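/- Let n ≥ 2 and let v : (0,∞) → [0,∞) be measurable with v(r) ≤ n ω_n r^{n-1} for H^1-a.e. r, such that F_v is a set of finite perimeter and finite volume. If rigidity holds (every spherically v-distributed set E with P(E) = P(F_v) satisfies H^n(E Δ (R F_v)) = 0 for some R ∈ O(n)), then the set I := {r > 0 : 0 < α_v^∧(r) ≤ α_v^∨(r) < π} is a (possibly unbounded) interval and α_v ∈ W^{1,1}_loc on the interior of I. -/

import Mathlib

/- Common definitions: geometric measure theory notions (density points, essential
boundary, perimeter, reduced boundary and measure-theoretic outer unit normal),
spherical and circular symmetrisation, BV and Sobolev-type notions. -/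

open MeasureTheory Metric Set Filter
open scoped ENNReal NNReal Topology RealInnerProductSpace

noncomputable section

/-- Euclidean space `ℝⁿ`. -/
abbrev Euc (n : ℕ) : Type := EuclideanSpace ℝ (Fin n)

/-- `ω_k`: the volume of the unit ball of `ℝ^k`. -/
def omegaBall (k : ℕ) : ℝ := (volume (ball (0 : Euc k) 1)).toReal

/-- The radial unit vector `x̂ = x/|x|`. -/
def hatv {n : ℕ} (x : Euc n) : Euc n := ‖x‖⁻¹ • x

/-- The first vector of the canonical basis. -/
def e1 (n : ℕ) (hn : 0 < n) : Euc n := EuclideanSpace.single ⟨0, hn⟩ 1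

/-- `E` has `n`-dimensional density `t` at `x`. -/
def DensityAt {n : ℕ} (E : Set (Euc n)) (x : Euc n) (t : ℝ≥0∞) : Prop :=
  Tendsto (fun ρ : ℝ => volume (E ∩ ball x ρ) / volume (ball x ρ)) (𝓝[>] (0:ℝ)) (𝓝 t)

/-- The essential boundary `∂ᵉE`: points of density neither `0` nor `1`. -/
def essBoundary {n : ℕ} (E : Set (Euc n)) : Set (Euc n) :=
  {x | ¬ DensityAt E x 0 ∧ ¬ DensityAt E x 1}

/-- The perimeter of `E` relative to `A`: `P(E;A) = H^{n-1}(∂ᵉE ∩ A)`. -/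
def perim {n : ℕ} (E A : Set (Euc n)) : ℝ≥0∞ := μH[(n : ℝ) - 1] (essBoundary E ∩ A)

/-- `ν` is the measure-theoretic outer unit normal of `E` at `x`: the blow-up of `E`
at `x` is the half space `{y : (y-x)·ν ≤ 0}` in density. -/
def HasMTNormal {n : ℕ} (E : Set (Euc n)) (x ν : Euc n) : Prop :=
  ‖ν‖ = 1 ∧
    Tendsto (fun ρ : ℝ =>
        volume ({y | y ∈ E ∧ 0 < ⟪y - x, ν⟫} ∩ ball x ρ) / volume (ball x ρ))
      (𝓝[>] (0:ℝ)) (𝓝 0) ∧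
    Tendsto (fun ρ : ℝ =>
        volume ({y | y ∉ E ∧ ⟪y - x, ν⟫ < 0} ∩ ball x ρ) / volume (ball x ρ))
      (𝓝[>] (0:ℝ)) (𝓝 0)

/-- The reduced boundary `∂*E`. -/
def redBoundary {n : ℕ} (E : Set (Euc n)) : Set (Euc n) := {x | ∃ ν, HasMTNormal E x ν}

/-- The measure-theoretic outer unit normal `ν^E`. -/
def mtNormal {n : ℕ} (E : Set (Euc n)) (x : Euc n) : Euc n :=
  haveI := Classical.propDecidable (∃ ν, HasMTNormal E x ν)
  if h : ∃ ν, HasMTNormal E x ν then h.choose else 0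

/-- The tangential component `ν∥^E(x) = ν^E(x) - (ν^E(x)·x̂)x̂` of the normal along
the sphere `∂B(|x|)`. -/
def nuPar {n : ℕ} (E : Set (Euc n)) (x : Euc n) : Euc n :=
  mtNormal E x - ⟪mtNormal E x, hatv x⟫ • hatv x

/-- The open geodesic ball (spherical cap) `B_β(r p)` in the sphere `∂B(0,r)`. -/
def capSet {n : ℕ} (p : Euc n) (r β : ℝ) : Set (Euc n) :=
  {x | x ∈ sphere (0 : Euc n) r ∧ Real.arccos ⟪hatv x, p⟫ < β}

/-- The geodesic sphere `S_β(r p)` in the sphere `∂B(0,r)`. -/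
def capSphere {n : ℕ} (p : Euc n) (r β : ℝ) : Set (Euc n) :=
  {x | x ∈ sphere (0 : Euc n) r ∧ Real.arccos ⟪hatv x, p⟫ = β}

/-- `E ⊆ ℝⁿ` is spherically `v`-distributed: `H^{n-1}(E ∩ ∂B(0,r)) = v r` for a.e. `r > 0`. -/
def SphDistrib {n : ℕ} (v : ℝ → ℝ) (E : Set (Euc n)) : Prop :=
  ∀ᵐ r ∂(volume.restrict (Ioi (0:ℝ))),
    μH[(n : ℝ) - 1] (E ∩ sphere (0 : Euc n) r) = ENNReal.ofReal (v r)

/-- The spherical symmetral `F_v` (determined by the angle function `α = α_v` and the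
direction `p`). -/
def sphSymm (n : ℕ) (α : ℝ → ℝ) (p : Euc n) : Set (Euc n) :=
  {x : Euc n | x ≠ 0 ∧ Real.arccos ⟪hatv x, p⟫ < α ‖x‖}

/-- `Φ(B × S^{n-1})`, for `B ⊆ (0,∞)`. -/
def sphShell (n : ℕ) (B : Set ℝ) : Set (Euc n) := {x : Euc n | x ≠ 0 ∧ ‖x‖ ∈ B}

/-- `v ∈ BV(0,∞)`: `v` is integrable on `(0,∞)` and has a representative of bounded
pointwise variation there. -/
def BVIoi (v : ℝ → ℝ) : Prop :=
  IntegrableOn v (Ioi (0:ℝ)) volume ∧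
    ∃ w : ℝ → ℝ, (∀ᵐ r ∂(volume.restrict (Ioi (0:ℝ))), w r = v r) ∧
      BoundedVariationOn w (Ioi (0:ℝ))

/-- `f ∈ W^{1,1}_loc(I)` for `I ⊆ ℝ`: `f` has a representative `w` which is locally
absolutely continuous on `I`, i.e. `w b - w a = ∫_a^b g` with `g` locally integrable on `I`. -/
def W11locOn (f : ℝ → ℝ) (I : Set ℝ) : Prop :=
  ∃ w g : ℝ → ℝ, (∀ᵐ r ∂(volume.restrict I), w r = f r) ∧
    LocallyIntegrableOn g I volume ∧
    ∀ a b : ℝ, uIcc a b ⊆ I → w b - w a = ∫ t in a..b, g t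

/-- `S ⊆ ℝ` has one-dimensional density `0` at `x`. -/
def RDensity0 (S : Set ℝ) (x : ℝ) : Prop :=
  Tendsto (fun ρ : ℝ => volume (S ∩ ball x ρ) / volume (ball x ρ)) (𝓝[>] (0:ℝ)) (𝓝 0)

/-- The approximate upper limit `f^∨(x)` (for bounded `f`). -/
def apSup (f : ℝ → ℝ) (x : ℝ) : ℝ := sInf {t : ℝ | RDensity0 {y | t < f y} x}

/-- The approximate lower limit `f^∧(x)` (for bounded `f`). -/
def apInf (f : ℝ → ℝ) (x : ℝ) : ℝ := sSup {t : ℝ | RDensity0 {y | f y < t} x}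

/-- `t` is the approximate limit of `f` at `x` with respect to `A`. -/
def apLimOn (f : ℝ → ℝ) (A : Set ℝ) (x t : ℝ) : Prop :=
  ∀ ε : ℝ, 0 < ε → RDensity0 ({y | ε < |f y - t|} ∩ A) x

/-- Density (with value `t`) at `x` of a subset `A` of the sphere `∂B(0,r)`,
with respect to the measure `H^{n-1}` on the sphere. -/
def SphDensityAt {n : ℕ} (A : Set (Euc n)) (r : ℝ) (x : Euc n) (t : ℝ≥0∞) : Prop :=
  Tendsto (fun ρ : ℝ =>
      μH[(n : ℝ) - 1] (A ∩ ball x ρ) / μH[(n : ℝ) - 1] (sphere (0 : Euc n) r ∩ ball x ρ))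
    (𝓝[>] (0:ℝ)) (𝓝 t)

/-- The essential boundary, within the sphere `∂B(0,r)`, of a subset `A` of that sphere. -/
def sphEssBoundary {n : ℕ} (A : Set (Euc n)) (r : ℝ) : Set (Euc n) :=
  {x | x ∈ sphere (0 : Euc n) r ∧ ¬ SphDensityAt A r x 0 ∧ ¬ SphDensityAt A r x 1}

/-- A pair of mutually singular measures `(σp, σm)` supported in `(0,∞)`, locally finite
there, representing the distributional derivative `Dξ = σp - σm` of `ξ` on `(0,∞)`. -/
def RepDeriv (ξ : ℝ → ℝ) (σp σm : Measure ℝ) : Prop :=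
  σp (Iic (0:ℝ)) = 0 ∧ σm (Iic (0:ℝ)) = 0 ∧
    (∀ K : Set ℝ, K ⊆ Ioi (0:ℝ) → IsCompact K → σp K < ⊤ ∧ σm K < ⊤) ∧
    σp.MutuallySingular σm ∧
    ∀ φ : ℝ → ℝ, ContDiff ℝ 1 φ → HasCompactSupport φ → tsupport φ ⊆ Ioi (0:ℝ) →
      (∫ r in Ioi (0:ℝ), ξ r * deriv φ r) = (∫ r, φ r ∂σm) - ∫ r, φ r ∂σp

/-- The density `ξ'` of the absolutely continuous part of `Dξ = σp - σm`. -/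
def acDeriv (σp σm : Measure ℝ) (r : ℝ) : ℝ :=
  (σp.rnDeriv volume r).toReal - (σm.rnDeriv volume r).toReal

/-- `p_E(r) = H^{n-2}(∂*E ∩ ∂B(0,r))` (as a real number). -/
def pSlice {n : ℕ} (E : Set (Euc n)) (r : ℝ) : ℝ :=
  (μH[(n : ℝ) - 2] (redBoundary E ∩ sphere (0 : Euc n) r)).toReal

/-- The projection `x ↦ x₁₂` onto the plane of the first two coordinates. -/
def pr12 {n : ℕ} (hn : 2 ≤ n) (x : Euc n) : Euc 2 :=
  (EuclideanSpace.equiv (Fin 2) ℝ).symm fun i => x ⟨i.1, lt_of_lt_of_le i.2 hn⟩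

/-- The projection `x ↦ x'` onto the remaining `n - 2` coordinates. -/
def prC {n : ℕ} (hn : 2 ≤ n) (x : Euc n) : Euc (n - 2) :=
  (EuclideanSpace.equiv (Fin (n - 2)) ℝ).symm fun i => x ⟨i.1 + 2, by have := i.2; omega⟩

/-- The circle `∂B((0,x'),r) ∩ Π_{x'}`, for `p = (r, x')`. -/
def circFiber {n : ℕ} (hn : 2 ≤ n) (p : ℝ × Euc (n - 2)) : Set (Euc n) :=
  {y : Euc n | prC hn y = p.2 ∧ ‖pr12 hn y‖ = p.1}

/-- The circular slice `E_{(r,x')}`, for `p = (r, x')`. -/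
def cslice {n : ℕ} (hn : 2 ≤ n) (E : Set (Euc n)) (p : ℝ × Euc (n - 2)) : Set (Euc n) :=
  E ∩ circFiber hn p

/-- `E` is circularly `ℓ`-distributed. -/
def CircDistrib {n : ℕ} (hn : 2 ≤ n) (ℓ : ℝ × Euc (n - 2) → ℝ) (E : Set (Euc n)) : Prop :=
  ∀ᵐ p ∂(volume.restrict ((Ioi (0:ℝ)) ×ˢ (univ : Set (Euc (n - 2))))),
    μH[(1:ℝ)] (cslice hn E p) = ENNReal.ofReal (ℓ p)

/-- The circular symmetral `F^ℓ`. -/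
def circSymm {n : ℕ} (hn : 2 ≤ n) (ℓ : ℝ × Euc (n - 2) → ℝ) : Set (Euc n) :=
  {x : Euc n | pr12 hn x ≠ 0 ∧
    Real.arccos ⟪hatv (pr12 hn x), e1 2 (by norm_num)⟫
      < ℓ (‖pr12 hn x‖, prC hn x) / (2 * ‖pr12 hn x‖)}

/-- `Φ₁₂(B × S¹)`, for `B ⊆ (0,∞) × ℝ^{n-2}`. -/
def cylSet {n : ℕ} (hn : 2 ≤ n) (B : Set (ℝ × Euc (n - 2))) : Set (Euc n) :=
  {x : Euc n | pr12 hn x ≠ 0 ∧ (‖pr12 hn x‖, prC hn x) ∈ B}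

/-- The component `ν₁₂∥^E(x) = ν₁₂^E(x) - (ν^E(x)·x̂₁₂)x̂₁₂` of the normal. -/
def nu12par {n : ℕ} (hn : 2 ≤ n) (E : Set (Euc n)) (x : Euc n) : Euc 2 :=
  pr12 hn (mtNormal E x) - ⟪pr12 hn (mtNormal E x), hatv (pr12 hn x)⟫ • hatv (pr12 hn x)

/-- Density (with value `t`) at `x` of a subset `A` of the circle `circFiber hn p`,
with respect to the measure `H¹` on that circle. -/
def CircDensityAt {n : ℕ} (hn : 2 ≤ n) (A : Set (Euc n)) (p : ℝ × Euc (n - 2)) (x : Euc n)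
    (t : ℝ≥0∞) : Prop :=
  Tendsto (fun ρ : ℝ => μH[(1:ℝ)] (A ∩ ball x ρ) / μH[(1:ℝ)] (circFiber hn p ∩ ball x ρ))
    (𝓝[>] (0:ℝ)) (𝓝 t)

/-- The essential boundary, within the circle `circFiber hn p`, of a subset `A`. -/
def circEssBoundary {n : ℕ} (hn : 2 ≤ n) (A : Set (Euc n)) (p : ℝ × Euc (n - 2)) :
    Set (Euc n) :=
  {x | x ∈ circFiber hn p ∧ ¬ CircDensityAt hn A p x 0 ∧ ¬ CircDensityAt hn A p x 1}

/-- `f` has locally bounded variation on the open set `Ω`: on every open `U` compactly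
contained in `Ω` the distributional gradient of `f` has finite total variation. -/
def BVlocOn {W : Type*} [NormedAddCommGroup W] [NormedSpace ℝ W] [MeasureSpace W]
    (f : W → ℝ) (Ω : Set W) : Prop :=
  LocallyIntegrableOn f Ω volume ∧
    ∀ U : Set W, IsOpen U → IsCompact (closure U) → closure U ⊆ Ω →
      ∃ C : ℝ, ∀ g : W → W, ContDiff ℝ 1 g → HasCompactSupport g → tsupport g ⊆ U →
        (∀ x, ‖g x‖ ≤ 1) →
        (∫ x in U, f x * LinearMap.trace ℝ W (fderiv ℝ g x).toLinearMap) ≤ C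

/-- `f ∈ W^{1,1}_loc(Ω)` for `Ω ⊆ (0,∞) × ℝ^m`: `f` has a locally integrable weak
gradient `(g1, g2)` on `Ω`. -/
def W11locProd {m : ℕ} (f : ℝ × Euc m → ℝ) (Ω : Set (ℝ × Euc m)) : Prop :=
  ∃ (g1 : ℝ × Euc m → ℝ) (g2 : ℝ × Euc m → Euc m),
    LocallyIntegrableOn f Ω volume ∧ LocallyIntegrableOn g1 Ω volume ∧
      LocallyIntegrableOn g2 Ω volume ∧
      ∀ φ : ℝ × Euc m → ℝ, ContDiff ℝ 1 φ → HasCompactSupport φ → tsupport φ ⊆ Ω →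
        ∀ y : ℝ × Euc m,
          (∫ x in Ω, f x * fderiv ℝ φ x y) = -∫ x in Ω, φ x * (g1 x * y.1 + ⟪g2 x, y.2⟫)

/-- A pair of mutually singular measures `(σp, σm)` supported in `Ω₀ = (0,∞) × ℝ^m`,
locally finite there, representing the partial distributional derivative
`D_r ξ = σp - σm` of `ξ` in the radial variable. -/
def RepDerivR {m : ℕ} (ξ : ℝ × Euc m → ℝ) (σp σm : Measure (ℝ × Euc m)) : Prop :=
  σp ((Ioi (0:ℝ)) ×ˢ (univ : Set (Euc m)))ᶜ = 0 ∧
    σm ((Ioi (0:ℝ)) ×ˢ (univ : Set (Euc m)))ᶜ = 0 ∧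
    (∀ K : Set (ℝ × Euc m), K ⊆ (Ioi (0:ℝ)) ×ˢ univ → IsCompact K → σp K < ⊤ ∧ σm K < ⊤) ∧
    σp.MutuallySingular σm ∧
    ∀ φ : ℝ × Euc m → ℝ, ContDiff ℝ 1 φ → HasCompactSupport φ →
      tsupport φ ⊆ (Ioi (0:ℝ)) ×ˢ (univ : Set (Euc m)) →
      (∫ x in (Ioi (0:ℝ)) ×ˢ (univ : Set (Euc m)), ξ x * fderiv ℝ φ x ((1:ℝ), (0 : Euc m)))
        = (∫ x, φ x ∂σm) - ∫ x, φ x ∂σp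

/-- A polar representation `(τ, h)` (with `‖h‖ = 1` `τ`-a.e.) of the distributional
gradient `D_{x'} f = h τ` of `f` in the `x'` variables, on `Ω₀ = (0,∞) × ℝ^m`. -/
def RepDerivX {m : ℕ} (f : ℝ × Euc m → ℝ) (τ : Measure (ℝ × Euc m))
    (h : ℝ × Euc m → Euc m) : Prop :=
  τ ((Ioi (0:ℝ)) ×ˢ (univ : Set (Euc m)))ᶜ = 0 ∧
    (∀ K : Set (ℝ × Euc m), K ⊆ (Ioi (0:ℝ)) ×ˢ univ → IsCompact K → τ K < ⊤) ∧
    (∀ᵐ x ∂τ, ‖h x‖ = 1) ∧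
    ∀ φ : ℝ × Euc m → ℝ, ContDiff ℝ 1 φ → HasCompactSupport φ →
      tsupport φ ⊆ (Ioi (0:ℝ)) ×ˢ (univ : Set (Euc m)) →
      ∀ y : Euc m,
        (∫ x in (Ioi (0:ℝ)) ×ˢ (univ : Set (Euc m)), f x * fderiv ℝ φ x ((0:ℝ), y))
          = -∫ x, φ x * ⟪h x, y⟫ ∂τ

/-- The barycentre function `b_E(r) = r^{1-n} ∫_{E_r} x̂ dH^{n-1}`. -/
def bary (n : ℕ) (E : Set (Euc n)) (r : ℝ) : Euc n :=
  (r ^ (n - 1))⁻¹ • ∫ x in E ∩ sphere (0 : Euc n) r, hatv x ∂μH[(n : ℝ) - 1]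

/-- The average direction `d_E(r)` of the slice `E_r`. -/
def avgDir (n : ℕ) (α : ℝ → ℝ) (E : Set (Euc n)) (r : ℝ) : Euc n :=
  (omegaBall (n - 1) * Real.sin (α r) ^ (n - 1) * r ^ (n - 1))⁻¹ •
    ∫ x in E ∩ sphere (0 : Euc n) r, hatv x ∂μH[(n : ℝ) - 1]

end




theorem finrank_Euc (n : ℕ) : Module.finrank ℝ (Euc n) = n := by simp

/-- The sector over the radii `A` and the directions `N`. -/
def sector {n : ℕ} (A : Set ℝ) (N : Set (Euc n)) : Set (Euc n) :=
  {x | x ≠ 0 ∧ ‖x‖ ∈ A ∧ hatv x ∈ N}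

theorem norm_hatv {n : ℕ} {x : Euc n} (hx : x ≠ 0) : ‖hatv x‖ = 1 := by
  unfold hatv
  rw [norm_smul, norm_inv, norm_norm, inv_mul_cancel₀ (norm_ne_zero_iff.2 hx)]

theorem hatv_smul {n : ℕ} {p : Euc n} (hp : ‖p‖ = 1) {r : ℝ} (hr : 0 < r) : hatv (r • p) = p := by
  unfold hatv
  rw [norm_smul, hp, Real.norm_of_nonneg hr.le, mul_one, smul_smul, inv_mul_cancel₀ hr.ne', one_smul]

theorem smul_hatv {n : ℕ} (x : Euc n) (hx : x ≠ 0) : ‖x‖ • hatv x = x := by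
  unfold hatv
  rw [smul_smul, mul_inv_cancel₀ (norm_ne_zero_iff.2 hx), one_smul]

theorem measurable_hatv {n : ℕ} : Measurable (hatv : Euc n → Euc n) := by
  unfold hatv; fun_prop

theorem sector_measurable {n : ℕ} {A : Set ℝ} (hA : MeasurableSet A) {N : Set (Euc n)}
    (hN : MeasurableSet N) : MeasurableSet (sector A N) := by
  have : sector A N = {0}ᶜ ∩ (norm ⁻¹' A ∩ hatv ⁻¹' N) := by
    ext x; simp [sector]
  rw [this]
  exact (measurableSet_singleton _).compl.inter
    ((measurable_norm hA).inter (measurable_hatv hN))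

theorem polar_volume {n : ℕ} {A : Set ℝ} (hA : MeasurableSet A) {N : Set (Euc n)}
    (hN : MeasurableSet N) :
    volume (sector A N) = (volume : Measure (Euc n)).toSphere (Subtype.val ⁻¹' N) *
      ∫⁻ r in A ∩ Ioi 0, ENNReal.ofReal (r ^ (n - 1)) := by
  have h := Measure.measurePreserving_homeomorphUnitSphereProd (E := Euc n) volume
  have hm : MeasurableSet ((Subtype.val ⁻¹' N : Set (sphere (0 : Euc n) 1)) ×ˢ
      (Subtype.val ⁻¹' A : Set (Ioi (0:ℝ)))) :=
    (measurable_subtype_coe hN).prod (measurable_subtype_coe hA)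
  have h1 := h.measure_preimage hm.nullMeasurableSet
  rw [Measure.prod_prod, comap_subtype_coe_apply (measurableSet_singleton _).compl] at h1
  have h2 : (Subtype.val '' ((homeomorphUnitSphereProd (Euc n)) ⁻¹'
      ((Subtype.val ⁻¹' N : Set (sphere (0 : Euc n) 1)) ×ˢ
      (Subtype.val ⁻¹' A : Set (Ioi (0:ℝ)))))) = sector A N := by
    ext x
    constructor
    · rintro ⟨y, hy, rfl⟩
      exact ⟨y.2, by simpa using hy.2, by simpa [hatv] using hy.1⟩
    · rintro ⟨h0, h1, h2⟩
      exact ⟨⟨x, h0⟩, ⟨by simpa [hatv] using h2, by simpa using h1⟩, rfl⟩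
  rw [h2] at h1
  rw [h1, finrank_Euc]
  congr 1
  rw [Measure.volumeIoiPow, withDensity_apply _ (measurable_subtype_coe hA),
    setLIntegral_subtype measurableSet_Ioi _ fun a : ℝ ↦ .ofReal (a ^ (n-1))]
  simp [inter_comm]

theorem volume_sector_null {n : ℕ} {A : Set ℝ} (hA : volume (A ∩ Ioi 0) = 0) :
    volume {x : Euc n | x ≠ 0 ∧ ‖x‖ ∈ A} = 0 := by
  set B := toMeasurable volume (A ∩ Ioi (0:ℝ))
  have hB : volume B = 0 := by rw [measure_toMeasurable, hA]
  refine measure_mono_null (t := sector B univ) ?_ ?_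
  · rintro x ⟨hx, hxA⟩
    exact ⟨hx, subset_toMeasurable _ _ ⟨hxA, norm_pos_iff.2 hx⟩, trivial⟩
  · rw [polar_volume (measurableSet_toMeasurable _ _) MeasurableSet.univ]
    rw [setLIntegral_measure_zero _ _ (measure_mono_null inter_subset_left hB), mul_zero]

theorem sector_compare {n : ℕ} {A : Set ℝ} (hA : MeasurableSet A) {N : Set (Euc n)}
    (hN : MeasurableSet N) {r ρ : ℝ} (hρ : 0 < ρ) (hρr : ρ ≤ r / 2) (hAs : A ⊆ Ioo (r - ρ) (r + ρ)) :
    volume A * volume (sector (Ioo (r - ρ) (r + ρ)) N) ≤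
      ENNReal.ofReal (4 ^ (n - 1) * (2 * ρ)) * volume (sector A N) := by
  have hr : 0 < r := by linarith
  rw [polar_volume hA hN, polar_volume measurableSet_Ioo hN]
  set s := (volume : Measure (Euc n)).toSphere (Subtype.val ⁻¹' N)
  have h1 : ∫⁻ x in Ioo (r - ρ) (r + ρ) ∩ Ioi 0, ENNReal.ofReal (x ^ (n - 1)) ≤
      ENNReal.ofReal ((2 * r) ^ (n-1)) * ENNReal.ofReal (2 * ρ) := by
    calc _ ≤ ∫⁻ x in Ioo (r - ρ) (r + ρ) ∩ Ioi 0, ENNReal.ofReal ((2 * r) ^ (n - 1)) := by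
          refine setLIntegral_mono' (measurableSet_Ioo.inter measurableSet_Ioi) fun x hx => ?_
          refine ENNReal.ofReal_le_ofReal (pow_le_pow_left₀ (le_of_lt hx.2) ?_ _)
          linarith [hx.1.2]
      _ ≤ _ := by
          rw [setLIntegral_const]
          gcongr
          refine (measure_mono inter_subset_left).trans ?_
          rw [Real.volume_Ioo]
          exact ENNReal.ofReal_le_ofReal (by linarith)
  have h2 : ENNReal.ofReal ((r/2) ^ (n-1)) * volume A ≤
      ∫⁻ x in A ∩ Ioi 0, ENNReal.ofReal (x ^ (n - 1)) := by
    have hAA : A ∩ Ioi 0 = A := by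
      apply inter_eq_left.2
      intro x hx
      have := (hAs hx).1
      simp only [mem_Ioi]; linarith
    rw [hAA, ← setLIntegral_const]
    refine setLIntegral_mono' hA fun x hx => ?_
    refine ENNReal.ofReal_le_ofReal (pow_le_pow_left₀ (by positivity) ?_ _)
    have := (hAs hx).1
    linarith
  calc _ ≤ volume A * (s * (ENNReal.ofReal ((2 * r) ^ (n-1)) * ENNReal.ofReal (2 * ρ))) := by gcongr
    _ = ENNReal.ofReal (4 ^ (n - 1) * (2 * ρ)) * (s * (ENNReal.ofReal ((r/2) ^ (n-1)) * volume A)) := by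
      have : (2 * r) ^ (n-1) = 4 ^ (n-1) * (r/2)^(n-1) := by
        rw [← mul_pow]; congr 1; ring
      rw [this, ENNReal.ofReal_mul (p := 4 ^ (n-1)) (q := (r/2)^(n-1)) (by positivity),
        ENNReal.ofReal_mul (p := 4 ^ (n-1)) (q := 2 * ρ) (by positivity)]
      generalize ENNReal.ofReal ((r/2) ^ (n-1)) = X
      generalize ENNReal.ofReal (2 * ρ) = Y
      ring
    _ ≤ _ := by gcongr


theorem volume_ball_Euc {n : ℕ} (x : Euc n) {ρ : ℝ} (hρ : 0 < ρ) :
    volume (ball x ρ) = ENNReal.ofReal (ρ ^ n) * volume (ball (0 : Euc n) 1) := by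
  rw [Measure.addHaar_ball_of_pos _ _ hρ, finrank_Euc]

theorem densityAt_congr {n : ℕ} {E E' : Set (Euc n)} {x : Euc n} {ε : ℝ} (hε : 0 < ε)
    (h : ∀ᵐ z ∂(volume : Measure (Euc n)), z ∈ ball x ε → (z ∈ E ↔ z ∈ E')) (t : ℝ≥0∞) :
    DensityAt E x t ↔ DensityAt E' x t := by
  unfold DensityAt
  refine tendsto_congr' ?_
  filter_upwards [Ioo_mem_nhdsGT hε] with ρ hρ
  congr 1
  refine measure_congr ?_
  filter_upwards [h] with z hz
  refine propext ?_
  change (z ∈ E ∧ z ∈ ball x ρ) ↔ (z ∈ E' ∧ z ∈ ball x ρ)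
  constructor
  · rintro ⟨h1, h2⟩; exact ⟨(hz (ball_subset_ball hρ.2.le h2)).1 h1, h2⟩
  · rintro ⟨h1, h2⟩; exact ⟨(hz (ball_subset_ball hρ.2.le h2)).2 h1, h2⟩

theorem densityAt_empty {n : ℕ} (x : Euc n) : DensityAt ∅ x 0 := by
  unfold DensityAt; simp

theorem densityAt_univ {n : ℕ} (x : Euc n) : DensityAt univ x 1 := by
  unfold DensityAt
  refine tendsto_const_nhds.congr' ?_
  filter_upwards [self_mem_nhdsWithin] with ρ hρ
  rw [univ_inter, ENNReal.div_self (measure_ball_pos _ _ hρ).ne' measure_ball_lt_top.ne]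

theorem densityAt_compl {n : ℕ} {E : Set (Euc n)} (hE : MeasurableSet E) {x : Euc n}
    (h : DensityAt E x 1) : DensityAt Eᶜ x 0 := by
  unfold DensityAt at *
  have h2 := ENNReal.Tendsto.sub (tendsto_const_nhds (x := (1:ℝ≥0∞))) h (Or.inl ENNReal.one_ne_top)
  rw [tsub_self] at h2
  refine h2.congr' ?_
  filter_upwards [self_mem_nhdsWithin] with ρ hρ
  have hp := (measure_ball_pos (volume : Measure (Euc n)) x hρ).ne'
  have ht := (measure_ball_lt_top (μ := (volume : Measure (Euc n))) (x := x) (r := ρ)).ne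
  have h3 : volume (Eᶜ ∩ ball x ρ) = volume (ball x ρ) - volume (E ∩ ball x ρ) := by
    rw [inter_comm E, ← measure_diff inter_subset_left (measurableSet_ball.inter hE).nullMeasurableSet]
    · congr 1; ext z; simp; tauto
    · exact ne_top_of_le_ne_top ht (measure_mono inter_subset_left)
  rw [h3, ENNReal.sub_div (fun _ _ => hp), ENNReal.div_self hp ht]

theorem mem_essBoundary_of {n : ℕ} {E : Set (Euc n)} (hE : MeasurableSet E) {x : Euc n}
    (h0 : ¬ DensityAt E x 0) (h1 : ¬ DensityAt Eᶜ x 0) : x ∈ essBoundary E :=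
  ⟨h0, fun h => h1 (densityAt_compl hE h)⟩

theorem essBoundary_congr {n : ℕ} {E E' : Set (Euc n)} {x : Euc n} {ε : ℝ} (hε : 0 < ε)
    (h : ∀ᵐ z ∂(volume : Measure (Euc n)), z ∈ ball x ε → (z ∈ E ↔ z ∈ E')) :
    x ∈ essBoundary E ↔ x ∈ essBoundary E' := by
  simp only [essBoundary, mem_setOf_eq, densityAt_congr hε h]

theorem not_mem_essBoundary_of_notMem {n : ℕ} {E : Set (Euc n)} {x : Euc n} {ε : ℝ} (hε : 0 < ε)
    (h : ∀ᵐ z ∂(volume : Measure (Euc n)), z ∈ ball x ε → z ∉ E) : x ∉ essBoundary E := by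
  rintro ⟨h0, -⟩
  refine h0 ((densityAt_congr (E' := ∅) hε ?_ 0).2 (densityAt_empty x))
  filter_upwards [h] with z hz hzb
  simp [hz hzb]

theorem not_mem_essBoundary_of_mem {n : ℕ} {E : Set (Euc n)} {x : Euc n} {ε : ℝ} (hε : 0 < ε)
    (h : ∀ᵐ z ∂(volume : Measure (Euc n)), z ∈ ball x ε → z ∈ E) : x ∉ essBoundary E := by
  rintro ⟨-, h0⟩
  refine h0 ((densityAt_congr (E' := univ) hε ?_ 1).2 (densityAt_univ x))
  filter_upwards [h] with z hz hzb
  simp [hz hzb]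

theorem norm_sub_smul_le {n : ℕ} (x p : Euc n) (hx : x ≠ 0) {r : ℝ} (hr : 0 ≤ r) :
    ‖x - r • p‖ ≤ |‖x‖ - r| + r * ‖hatv x - p‖ := by
  have h : x - r • p = (‖x‖ - r) • hatv x + r • (hatv x - p) := by
    rw [sub_smul, smul_sub, smul_hatv x hx]; abel
  rw [h]
  refine (norm_add_le _ _).trans ?_
  rw [norm_smul, norm_smul, norm_hatv hx, Real.norm_of_nonneg hr, Real.norm_eq_abs, mul_one]

/-- The small angular neighbourhoods used in the cone lemma. -/
def coneN {n : ℕ} (p d : Euc n) (K κ ρ : ℝ) : Set (Euc n) :=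
  {q | ‖q - p‖ < K * ρ ∧ κ * ρ < ⟪q - p, d⟫}

theorem coneN_measurable {n : ℕ} (p d : Euc n) (K κ ρ : ℝ) : MeasurableSet (coneN p d K κ ρ) := by
  refine IsOpen.measurableSet ?_
  have h1 : IsOpen {q : Euc n | ‖q - p‖ < K * ρ} := isOpen_lt (by fun_prop) (by fun_prop)
  have h2 : IsOpen {q : Euc n | κ * ρ < ⟪q - p, d⟫} := isOpen_lt (by fun_prop) (by fun_prop)
  exact h1.inter h2

set_option maxHeartbeats 1000000 in
theorem cone_ball_subset {n : ℕ} {p d : Euc n} (hp : ‖p‖ = 1) (hd : ‖d‖ = 1)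
    (hpd : |⟪p, d⟫| < 1) {r : ℝ} (hr : 0 < r) :
    ∃ κ c : ℝ, 0 < κ ∧ 0 < c ∧ ∃ ρ1 > 0, ∃ u : Euc n, ∀ ρ, 0 < ρ → ρ < ρ1 →
      ball (r • (p + ρ • u)) (r * (c * ρ)) ⊆ sector (Ioo (r - ρ) (r + ρ)) (coneN p d 5 κ ρ) := by
  set s := ⟪p, d⟫ with hs
  set u : Euc n := d - s • p with hu
  set τ := 1 - s ^ 2 with hτ
  have hτ0 : 0 < τ := by
    have := (sq_lt_one_iff_abs_lt_one s).2 hpd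
    linarith
  have hτ1 : τ ≤ 1 := by nlinarith [sq_nonneg s]
  have hpp : ⟪p, p⟫ = 1 := by rw [real_inner_self_eq_norm_sq, hp]; norm_num
  have hdd : ⟪d, d⟫ = 1 := by rw [real_inner_self_eq_norm_sq, hd]; norm_num
  have hdp : ⟪d, p⟫ = s := by rw [real_inner_comm]
  have hpu : ⟪p, u⟫ = 0 := by
    rw [hu, inner_sub_right, inner_smul_right, hpp, ← hs]; ring
  have hud : ⟪u, d⟫ = τ := by
    rw [hu, inner_sub_left, inner_smul_left, hdd, ← hs, hτ]; simp; ring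
  have huu : ‖u‖ ^ 2 = τ := by
    rw [← real_inner_self_eq_norm_sq]
    nth_rewrite 2 [hu]
    rw [inner_sub_right, inner_smul_right, hud, real_inner_comm, hpu]; ring
  have hu1 : ‖u‖ ≤ 1 := by nlinarith [norm_nonneg u]
  refine ⟨τ / 2, min (τ / 8) (1 / (4 * r)), by positivity, by positivity,
    min (τ / 8) (1 / (4 * r)), by positivity, u, fun ρ hρ hρ1 => ?_⟩
  set c := min (τ / 8) (1 / (4 * r)) with hc
  have hc0 : 0 < c := by positivity
  have hc1 : c ≤ τ / 8 := min_le_left _ _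
  have hc2 : r * c ≤ 1 / 4 := by
    have : c ≤ 1 / (4 * r) := min_le_right _ _
    calc r * c ≤ r * (1 / (4 * r)) := by gcongr
      _ = 1/4 := by field_simp
  intro x hx
  set z := r⁻¹ • x with hz
  have hxz : x = r • z := by rw [hz, smul_smul, mul_inv_cancel₀ hr.ne', one_smul]
  set w := z - (p + ρ • u) with hw
  have hwn : ‖w‖ < c * ρ := by
    rw [mem_ball, dist_eq_norm, hxz, ← smul_sub, norm_smul, Real.norm_of_nonneg hr.le] at hx
    exact lt_of_mul_lt_mul_left hx hr.le
  have hzw : z = p + ρ • u + w := by rw [hw]; abel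
  have hpu2 : ‖p + ρ • u‖ ^ 2 = 1 + ρ ^ 2 * τ := by
    rw [norm_add_sq_real, hp, inner_smul_right, hpu, norm_smul, mul_pow, huu, Real.norm_eq_abs, sq_abs]; ring
  have hA : |‖p + ρ • u‖ - 1| ≤ ρ ^ 2 := by
    have := norm_nonneg (p + ρ • u)
    rw [abs_le]; constructor
    · nlinarith [mul_pos (pow_pos hρ 2) hτ0]
    · nlinarith [mul_pos (pow_pos hρ 2) hτ0]
  have hB : |‖z‖ - 1| ≤ ρ ^ 2 + c * ρ := by
    have h1 : |‖z‖ - ‖p + ρ • u‖| ≤ ‖w‖ := abs_norm_sub_norm_le _ _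
    rw [abs_le] at *
    constructor <;> linarith [h1.1, h1.2, hA.1, hA.2]
  have hρc : ρ ^ 2 ≤ c * ρ := by nlinarith
  have hB' : |‖z‖ - 1| ≤ 2 * c * ρ := by linarith
  have hcρ : c * ρ < 1/8 := by nlinarith
  have hz0 : 0 < ‖z‖ := by have := (abs_le.1 hB').1; nlinarith
  have hzne : z ≠ 0 := norm_pos_iff.1 hz0
  have hxne : x ≠ 0 := by rw [hxz]; exact smul_ne_zero hr.ne' hzne
  have hxn : ‖x‖ = r * ‖z‖ := by rw [hxz, norm_smul, Real.norm_of_nonneg hr.le]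
  have hhat : hatv x = hatv z := by
    unfold hatv; rw [hxn, hxz, smul_smul]; congr 1; field_simp
  have hhz : ‖hatv z - z‖ = |‖z‖ - 1| := by
    have : hatv z - z = (1 - ‖z‖) • hatv z := by rw [sub_smul, one_smul, smul_hatv z hzne]
    rw [this, norm_smul, norm_hatv hzne, mul_one, Real.norm_eq_abs, abs_sub_comm]
  refine ⟨hxne, ?_, ?_, ?_⟩
  · rw [hxn]
    have h1 := abs_le.1 hB'
    have h5 : r * (2 * c * ρ) < ρ := by nlinarith
    have h6 : r * (‖z‖ - 1) ≤ r * (2 * c * ρ) := mul_le_mul_of_nonneg_left h1.2 hr.le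
    have h7 : r * (-(2 * c * ρ)) ≤ r * (‖z‖ - 1) := mul_le_mul_of_nonneg_left h1.1 hr.le
    constructor <;> linarith
  · rw [hhat]
    have h2 : hatv z - p = (hatv z - z) + (ρ • u + w) := by rw [hzw]; abel
    rw [h2]
    calc _ ≤ ‖hatv z - z‖ + (‖ρ • u‖ + ‖w‖) := (norm_add_le _ _).trans (by gcongr; exact norm_add_le _ _)
      _ < 5 * ρ := by
        rw [hhz, norm_smul ρ u, Real.norm_of_nonneg hρ.le]
        have h5 : ρ * ‖u‖ ≤ ρ * 1 := mul_le_mul_of_nonneg_left hu1 hρ.le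
        have h6 : c * ρ ≤ 1 * ρ := mul_le_mul_of_nonneg_right (by linarith) hρ.le
        linarith
  · rw [hhat]
    have h2 : hatv z - p = (hatv z - z) + ρ • u + w := by rw [hzw]; abel
    rw [h2, inner_add_left, inner_add_left, inner_smul_left, hud]
    have h3 := (abs_le.1 (abs_real_inner_le_norm (hatv z - z) d)).1
    have h4 := (abs_le.1 (abs_real_inner_le_norm w d)).1
    rw [hd, mul_one] at h3 h4
    rw [hhz] at h3
    simp only [conj_trivial]
    have h5 : c * ρ ≤ τ / 8 * ρ := mul_le_mul_of_nonneg_right hc1 hρ.le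
    have h6 : 0 < τ * ρ := by positivity
    linarith

theorem cone_density {n : ℕ} (hn : 1 ≤ n) {p d : Euc n} (hp : ‖p‖ = 1) (hd : ‖d‖ = 1)
    (hpd : |⟪p, d⟫| < 1) {r : ℝ} (hr : 0 < r) {E : Set (Euc n)} (hE : DensityAt E (r • p) 0)
    {A : Set ℝ} (hA : MeasurableSet A)
    (h : ∀ κ : ℝ, 0 < κ → ∀ᶠ ρ in 𝓝[>] (0:ℝ), ∀ x : Euc n, x ≠ 0 → ‖x‖ ∈ A → |‖x‖ - r| < ρ →
      ‖hatv x - p‖ < 5 * ρ → κ * ρ < ⟪hatv x - p, d⟫ → x ∈ E) : RDensity0 A r := by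
  obtain ⟨κ, c, hκ, hc, ρ1, hρ1, u, hu⟩ := cone_ball_subset hp hd hpd hr
  set C := 1 + 5 * r with hC
  have hC0 : 0 < C := by positivity
  set ω := volume (ball (0 : Euc n) 1) with hω
  have hω0 : ω ≠ 0 := (measure_ball_pos _ _ one_pos).ne'
  have hωt : ω ≠ ⊤ := measure_ball_lt_top.ne
  set M : ℝ≥0∞ := ENNReal.ofReal (4 ^ (n-1) * C ^ n / (r * c) ^ n) with hM
  have hlim : Tendsto (fun ρ : ℝ => M * (volume (E ∩ ball (r • p) (C * ρ)) /
      volume (ball (r • p) (C * ρ)))) (𝓝[>] (0:ℝ)) (𝓝 0) := by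
    have h1 : Tendsto (fun ρ : ℝ => C * ρ) (𝓝[>] (0:ℝ)) (𝓝[>] (0:ℝ)) := by
      refine tendsto_nhdsWithin_iff.2 ⟨?_, ?_⟩
      · have : Tendsto (fun ρ : ℝ => C * ρ) (𝓝 (0:ℝ)) (𝓝 (C * 0)) := by
          exact (continuous_const.mul continuous_id).tendsto 0
        rw [mul_zero] at this
        exact this.mono_left nhdsWithin_le_nhds
      · filter_upwards [self_mem_nhdsWithin] with ρ hρ
        exact mul_pos hC0 hρ
    have := ENNReal.Tendsto.const_mul (a := M) (hE.comp h1) (Or.inr ENNReal.ofReal_ne_top)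
    rw [mul_zero] at this
    exact this
  refine tendsto_of_tendsto_of_tendsto_of_le_of_le' tendsto_const_nhds hlim
    (Eventually.of_forall fun _ => zero_le) ?_
  have hmin : 0 < min ρ1 (r / 2) := by positivity
  filter_upwards [h κ hκ, Ioo_mem_nhdsGT hmin] with ρ hρE hρ
  have hρ0 : 0 < ρ := hρ.1
  have hρ1' : ρ < ρ1 := hρ.2.trans_le (min_le_left _ _)
  have hρr : ρ ≤ r / 2 := hρ.2.le.trans (min_le_right _ _)
  have hB : ball r ρ = Ioo (r - ρ) (r + ρ) := Real.ball_eq_Ioo r ρ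
  set A' := A ∩ ball r ρ with hA'
  have hA'm : MeasurableSet A' := hA.inter measurableSet_ball
  have h1 := sector_compare hA'm (coneN_measurable p d 5 κ ρ) hρ0 hρr (by rw [← hB]; exact inter_subset_right)
  have h2 : sector A' (coneN p d 5 κ ρ) ⊆ E ∩ ball (r • p) (C * ρ) := by
    rintro x ⟨hx0, hxA, hx1, hx2⟩
    have h3 : |‖x‖ - r| < ρ := by
      have := hxA.2; rwa [mem_ball, Real.dist_eq] at this
    refine ⟨hρE x hx0 hxA.1 h3 hx1 hx2, ?_⟩
    rw [mem_ball, dist_eq_norm]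
    refine (norm_sub_smul_le x p hx0 hr.le).trans_lt ?_
    rw [hC]; nlinarith
  have h3 := measure_mono (μ := volume) (hu ρ hρ0 hρ1')
  rw [volume_ball_Euc _ (by positivity), ← hω] at h3
  rw [volume_ball_Euc _ (by positivity), ← hω, hB, Real.volume_Ioo]
  set V := volume (E ∩ ball (r • p) (C * ρ))
  set a := volume A'
  have h4 : a * (ENNReal.ofReal ((r * (c * ρ)) ^ n) * ω) ≤ ENNReal.ofReal (4 ^ (n - 1) * (2 * ρ)) * V := by
    refine le_trans ?_ (h1.trans ?_)
    · gcongr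
    · gcongr
      exact measure_mono h2
  have e1 : r + ρ - (r - ρ) = 2 * ρ := by ring
  rw [e1]
  have hρn : 0 < ρ ^ n := by positivity
  refine ENNReal.div_le_of_le_mul ?_
  have hX0 : ENNReal.ofReal ((r * (c * ρ)) ^ n) * ω ≠ 0 :=
    mul_ne_zero (by rw [Ne, ENNReal.ofReal_eq_zero, not_le]; positivity) hω0
  have hXt : ENNReal.ofReal ((r * (c * ρ)) ^ n) * ω ≠ ⊤ := ENNReal.mul_ne_top ENNReal.ofReal_ne_top hωt
  refine ((ENNReal.le_div_iff_mul_le (Or.inl hX0) (Or.inl hXt)).2 h4).trans (le_of_eq ?_)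
  rw [hM]
  have : 4 ^ (n-1) * C ^ n / (r * c) ^ n = (4 ^ (n-1) * (C * ρ) ^ n) / (r * (c * ρ)) ^ n := by
    rw [← mul_assoc r c ρ, mul_pow (r * c), mul_pow C]
    field_simp
  rw [this, ENNReal.ofReal_div_of_pos (by positivity),
    ENNReal.ofReal_mul (p := 4 ^ (n-1)) (q := 2 * ρ) (by positivity),
    ENNReal.ofReal_mul (p := 4 ^ (n-1)) (q := (C * ρ) ^ n) (by positivity)]
  have hp1 : ENNReal.ofReal ((C * ρ) ^ n) ≠ 0 := by rw [Ne, ENNReal.ofReal_eq_zero, not_le]; positivity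
  have hp2 : ENNReal.ofReal ((C * ρ) ^ n) ≠ ⊤ := ENNReal.ofReal_ne_top
  have hp3 : ENNReal.ofReal ((r * (c * ρ)) ^ n) ≠ 0 := by rw [Ne, ENNReal.ofReal_eq_zero, not_le]; positivity
  have hp4 : ENNReal.ofReal ((r * (c * ρ)) ^ n) ≠ ⊤ := ENNReal.ofReal_ne_top
  generalize ENNReal.ofReal ((C * ρ) ^ n) = P at *
  generalize ENNReal.ofReal ((r * (c * ρ)) ^ n) = Q at *
  generalize ENNReal.ofReal (2 * ρ) = T
  generalize ENNReal.ofReal (4 ^ (n-1)) = D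
  simp only [div_eq_mul_inv]
  rw [ENNReal.mul_inv (Or.inl hp1) (Or.inl hp2), ENNReal.mul_inv (Or.inl hp3) (Or.inl hp4)]
  calc D * T * V * (Q⁻¹ * ω⁻¹) = (D * T * V * (Q⁻¹ * ω⁻¹)) * 1 := by ring
    _ = (D * T * V * (Q⁻¹ * ω⁻¹)) * (P * P⁻¹) := by rw [ENNReal.mul_inv_cancel hp1 hp2]
    _ = _ := by ring


/-- The set whose slices are spherical caps with direction `d r` and height `β r`. -/
def capE {n : ℕ} (d : ℝ → Euc n) (β : ℝ → ℝ) : Set (Euc n) :=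
  {x | x ≠ 0 ∧ β ‖x‖ < ⟪hatv x, d ‖x‖⟫}

/-- The unit spherical cap. -/
def ucap {n : ℕ} (d : Euc n) (y : ℝ) : Set (Euc n) := {q | ‖q‖ = 1 ∧ y < ⟪q, d⟫}

/-- The level sets of the height on the unit sphere. -/
def ulev {n : ℕ} (d : Euc n) (y : ℝ) : Set (Euc n) := {q | ‖q‖ = 1 ∧ ⟪q, d⟫ = y}

theorem norm_e1 {n : ℕ} (hn : 0 < n) : ‖e1 n hn‖ = 1 := by
  unfold e1; simp

theorem abs_inner_le_one {n : ℕ} {p d : Euc n} (hp : ‖p‖ = 1) (hd : ‖d‖ = 1) : |⟪p, d⟫| ≤ 1 := by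
  have := abs_real_inner_le_norm p d
  rwa [hp, hd, mul_one] at this

theorem arccos_lt_iff_cos_lt {x a : ℝ} (hx : |x| ≤ 1) (ha : a ∈ Icc 0 Real.pi) :
    Real.arccos x < a ↔ Real.cos a < x := by
  rw [abs_le] at hx
  constructor
  · intro h
    have := Real.strictAntiOn_cos ⟨Real.arccos_nonneg x, Real.arccos_le_pi x⟩ ha h
    rwa [Real.cos_arccos hx.1 hx.2] at this
  · intro h
    by_contra! h2
    have := Real.strictAntiOn_cos.antitoneOn ha ⟨Real.arccos_nonneg x, Real.arccos_le_pi x⟩ h2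
    rw [Real.cos_arccos hx.1 hx.2] at this
    linarith

theorem sphSymm_eq {n : ℕ} {α : ℝ → ℝ} (hα : ∀ r, α r ∈ Icc (0:ℝ) Real.pi) {p : Euc n} (hp : ‖p‖ = 1) :
    sphSymm n α p = capE (fun _ => p) (fun r => Real.cos (α r)) := by
  ext x
  unfold sphSymm capE
  constructor
  · rintro ⟨h0, h⟩
    exact ⟨h0, (arccos_lt_iff_cos_lt (abs_inner_le_one (norm_hatv h0) hp) (hα _)).1 h⟩
  · rintro ⟨h0, h⟩
    exact ⟨h0, (arccos_lt_iff_cos_lt (abs_inner_le_one (norm_hatv h0) hp) (hα _)).2 h⟩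

theorem ucap_scale {n : ℕ} (d : ℝ → Euc n) (β : ℝ → ℝ) {r : ℝ} (hr : 0 < r) :
    capE d β ∩ sphere 0 r = (fun x => r • x) '' ucap (d r) (β r) := by
  ext x
  constructor
  · rintro ⟨⟨h0, h⟩, hx⟩
    rw [mem_sphere_zero_iff_norm] at hx
    rw [hx] at h
    exact ⟨hatv x, ⟨norm_hatv h0, h⟩, by rw [← hx]; exact smul_hatv x h0⟩
  · rintro ⟨q, ⟨hq, h⟩, rfl⟩
    have hn : ‖r • q‖ = r := by rw [norm_smul, hq, Real.norm_of_nonneg hr.le, mul_one]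
    refine ⟨⟨?_, ?_⟩, ?_⟩
    · rw [← norm_pos_iff, hn]; exact hr
    · rw [hn, hatv_smul hq hr]; exact h
    · simp [norm_smul, hq, abs_of_pos hr]

theorem capSet_scale {n : ℕ} {p : Euc n} (hp : ‖p‖ = 1) {a : ℝ} (ha : a ∈ Icc 0 Real.pi) {r : ℝ}
    (hr : 0 < r) : capSet p r a = (fun x => r • x) '' ucap p (Real.cos a) := by
  ext x
  constructor
  · rintro ⟨hx, h⟩
    rw [mem_sphere_zero_iff_norm] at hx
    have h0 : x ≠ 0 := by rw [← norm_pos_iff, hx]; exact hr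
    rw [arccos_lt_iff_cos_lt (abs_inner_le_one (norm_hatv h0) hp) ha] at h
    exact ⟨hatv x, ⟨norm_hatv h0, h⟩, by rw [← hx]; exact smul_hatv x h0⟩
  · rintro ⟨q, ⟨hq, h⟩, rfl⟩
    refine ⟨by simp [norm_smul, hq, abs_of_pos hr], ?_⟩
    rw [hatv_smul hq hr, arccos_lt_iff_cos_lt (abs_inner_le_one hq hp) ha]; exact h

open scoped Pointwise in
theorem hmeas_smul {n : ℕ} (hn : 1 ≤ n) {r : ℝ} (hr : 0 < r) (s : Set (Euc n)) :
    μH[(n:ℝ) - 1] ((fun x => r • x) '' s) = ENNReal.ofReal r ^ ((n:ℝ) - 1) * μH[(n:ℝ) - 1] s := by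
  have h1 : (0:ℝ) ≤ (n:ℝ) - 1 := by
    have : (1:ℝ) ≤ n := by exact_mod_cast hn
    linarith
  have h := Measure.hausdorffMeasure_smul₀ (𝕜 := ℝ) (E := Euc n) h1 hr.ne' s
  have h2 : (r • s : Set (Euc n)) = (fun x => r • x) '' s := rfl
  rw [← h2, h, ENNReal.smul_def, smul_eq_mul]
  congr 1
  rw [ENNReal.coe_rpow_of_nonneg _ h1]
  congr 1
  rw [ENNReal.ofReal, Real.toNNReal_of_nonneg hr.le]
  congr 1
  ext
  simp [abs_of_pos hr]

theorem exists_isometry {n : ℕ} {d d' : Euc n} (hd : ‖d‖ = 1) (hd' : ‖d'‖ = 1) :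
    ∃ R : Euc n ≃ₗᵢ[ℝ] Euc n, R d = d' :=
  ⟨Submodule.reflection (Submodule.span ℝ {d - d'})ᗮ, Submodule.reflection_sub (hd.trans hd'.symm)⟩

theorem ucap_image {n : ℕ} (R : Euc n ≃ₗᵢ[ℝ] Euc n) (d : Euc n) (y : ℝ) :
    R '' ucap d y = ucap (R d) y := by
  ext q
  constructor
  · rintro ⟨q, ⟨hq, h⟩, rfl⟩
    exact ⟨by rw [R.norm_map, hq], by rw [R.inner_map_map]; exact h⟩
  · rintro ⟨hq, h⟩
    refine ⟨R.symm q, ⟨by rw [R.symm.norm_map, hq], ?_⟩, by simp⟩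
    rw [← R.inner_map_map, R.apply_symm_apply]; exact h

theorem hmeas_isom {n : ℕ} (R : Euc n ≃ₗᵢ[ℝ] Euc n) (t : ℝ) (s : Set (Euc n)) :
    μH[t] (R '' s) = μH[t] s :=
  R.isometry.hausdorffMeasure_image (Or.inr R.surjective) s

theorem hmeas_ucap {n : ℕ} {d d' : Euc n} (hd : ‖d‖ = 1) (hd' : ‖d'‖ = 1) (t y : ℝ) :
    μH[t] (ucap d y) = μH[t] (ucap d' y) := by
  obtain ⟨R, rfl⟩ := exists_isometry hd hd'
  rw [← ucap_image, hmeas_isom]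

theorem sphDistrib_capE {n : ℕ} (hn : 1 ≤ n) {v α : ℝ → ℝ} {p : Euc n} (hp : ‖p‖ = 1)
    (hα_mem : ∀ r, α r ∈ Icc (0:ℝ) Real.pi)
    (hα : ∀ᵐ r ∂(volume.restrict (Ioi (0:ℝ))),
      μH[(n : ℝ) - 1] (capSet p r (α r)) = ENNReal.ofReal (v r))
    {d : ℝ → Euc n} (hd : ∀ r, ‖d r‖ = 1) : SphDistrib v (capE d fun r => Real.cos (α r)) := by
  unfold SphDistrib
  filter_upwards [hα, ae_restrict_mem measurableSet_Ioi] with r h hr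
  rw [← h, ucap_scale _ _ hr, capSet_scale hp (hα_mem r) hr, hmeas_smul hn hr, hmeas_smul hn hr,
    hmeas_ucap (hd r) hp]

theorem sphere_finite {n : ℕ} {t : ℝ} {d : Euc n} (hd : ‖d‖ = 1) {y : ℝ} (hy : y < 1)
    (h : μH[t] (ucap d y) < ⊤) : μH[t] (sphere (0 : Euc n) 1) < ⊤ := by
  refine (isCompact_sphere _ _).measure_lt_top_of_nhdsWithin fun q hq => ?_
  rw [mem_sphere_zero_iff_norm] at hq
  refine ⟨ucap q y, ?_, by rwa [hmeas_ucap hq hd]⟩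
  have h1 : IsOpen {z : Euc n | y < ⟪z, q⟫} := isOpen_lt (by fun_prop) (by fun_prop)
  refine mem_of_superset (inter_mem_nhdsWithin _ (h1.mem_nhds (x := q) ?_)) ?_
  · change y < ⟪q, q⟫
    rw [real_inner_self_eq_norm_sq, hq]; linarith
  · rintro z ⟨hz, hz2⟩
    exact ⟨by simpa using hz, hz2⟩

theorem hmeas_singleton {n : ℕ} (hn : 2 ≤ n) (x : Euc n) : μH[(n:ℝ) - 1] {x} = 0 := by
  have h : (0:ℝ) < (n:ℝ) - 1 := by
    have : (2:ℝ) ≤ n := by exact_mod_cast hn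
    linarith
  have := Measure.nullSingletonClass_hausdorff (Euc n) h
  exact measure_singleton x

theorem level_null {n : ℕ} (hn : 2 ≤ n) (hfin : μH[(n:ℝ) - 1] (sphere (0 : Euc n) 1) < ⊤)
    {d : Euc n} (hd : ‖d‖ = 1) (y : ℝ) : μH[(n:ℝ) - 1] (ulev d y) = 0 := by
  have hn1 : (0:ℝ) ≤ (n:ℝ) - 1 := by
    have : (2:ℝ) ≤ n := by exact_mod_cast hn
    linarith
  rcases lt_trichotomy |y| 1 with hy | hy | hy
  · -- find a null level
    have : IsFiniteMeasure ((μH[(n:ℝ) - 1]).restrict (sphere (0 : Euc n) 1)) := ⟨by simpa using hfin⟩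
    have hc := Measure.countable_meas_level_set_pos
      (μ := (μH[(n:ℝ) - 1]).restrict (sphere (0 : Euc n) 1)) (g := fun q => ⟪q, d⟫) (by fun_prop)
    have hex : ∃ y' ∈ Ioo (-1:ℝ) 1, y' ∉ {t : ℝ | 0 < (μH[(n:ℝ) - 1]).restrict (sphere (0 : Euc n) 1)
        {a | ⟪a, d⟫ = t}} := by
      by_contra! hcon
      have h1 : (Ioo (-1:ℝ) 1).Countable := hc.mono hcon
      have h2 := h1.measure_zero volume
      rw [Real.volume_Ioo] at h2
      norm_num at h2
    obtain ⟨y', hy', h0⟩ := hex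
    have hm : MeasurableSet {a : Euc n | ⟪a, d⟫ = y'} :=
      (isClosed_eq (by fun_prop) (by fun_prop)).measurableSet
    have h0' : μH[(n:ℝ) - 1] (ulev d y') = 0 := by
      have h1 : ¬ (0 < (μH[(n:ℝ) - 1]).restrict (sphere (0 : Euc n) 1) {a | ⟪a, d⟫ = y'}) := h0
      rw [not_lt, nonpos_iff_eq_zero, Measure.restrict_apply hm] at h1
      refine measure_mono_null ?_ h1
      rintro q ⟨hq, hq2⟩
      exact ⟨hq2, by simpa using hq⟩
    rw [abs_lt] at hy
    have hp : 0 < 1 - y' ^ 2 := by nlinarith [hy'.1, hy'.2]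
    have hp2 : 0 < 1 - y ^ 2 := by nlinarith
    set c := Real.sqrt ((1 - y ^ 2) / (1 - y' ^ 2)) with hc
    have hc0 : 0 < c := Real.sqrt_pos.2 (by positivity)
    have hc2 : c ^ 2 = (1 - y ^ 2) / (1 - y' ^ 2) := Real.sq_sqrt (by positivity)
    have hL : LipschitzWith c.toNNReal (fun x : Euc n => c • (x - y' • d) + y • d) := by
      refine LipschitzWith.of_dist_le_mul fun a b => ?_
      rw [dist_eq_norm, dist_eq_norm, Real.coe_toNNReal _ hc0.le]
      have : c • (a - y' • d) + y • d - (c • (b - y' • d) + y • d) = c • (a - b) := by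
        simp only [smul_sub]; abel
      rw [this, norm_smul, Real.norm_of_nonneg hc0.le]
    have hle := hL.hausdorffMeasure_image_le hn1 (ulev d y')
    rw [h0', mul_zero, nonpos_iff_eq_zero] at hle
    refine measure_mono_null ?_ hle
    rintro q ⟨hq, hqd⟩
    have hdd : ⟪d, d⟫ = 1 := by rw [real_inner_self_eq_norm_sq, hd]; norm_num
    have hqd' : ⟪q - y • d, d⟫ = 0 := by
      rw [inner_sub_left, inner_smul_left, hqd, hdd]; simp
    have hqq : ‖q - y • d‖ ^ 2 = 1 - y ^ 2 := by
      rw [norm_sub_sq_real, hq, inner_smul_right, hqd, norm_smul, hd, mul_one, Real.norm_eq_abs, sq_abs]; ring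
    refine ⟨c⁻¹ • (q - y • d) + y' • d, ⟨?_, ?_⟩, ?_⟩
    · rw [← sq_eq_sq₀ (norm_nonneg _) zero_le_one, norm_add_sq_real, norm_smul, mul_pow, hqq,
        inner_smul_left, inner_smul_right, hqd', norm_smul, hd, mul_one, Real.norm_eq_abs,
        Real.norm_eq_abs, sq_abs, sq_abs, inv_pow, hc2]
      field_simp
      ring
    · rw [inner_add_left, inner_smul_left, hqd', inner_smul_left, hdd]; simp
    · change c • (c⁻¹ • (q - y • d) + y' • d - y' • d) + y • d = q
      rw [add_sub_cancel_right, smul_smul, mul_inv_cancel₀ hc0.ne', one_smul]; abel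
  · refine measure_mono_null ?_ (hmeas_singleton hn (y • d))
    rintro q ⟨hq, hqd⟩
    rw [mem_singleton_iff]
    have hy2 : y ^ 2 = 1 := by rw [← sq_abs, hy]; norm_num
    have : ‖q - y • d‖ ^ 2 = 0 := by
      rw [norm_sub_sq_real, hq, inner_smul_right, hqd, norm_smul, hd, mul_one, Real.norm_eq_abs, sq_abs]
      linarith
    exact sub_eq_zero.1 (norm_eq_zero.1 (pow_eq_zero_iff (two_ne_zero) |>.1 this))
  · have : ulev d y = ∅ := by
      ext q
      simp only [ulev, mem_empty_iff_false, iff_false]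
      rintro ⟨hq, hqd⟩
      have := abs_inner_le_one hq hd
      rw [hqd] at this; linarith
    rw [this, measure_empty]

theorem capE_measurable {n : ℕ} {d : ℝ → Euc n} (hd : Measurable d) {β : ℝ → ℝ} (hβ : Measurable β) :
    MeasurableSet (capE d β) := by
  have h1 : Measurable fun x : Euc n => ⟪hatv x, d ‖x‖⟫ :=
    measurable_hatv.inner (hd.comp measurable_norm)
  have h2 : Measurable fun x : Euc n => β ‖x‖ := hβ.comp measurable_norm
  exact (measurableSet_singleton (0 : Euc n)).compl.inter (measurableSet_lt h2 h1)

theorem norm_sub_sq_polar {n : ℕ} {x y : Euc n} (hx : x ≠ 0) (hy : y ≠ 0) :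
    ‖x - y‖ ^ 2 = (‖x‖ - ‖y‖) ^ 2 + ‖x‖ * ‖y‖ * ‖hatv x - hatv y‖ ^ 2 := by
  have h1 : ⟪x, y⟫ = ‖x‖ * ‖y‖ * ⟪hatv x, hatv y⟫ := by
    conv_lhs => rw [← smul_hatv x hx, ← smul_hatv y hy]
    rw [inner_smul_left, inner_smul_right]; simp; ring
  rw [norm_sub_sq_real, norm_sub_sq_real, norm_hatv hx, norm_hatv hy, h1]; ring

theorem norm_hatv_sub_le {n : ℕ} {a : ℝ} (ha : 0 < a) {x y : Euc n} (hx : a ≤ ‖x‖) (hy : a ≤ ‖y‖) :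
    ‖hatv x - hatv y‖ ≤ a⁻¹ * ‖x - y‖ := by
  have hx0 : x ≠ 0 := norm_pos_iff.1 (ha.trans_le hx)
  have hy0 : y ≠ 0 := norm_pos_iff.1 (ha.trans_le hy)
  have h := norm_sub_sq_polar hx0 hy0
  rw [inv_mul_eq_div, le_div_iff₀ ha]
  refine abs_le_of_sq_le_sq' ?_ (norm_nonneg _) |>.2
  have h2 : a * a ≤ ‖x‖ * ‖y‖ := mul_le_mul hx hy ha.le (ha.le.trans hx)
  nlinarith [sq_nonneg (‖x‖ - ‖y‖), mul_le_mul_of_nonneg_right h2 (sq_nonneg ‖hatv x - hatv y‖)]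


theorem not_rdensity0_of_half {A : Set ℝ} {r : ℝ} {ε : ℝ} (hε : 0 < ε)
    (h : ∀ ρ, 0 < ρ → ρ < ε → ENNReal.ofReal ρ ≤ volume (A ∩ ball r ρ)) : ¬ RDensity0 A r := by
  intro hd
  have h2 : (2:ℝ≥0∞)⁻¹ ≤ 0 := by
    refine ge_of_tendsto hd ?_
    filter_upwards [Ioo_mem_nhdsGT hε] with ρ hρ
    have h3 := h ρ hρ.1 hρ.2
    rw [Real.volume_ball, ENNReal.le_div_iff_mul_le (by simp [hρ.1]) (Or.inl ENNReal.ofReal_ne_top)]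
    refine le_trans ?_ h3
    rw [ENNReal.ofReal_mul (by norm_num)]
    simp only [ENNReal.ofReal_ofNat]
    rw [← mul_assoc, ENNReal.inv_mul_cancel (by simp) (by simp), one_mul]
  simp at h2

theorem ev_right_iff {P : ℝ → Prop} {r : ℝ} :
    (∀ᶠ x in 𝓝[>] r ⊓ ae (volume : Measure ℝ), P x) ↔
      ∃ ε > 0, ∀ᵐ x ∂(volume : Measure ℝ), x ∈ Ioo r (r + ε) → P x := by
  rw [eventually_inf]
  constructor
  · rintro ⟨s, hs, t, ht, h⟩
    obtain ⟨u, hu, hus⟩ := mem_nhdsGT_iff_exists_Ioo_subset.1 hs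
    refine ⟨u - r, sub_pos.2 hu, ?_⟩
    filter_upwards [ht] with x hx hx2
    exact h x ⟨hus ⟨hx2.1, by linarith [hx2.2]⟩, hx⟩
  · rintro ⟨ε, hε, h⟩
    exact ⟨Ioo r (r + ε), Ioo_mem_nhdsGT (by linarith), _, h, fun x hx => hx.2 hx.1⟩

theorem ev_left_iff {P : ℝ → Prop} {r : ℝ} :
    (∀ᶠ x in 𝓝[<] r ⊓ ae (volume : Measure ℝ), P x) ↔
      ∃ ε > 0, ∀ᵐ x ∂(volume : Measure ℝ), x ∈ Ioo (r - ε) r → P x := by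
  rw [eventually_inf]
  constructor
  · rintro ⟨s, hs, t, ht, h⟩
    obtain ⟨u, hu, hus⟩ := mem_nhdsLT_iff_exists_Ioo_subset.1 hs
    refine ⟨r - u, sub_pos.2 hu, ?_⟩
    filter_upwards [ht] with x hx hx2
    exact h x ⟨hus ⟨by linarith [hx2.1], hx2.2⟩, hx⟩
  · rintro ⟨ε, hε, h⟩
    exact ⟨Ioo (r - ε) r, Ioo_mem_nhdsLT (by linarith), _, h, fun x hx => hx.2 hx.1⟩

theorem ev_nhds_of_sides {P : ℝ → Prop} {r : ℝ} (h1 : ∀ᶠ x in 𝓝[>] r ⊓ ae (volume : Measure ℝ), P x)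
    (h2 : ∀ᶠ x in 𝓝[<] r ⊓ ae (volume : Measure ℝ), P x) :
    ∃ ε > 0, ∀ᵐ x ∂(volume : Measure ℝ), x ∈ Ioo (r - ε) (r + ε) → P x := by
  obtain ⟨ε1, hε1, h1⟩ := ev_right_iff.1 h1
  obtain ⟨ε2, hε2, h2⟩ := ev_left_iff.1 h2
  refine ⟨min ε1 ε2, by positivity, ?_⟩
  have h3 : ∀ᵐ x ∂(volume : Measure ℝ), x ≠ r := by
    rw [ae_iff]; simp
  filter_upwards [h1, h2, h3] with x hx1 hx2 hx3 hx
  rcases lt_or_gt_of_ne hx3 with h | h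
  · exact hx2 ⟨by linarith [hx.1, min_le_right ε1 ε2], h⟩
  · exact hx1 ⟨h, by linarith [hx.2, min_le_left ε1 ε2]⟩

theorem not_rdensity0_right {A : Set ℝ} {r : ℝ}
    (h : ∀ᶠ x in 𝓝[>] r ⊓ ae (volume : Measure ℝ), x ∈ A) : ¬ RDensity0 A r := by
  obtain ⟨ε, hε, h⟩ := ev_right_iff.1 h
  refine not_rdensity0_of_half hε fun ρ hρ hρε => ?_
  calc ENNReal.ofReal ρ = volume (Ioo r (r + ρ)) := by rw [Real.volume_Ioo]; congr 1; ring
    _ ≤ _ := by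
      refine measure_mono_ae ?_
      filter_upwards [h] with x hx hx2
      refine ⟨hx ⟨hx2.1, by linarith [hx2.2]⟩, ?_⟩
      rw [Real.ball_eq_Ioo]
      exact ⟨by linarith [hx2.1], hx2.2⟩

theorem not_rdensity0_left {A : Set ℝ} {r : ℝ}
    (h : ∀ᶠ x in 𝓝[<] r ⊓ ae (volume : Measure ℝ), x ∈ A) : ¬ RDensity0 A r := by
  obtain ⟨ε, hε, h⟩ := ev_left_iff.1 h
  refine not_rdensity0_of_half hε fun ρ hρ hρε => ?_
  calc ENNReal.ofReal ρ = volume (Ioo (r - ρ) r) := by rw [Real.volume_Ioo]; congr 1; ring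
    _ ≤ _ := by
      refine measure_mono_ae ?_
      filter_upwards [h] with x hx hx2
      refine ⟨hx ⟨by linarith [hx2.1], hx2.2⟩, ?_⟩
      rw [Real.ball_eq_Ioo]
      exact ⟨hx2.1, by linarith [hx2.2]⟩

theorem ev_pos_scale {P : ℝ → Prop} {r : ℝ} (h : ∀ᶠ x in 𝓝 r, P x) :
    ∀ᶠ ρ in 𝓝[>] (0:ℝ), ∀ x, |x - r| < ρ → P x := by
  obtain ⟨ε, hε, h⟩ := Metric.eventually_nhds_iff.1 h
  filter_upwards [Ioo_mem_nhdsGT hε] with ρ hρ x hx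
  exact h (by rw [Real.dist_eq]; linarith [hρ.2])

theorem cap_not_density0 {n : ℕ} (hn : 1 ≤ n) {d : ℝ → Euc n} {β : ℝ → ℝ} {p d0 : Euc n}
    (hp : ‖p‖ = 1) (hd0 : ‖d0‖ = 1) (hpd : |⟪p, d0⟫| < 1) {r : ℝ} (hr : 0 < r) {A : Set ℝ}
    (hA : MeasurableSet A) (hA0 : ¬ RDensity0 A r)
    (hβ : ∀ᶠ s in 𝓝 r, s ∈ A → β s ≤ ⟪p, d s⟫)
    (hd : ∀ ε > 0, ∀ᶠ s in 𝓝 r, s ∈ A → ‖d s - d0‖ < ε) :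
    ¬ DensityAt (capE d β) (r • p) 0 := by
  intro hE
  refine hA0 (cone_density hn hp hd0 hpd hr hE hA fun κ hκ => ?_)
  filter_upwards [ev_pos_scale hβ, ev_pos_scale (hd (κ / 5) (by positivity)), self_mem_nhdsWithin]
    with ρ h1 h2 hρ x hx0 hxA hxr hx5 hxκ
  have hρ : 0 < ρ := hρ
  refine ⟨hx0, ?_⟩
  have h3 := h1 _ hxr hxA
  have h4 := h2 _ hxr hxA
  have h5 : ⟪hatv x, d ‖x‖⟫ = ⟪p, d ‖x‖⟫ + ⟪hatv x - p, d0⟫ + ⟪hatv x - p, d ‖x‖ - d0⟫ := by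
    simp only [inner_sub_left, inner_sub_right]; ring
  have h6 := (abs_le.1 (abs_real_inner_le_norm (hatv x - p) (d ‖x‖ - d0))).1
  have h7 : ‖hatv x - p‖ * ‖d ‖x‖ - d0‖ ≤ (5 * ρ) * (κ / 5) :=
    mul_le_mul hx5.le h4.le (norm_nonneg _) (by positivity)
  rw [h5]
  linarith

theorem cap_not_density_compl {n : ℕ} (hn : 1 ≤ n) {d : ℝ → Euc n} {β : ℝ → ℝ} {p d0 : Euc n}
    (hp : ‖p‖ = 1) (hd0 : ‖d0‖ = 1) (hpd : |⟪p, d0⟫| < 1) {r : ℝ} (hr : 0 < r) {A : Set ℝ}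
    (hA : MeasurableSet A) (hA0 : ¬ RDensity0 A r)
    (hβ : ∀ᶠ s in 𝓝 r, s ∈ A → ⟪p, d s⟫ ≤ β s)
    (hd : ∀ ε > 0, ∀ᶠ s in 𝓝 r, s ∈ A → ‖d s - d0‖ < ε) :
    ¬ DensityAt (capE d β)ᶜ (r • p) 0 := by
  intro hE
  refine hA0 (cone_density (d := -d0) hn hp (by rwa [norm_neg]) (by rwa [inner_neg_right, abs_neg])
    hr hE hA fun κ hκ => ?_)
  filter_upwards [ev_pos_scale hβ, ev_pos_scale (hd (κ / 5) (by positivity)), self_mem_nhdsWithin]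
    with ρ h1 h2 hρ x hx0 hxA hxr hx5 hxκ
  have hρ : 0 < ρ := hρ
  rintro ⟨-, hcon⟩
  have h3 := h1 _ hxr hxA
  have h4 := h2 _ hxr hxA
  have h5 : ⟪hatv x, d ‖x‖⟫ = ⟪p, d ‖x‖⟫ + ⟪hatv x - p, d0⟫ + ⟪hatv x - p, d ‖x‖ - d0⟫ := by
    simp only [inner_sub_left, inner_sub_right]; ring
  have h6 := (abs_le.1 (abs_real_inner_le_norm (hatv x - p) (d ‖x‖ - d0))).2
  have h7 : ‖hatv x - p‖ * ‖d ‖x‖ - d0‖ ≤ (5 * ρ) * (κ / 5) :=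
    mul_le_mul hx5.le h4.le (norm_nonneg _) (by positivity)
  rw [h5] at hcon
  rw [inner_neg_right] at hxκ
  linarith

theorem ae_norm_of_ae {n : ℕ} {P : ℝ → Prop} (h : ∀ᵐ s ∂(volume : Measure ℝ), 0 < s → P s) :
    ∀ᵐ x ∂(volume : Measure (Euc n)), x ≠ 0 → P ‖x‖ := by
  have := volume_sector_null (n := n) (A := {s | ¬ P s}) ?_
  · rw [ae_iff]
    refine measure_mono_null ?_ this
    intro x hx
    simp only [mem_setOf_eq, Classical.not_imp] at hx
    exact hx
  · rw [ae_iff] at h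
    refine measure_mono_null ?_ h
    rintro s ⟨hs, hs0⟩
    simp only [mem_setOf_eq, Classical.not_imp]
    exact ⟨hs0, hs⟩

theorem exists_ball_polar {n : ℕ} {p : Euc n} (hp : ‖p‖ = 1) {r : ℝ} (hr : 0 < r) {ε : ℝ} (hε : 0 < ε) :
    ∃ δ > 0, ∀ x ∈ ball (r • p) δ, x ≠ 0 ∧ ‖x‖ ∈ Ioo (r - ε) (r + ε) ∧ ‖hatv x - p‖ < ε := by
  refine ⟨min (r / 2) (min ε (ε * r / 2)), by positivity, fun x hx => ?_⟩
  have hnp : ‖r • p‖ = r := by rw [norm_smul, hp, Real.norm_of_nonneg hr.le, mul_one]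
  rw [mem_ball, dist_eq_norm] at hx
  have h1 : |‖x‖ - r| ≤ ‖x - r • p‖ := by
    have := abs_norm_sub_norm_le x (r • p); rwa [hnp] at this
  have h2 : ‖x - r • p‖ < r / 2 := hx.trans_le (min_le_left _ _)
  have h3 : ‖x - r • p‖ < ε := hx.trans_le ((min_le_right _ _).trans (min_le_left _ _))
  have h4 : ‖x - r • p‖ < ε * r / 2 := hx.trans_le ((min_le_right _ _).trans (min_le_right _ _))
  have h5 := abs_le.1 h1
  have hx2 : r / 2 ≤ ‖x‖ := by linarith [h5.1]
  refine ⟨norm_pos_iff.1 (by linarith), ⟨by linarith [h5.1], by linarith [h5.2]⟩, ?_⟩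
  have h6 := norm_hatv_sub_le (a := r / 2) (by positivity) hx2 (by rw [hnp]; linarith : r / 2 ≤ ‖r • p‖)
  rw [hatv_smul hp hr] at h6
  refine h6.trans_lt ?_
  rw [inv_mul_eq_div, div_lt_iff₀ (by positivity)]
  linarith

theorem cap_not_mem_of_above {n : ℕ} {d : ℝ → Euc n} (hdn : ∀ s, ‖d s‖ = 1) {β : ℝ → ℝ} {p : Euc n}
    (hp : ‖p‖ = 1) {r : ℝ} (hr : 0 < r) {η ε : ℝ} (hη : 0 < η) (hε : 0 < ε)
    (h : ∀ᵐ s ∂(volume : Measure ℝ), s ∈ Ioo (r - ε) (r + ε) → ⟪p, d s⟫ + η ≤ β s) :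
    r • p ∉ essBoundary (capE d β) := by
  obtain ⟨δ, hδ, hb⟩ := exists_ball_polar hp hr (lt_min hη hε)
  refine not_mem_essBoundary_of_notMem hδ ?_
  filter_upwards [ae_norm_of_ae (n := n) (h.mono fun s hs _ => hs)] with x hx hxb
  obtain ⟨h0, h1, h2⟩ := hb x hxb
  rintro ⟨-, hcon⟩
  have h3 := hx h0 ⟨by linarith [h1.1, min_le_right η ε], by linarith [h1.2, min_le_right η ε]⟩
  have h4 := (abs_le.1 (abs_real_inner_le_norm (hatv x - p) (d ‖x‖))).2
  rw [hdn, mul_one, inner_sub_left] at h4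
  linarith [min_le_left η ε]

theorem cap_not_mem_of_below {n : ℕ} {d : ℝ → Euc n} (hdn : ∀ s, ‖d s‖ = 1) {β : ℝ → ℝ} {p : Euc n}
    (hp : ‖p‖ = 1) {r : ℝ} (hr : 0 < r) {η ε : ℝ} (hη : 0 < η) (hε : 0 < ε)
    (h : ∀ᵐ s ∂(volume : Measure ℝ), s ∈ Ioo (r - ε) (r + ε) → β s ≤ ⟪p, d s⟫ - η) :
    r • p ∉ essBoundary (capE d β) := by
  obtain ⟨δ, hδ, hb⟩ := exists_ball_polar hp hr (lt_min hη hε)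
  refine not_mem_essBoundary_of_mem hδ ?_
  filter_upwards [ae_norm_of_ae (n := n) (h.mono fun s hs _ => hs)] with x hx hxb
  obtain ⟨h0, h1, h2⟩ := hb x hxb
  refine ⟨h0, ?_⟩
  have h3 := hx h0 ⟨by linarith [h1.1, min_le_right η ε], by linarith [h1.2, min_le_right η ε]⟩
  have h4 := (abs_le.1 (abs_real_inner_le_norm (hatv x - p) (d ‖x‖))).1
  rw [hdn, mul_one, inner_sub_left] at h4
  linarith [min_le_left η ε]


theorem indicator_intervalIntegrable {A : Set ℝ} (hA : MeasurableSet A) (a b : ℝ) :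
    IntervalIntegrable (A.indicator fun _ => (1:ℝ)) volume a b := by
  have h : IntervalIntegrable (fun _ : ℝ => (1:ℝ)) volume a b := intervalIntegrable_const
  exact ⟨h.1.indicator hA, h.2.indicator hA⟩

theorem hasDeriv_of_rdensity0 {A : Set ℝ} (hA : MeasurableSet A) {r : ℝ} (a : ℝ) (h : RDensity0 A r) :
    HasDerivAt (fun x => ∫ t in a..x, A.indicator (fun _ => (1:ℝ)) t) 0 r := by
  rw [hasDerivAt_iff_isLittleO, Asymptotics.isLittleO_iff]
  intro c hc
  have hc4 : (0:ℝ≥0∞) < ENNReal.ofReal (c / 4) := by simpa using hc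
  have h1 := (tendsto_order.1 h).2 _ hc4
  rw [eventually_nhdsWithin_iff] at h1
  obtain ⟨ε, hε, h1⟩ := Metric.eventually_nhds_iff.1 h1
  refine Metric.eventually_nhds_iff.2 ⟨ε / 2, by positivity, fun x hx => ?_⟩
  rw [Real.dist_eq] at hx
  rw [intervalIntegral.integral_interval_sub_left (indicator_intervalIntegrable hA _ _)
    (indicator_intervalIntegrable hA _ _), smul_zero, sub_zero]
  rcases eq_or_ne x r with rfl | hne
  · simp
  have hpos : 0 < |x - r| := abs_pos.2 (sub_ne_zero.2 hne)
  set ρ := 2 * |x - r| with hρ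
  have h2 := h1 (y := ρ) (by rw [Real.dist_eq, sub_zero, abs_of_pos (by positivity)]; linarith)
    (by change 0 < ρ; positivity)
  rw [Real.volume_ball, ENNReal.div_lt_iff (Or.inl (by simp; positivity)) (Or.inl ENNReal.ofReal_ne_top),
    ← ENNReal.ofReal_mul (by positivity)] at h2
  have hsub : uIoc r x ⊆ ball r ρ := by
    intro t ht
    rw [mem_ball, Real.dist_eq]
    rcases le_total r x with hrx | hrx
    · rw [uIoc_of_le hrx] at ht
      rw [abs_of_nonneg (by linarith [ht.1]), hρ, abs_of_nonneg (by linarith)]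
      rw [abs_of_nonneg (by linarith)] at hpos
      linarith [ht.2]
    · rw [uIoc_of_ge hrx] at ht
      rw [abs_of_nonpos (by linarith [ht.2]), hρ, abs_of_nonpos (by linarith)]
      rw [abs_of_nonpos (by linarith)] at hpos
      linarith [ht.1]
  calc _ ≤ ∫ t in uIoc r x, ‖A.indicator (fun _ => (1:ℝ)) t‖ :=
        intervalIntegral.norm_integral_le_integral_norm_uIoc
    _ = ∫ t in uIoc r x, A.indicator (fun _ => (1:ℝ)) t := by
        congr 1; ext t
        by_cases ht : t ∈ A <;> simp [ht]
    _ = volume.real (A ∩ uIoc r x) := by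
        rw [integral_indicator hA, Measure.restrict_restrict hA]; simp
    _ ≤ c / 4 * (2 * ρ) := by
        refine ENNReal.toReal_le_of_le_ofReal (by positivity) (le_trans ?_ h2.le)
        exact measure_mono (inter_subset_inter_right _ hsub)
    _ = c * ‖x - r‖ := by rw [hρ, Real.norm_eq_abs]; ring

theorem density_dichotomy {A : Set ℝ} (hA : MeasurableSet A) {a b : ℝ} (hab : a < b)
    (h : ∀ r ∈ Ioo a b, RDensity0 A r ∨ RDensity0 Aᶜ r) :
    volume (A ∩ Ioo a b) = 0 ∨ volume (Aᶜ ∩ Ioo a b) = 0 := by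
  set G : Set ℝ → ℝ → ℝ := fun B x => ∫ t in a..x, B.indicator (fun _ => (1:ℝ)) t with hG
  have hsum : ∀ x, G A x = (x - a) - G Aᶜ x := by
    intro x
    have h1 : G A x + G Aᶜ x = x - a := by
      rw [hG]
      simp only
      rw [← intervalIntegral.integral_add (indicator_intervalIntegrable hA _ _)
        (indicator_intervalIntegrable hA.compl _ _)]
      have : ∀ t, A.indicator (fun _ => (1:ℝ)) t + Aᶜ.indicator (fun _ => (1:ℝ)) t = 1 := by
        intro t; by_cases ht : t ∈ A <;> simp [ht]
      simp [this]
    linarith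
  have hvol : ∀ B : Set ℝ, MeasurableSet B → G B b = volume.real (B ∩ Ioc a b) := by
    intro B hB
    rw [hG]; simp only
    rw [intervalIntegral.integral_of_le hab.le, integral_indicator hB, Measure.restrict_restrict hB]; simp
  have hcont : ∀ B : Set ℝ, MeasurableSet B → ContinuousOn (G B) (Icc a b) := by
    intro B hB
    refine Continuous.continuousOn ?_
    exact intervalIntegral.continuous_primitive (fun a b => indicator_intervalIntegrable hB a b) a
  have key : ∀ B : Set ℝ, MeasurableSet B → (∀ r ∈ Ioo a b, RDensity0 B r) → volume (B ∩ Ioo a b) = 0 := by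
    intro B hB hr
    obtain ⟨c, hc, hc2⟩ := exists_hasDerivAt_eq_slope (G B) (fun _ => 0) hab (hcont B hB)
      (fun x hx => hasDeriv_of_rdensity0 hB a (hr x hx))
    have h0 : G B a = 0 := by simp [hG]
    rw [h0, sub_zero, hvol B hB] at hc2
    have h3 : volume.real (B ∩ Ioc a b) = 0 := by
      rcases div_eq_zero_iff.1 hc2.symm with h | h
      · exact h
      · linarith
    rw [measureReal_eq_zero_iff (ne_top_of_le_ne_top (by simp) (measure_mono inter_subset_right))] at h3
    exact measure_mono_null (inter_subset_inter_right _ Ioo_subset_Ioc_self) h3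
  by_cases h1 : ∀ r ∈ Ioo a b, RDensity0 A r
  · exact Or.inl (key A hA h1)
  by_cases h2 : ∀ r ∈ Ioo a b, RDensity0 Aᶜ r
  · exact Or.inr (key _ hA.compl h2)
  exfalso
  push Not at h1 h2
  obtain ⟨r1, hr1, h1⟩ := h1
  obtain ⟨r2, hr2, h2⟩ := h2
  classical
  have hd : ∀ x ∈ Ioo a b, HasDerivAt (G A) (if RDensity0 A x then 0 else 1) x := by
    intro x hx
    split_ifs with hx0
    · exact hasDeriv_of_rdensity0 hA a hx0
    · have hx1 := (h x hx).resolve_left hx0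
      have h3 := hasDeriv_of_rdensity0 hA.compl a hx1
      have h4 : HasDerivAt (fun x => (x - a) - G Aᶜ x) (1 - 0) x :=
        ((hasDerivAt_id x).sub_const a).sub h3
      rw [sub_zero] at h4
      exact h4.congr_of_eventuallyEq (Eventually.of_forall hsum)
  have hconn := (ordConnected_Ioo (a := a) (b := b)).image_hasDerivWithinAt
    (fun x hx => (hd x hx).hasDerivWithinAt)
  have hm := hconn.out (mem_image_of_mem _ hr2) (mem_image_of_mem _ hr1)
    (show (1/2 : ℝ) ∈ _ from ⟨by
      rw [if_pos ((h r2 hr2).resolve_right h2)]; norm_num, by rw [if_neg h1]; norm_num⟩)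
  obtain ⟨x, hx, hx2⟩ := hm
  simp only at hx2
  split_ifs at hx2 <;> norm_num at hx2

/-- The radial perimeter measure. -/
noncomputable def radPerim {n : ℕ} (E : Set (Euc n)) : Measure ℝ :=
  ((μH[(n:ℝ) - 1]).restrict (essBoundary E)).map norm

theorem radPerim_apply {n : ℕ} (E : Set (Euc n)) {B : Set ℝ} (hB : MeasurableSet B) :
    radPerim E B = μH[(n:ℝ) - 1] (norm ⁻¹' B ∩ essBoundary E) := by
  unfold radPerim
  rw [Measure.map_apply measurable_norm hB, Measure.restrict_apply (measurable_norm hB)]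

theorem radPerim_univ {n : ℕ} (E : Set (Euc n)) : radPerim E univ = perim E univ := by
  rw [radPerim_apply _ MeasurableSet.univ]
  unfold perim; simp

theorem osc_point {n : ℕ} (hn : 1 ≤ n) {e : Euc n} (he : ‖e‖ = 1) {β : ℝ → ℝ} (hβ : Measurable β)
    {p : Euc n} (hp : ‖p‖ = 1) (hpe : |⟪p, e⟫| < 1) {a b : ℝ} (ha : 0 ≤ a) (hab : a < b)
    (h1 : volume ({r | β r < ⟪p, e⟫} ∩ Ioo a b) ≠ 0) (h2 : volume ({r | ⟪p, e⟫ < β r} ∩ Ioo a b) ≠ 0) :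
    ∃ r ∈ Ioo a b, r • p ∈ essBoundary (capE (fun _ => e) β) := by
  by_contra! hcon
  have hm : MeasurableSet {r | β r < ⟪p, e⟫} := measurableSet_lt hβ measurable_const
  have hE : MeasurableSet (capE (fun _ => e) β) := capE_measurable measurable_const hβ
  have := density_dichotomy hm hab fun r hr => ?_
  · rcases this with h | h
    · exact h1 h
    · refine h2 (measure_mono_null (inter_subset_inter_left _ ?_) h)
      intro r hr hr2
      exact lt_asymm (show ⟪p, e⟫ < β r from hr) hr2
  · by_contra! hc
    have hr0 : 0 < r := ha.trans_lt hr.1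
    refine hcon r hr (mem_essBoundary_of hE ?_ ?_)
    · exact cap_not_density0 hn hp he hpe hr0 hm hc.1
        (Eventually.of_forall fun s hs => (show β s < ⟪p, e⟫ from hs).le)
        (fun ε hε => Eventually.of_forall fun s _ => by simpa using hε)
    · exact cap_not_density_compl hn hp he hpe hr0 hm.compl hc.2
        (Eventually.of_forall fun s hs => not_lt.1 hs)
        (fun ε hε => Eventually.of_forall fun s _ => by simpa using hε)

theorem band_lower {n : ℕ} (hn : 2 ≤ n) {δ : ℝ} (hδ : 0 < δ) (hδ1 : δ ≤ 1) :
    ∃ c : ℝ, 0 < c ∧ ∀ s t : ℝ, -1 + δ ≤ s → t ≤ 1 - δ →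
      ENNReal.ofReal (c * (t - s)) ≤
        μH[(n:ℝ) - 1] {q : Euc n | ‖q‖ = 1 ∧ s < ⟪q, e1 n (Nat.zero_lt_of_lt hn)⟫ ∧ ⟪q, e1 n (Nat.zero_lt_of_lt hn)⟫ < t} := by
  obtain ⟨m, rfl⟩ : ∃ m, n = m + 2 := ⟨n - 2, by omega⟩
  set η := Real.sqrt (δ / (m + 1)) with hη
  have hη0 : 0 < η := Real.sqrt_pos.2 (by positivity)
  have hη2 : η ^ 2 = δ / (m + 1) := Real.sq_sqrt (by positivity)
  refine ⟨(2 * η) ^ m, by positivity, fun s t hs ht => ?_⟩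
  set T := {q : Euc (m+2) | ‖q‖ = 1 ∧ s < ⟪q, e1 (m+2) (by omega)⟫ ∧ ⟪q, e1 (m+2) (by omega)⟫ < t} with hT
  set pr : Euc (m+2) → (Fin (m+1) → ℝ) := fun q i => q (Fin.castSucc i) with hpr
  have hL : LipschitzWith 1 pr := by
    refine LipschitzWith.of_dist_le_mul fun x y => ?_
    rw [NNReal.coe_one, one_mul]
    refine (dist_pi_le_iff dist_nonneg).2 fun i => ?_
    rw [Real.dist_eq, dist_eq_norm]
    exact (PiLp.norm_apply_le (x - y) (Fin.castSucc i))
  have hcard : ((m + 2 : ℕ) : ℝ) - 1 = (Fintype.card (Fin (m+1)) : ℝ) := by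
    rw [Fintype.card_fin]; push_cast; ring
  have h1 := hL.hausdorffMeasure_image_le (d := ((m + 2 : ℕ) : ℝ) - 1)
    (by rw [hcard]; positivity) T
  rw [ENNReal.coe_one, ENNReal.one_rpow, one_mul] at h1
  refine le_trans ?_ h1
  rw [hcard, hausdorffMeasure_pi_real]
  set box : Set (Fin (m+1) → ℝ) := Set.pi univ (Fin.cons (Ioo s t) fun _ => Ioo (-η) η) with hbox
  have hbv : volume box = ENNReal.ofReal ((2 * η) ^ m * (t - s)) := by
    rw [hbox, volume_pi_pi, Fin.prod_univ_succ]
    simp only [Fin.cons_zero, Fin.cons_succ, Real.volume_Ioo, Finset.prod_const, Finset.card_univ,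
      Fintype.card_fin]
    rw [ENNReal.ofReal_mul (by positivity), ENNReal.ofReal_pow (by positivity), mul_comm]
    congr 3; ring
  rw [← hbv]
  refine measure_mono ?_
  intro z hz
  have hz0 : z 0 ∈ Ioo s t := by simpa using hz 0 (mem_univ _)
  have hzi : ∀ i : Fin m, z i.succ ∈ Ioo (-η) η := fun i => by simpa using hz i.succ (mem_univ _)
  have hle : ∑ i, z i ^ 2 ≤ 1 := by
    rw [Fin.sum_univ_succ]
    have h2 : ∑ i : Fin m, z i.succ ^ 2 ≤ ∑ i : Fin m, η ^ 2 := by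
      refine Finset.sum_le_sum fun i _ => ?_
      have := hzi i
      nlinarith [this.1, this.2]
    rw [Finset.sum_const, Finset.card_univ, Fintype.card_fin, nsmul_eq_mul, hη2] at h2
    have h3 : (m:ℝ) * (δ / (m + 1)) ≤ δ := by
      rw [mul_div_assoc', div_le_iff₀ (by positivity)]; nlinarith
    have h4 : z 0 ^ 2 ≤ 1 - δ := by nlinarith [hz0.1, hz0.2]
    linarith
  set w := Real.sqrt (1 - ∑ i, z i ^ 2)
  have hw : w ^ 2 = 1 - ∑ i, z i ^ 2 := Real.sq_sqrt (by linarith)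
  set q : Euc (m+2) := WithLp.toLp 2 (Fin.snoc z w : Fin (m+2) → ℝ) with hq
  have hqi : ∀ i : Fin (m+1), q (Fin.castSucc i) = z i := fun i => by
    rw [hq]; exact Fin.snoc_castSucc (α := fun _ => ℝ) w z i
  have hql : q (Fin.last (m+1)) = w := by rw [hq]; exact Fin.snoc_last (α := fun _ => ℝ) w z
  have hin : ⟪q, e1 (m+2) (by omega)⟫ = z 0 := by
    unfold e1
    rw [EuclideanSpace.inner_single_right]
    simpa using hqi 0
  refine ⟨q, ⟨?_, ?_, ?_⟩, ?_⟩
  · rw [EuclideanSpace.norm_eq, Real.sqrt_eq_one, Fin.sum_univ_castSucc, hql]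
    simp only [hqi, Real.norm_eq_abs, sq_abs, hw]; ring
  · rw [hin]; exact hz0.1
  · rw [hin]; exact hz0.2
  · ext i; exact hqi i

theorem osc_lemma {n : ℕ} (hn : 2 ≤ n) {β : ℝ → ℝ} (hβ : Measurable β) {a δ : ℝ} (ha : 0 < a)
    (hδ : 0 < δ) (hδ1 : δ ≤ 1) : ∃ C : ℝ, 0 < C ∧ ∀ a' b s t : ℝ, a ≤ a' → a' < b → -1 + δ ≤ s → t ≤ 1 - δ →
      volume ({r | β r < s} ∩ Ioo a' b) ≠ 0 → volume ({r | t < β r} ∩ Ioo a' b) ≠ 0 →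
      ENNReal.ofReal (t - s) ≤ ENNReal.ofReal C *
        radPerim (capE (fun _ => e1 n (Nat.zero_lt_of_lt hn)) β) (Ioo a' b) := by
  have hn1 : (0:ℝ) ≤ (n:ℝ) - 1 := by
    have : (2:ℝ) ≤ n := by exact_mod_cast hn
    linarith
  obtain ⟨c, hc, hband⟩ := band_lower hn hδ hδ1
  set K : ℝ := (a⁻¹) ^ ((n:ℝ) - 1) with hK
  have hK0 : 0 < K := Real.rpow_pos_of_pos (by positivity) _
  refine ⟨K / c, by positivity, fun a' b s t haa' hab hs ht h1 h2 => ?_⟩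
  set e := e1 n (by omega) with he
  have hen : ‖e‖ = 1 := norm_e1 _
  set F := capE (fun _ => e) β with hF
  have hsub : {q : Euc n | ‖q‖ = 1 ∧ s < ⟪q, e⟫ ∧ ⟪q, e⟫ < t} ⊆
      hatv '' (norm ⁻¹' (Ioo a' b) ∩ essBoundary F) := by
    rintro q ⟨hq, hqs, hqt⟩
    obtain ⟨r, hr, hrq⟩ := osc_point (by omega) hen hβ hq (abs_lt.2 ⟨by linarith, by linarith⟩)
      (by linarith : 0 ≤ a') hab
      (fun h => h1 (measure_mono_null (inter_subset_inter_left _ fun x hx => lt_trans hx hqs) h))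
      (fun h => h2 (measure_mono_null (inter_subset_inter_left _ fun x hx => lt_trans hqt hx) h))
    have hr0 : 0 < r := by linarith [hr.1]
    refine ⟨r • q, ⟨?_, hrq⟩, hatv_smul hq hr0⟩
    change ‖r • q‖ ∈ Ioo a' b
    rw [norm_smul, hq, mul_one, Real.norm_of_nonneg hr0.le]; exact hr
  have hL : LipschitzOnWith (a⁻¹).toNNReal hatv (norm ⁻¹' (Ioo a' b) ∩ essBoundary F) := by
    refine LipschitzOnWith.of_dist_le_mul fun x hx y hy => ?_
    rw [dist_eq_norm, dist_eq_norm, Real.coe_toNNReal _ (by positivity)]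
    exact norm_hatv_sub_le ha (haa'.trans (le_of_lt hx.1.1)) (haa'.trans (le_of_lt hy.1.1))
  have h3 := hL.hausdorffMeasure_image_le hn1
  have h4 := (hband s t hs ht).trans ((measure_mono hsub).trans h3)
  rw [← radPerim_apply _ measurableSet_Ioo] at h4
  have h5 : (((a⁻¹).toNNReal : ℝ≥0∞)) ^ ((n:ℝ) - 1) = ENNReal.ofReal K := by
    rw [hK, ← ENNReal.ofReal_rpow_of_pos (by positivity)]; rfl
  rw [h5] at h4
  have hc' : ENNReal.ofReal c ≠ 0 := by simpa using hc
  rw [ENNReal.ofReal_div_of_pos hc]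
  rw [ENNReal.ofReal_mul hc.le] at h4
  calc ENNReal.ofReal (t - s) = (ENNReal.ofReal c)⁻¹ * (ENNReal.ofReal c * ENNReal.ofReal (t - s)) := by
        rw [← mul_assoc, ENNReal.inv_mul_cancel hc' ENNReal.ofReal_ne_top, one_mul]
    _ ≤ (ENNReal.ofReal c)⁻¹ * (ENNReal.ofReal K * radPerim F (Ioo a' b)) := by gcongr
    _ = _ := by rw [div_eq_mul_inv]; ring


/-- Essential right limit. -/
def RLim (f : ℝ → ℝ) (r y : ℝ) : Prop := Tendsto f (𝓝[>] r ⊓ ae (volume : Measure ℝ)) (𝓝 y)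
/-- Essential left limit. -/
def LLim (f : ℝ → ℝ) (r y : ℝ) : Prop := Tendsto f (𝓝[<] r ⊓ ae (volume : Measure ℝ)) (𝓝 y)

instance neBot_right (r : ℝ) : NeBot (𝓝[>] r ⊓ ae (volume : Measure ℝ)) := by
  refine ⟨fun h0 => ?_⟩
  have h : ∀ᶠ x in 𝓝[>] r ⊓ ae (volume : Measure ℝ), False := by rw [h0]; trivial
  exact not_rdensity0_right (A := ∅) (h.mono fun x hx => hx.elim) (by unfold RDensity0; simp)

instance neBot_left (r : ℝ) : NeBot (𝓝[<] r ⊓ ae (volume : Measure ℝ)) := by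
  refine ⟨fun h0 => ?_⟩
  have h : ∀ᶠ x in 𝓝[<] r ⊓ ae (volume : Measure ℝ), False := by rw [h0]; trivial
  exact not_rdensity0_left (A := ∅) (h.mono fun x hx => hx.elim) (by unfold RDensity0; simp)

theorem freq_right {P : ℝ → Prop} {r : ℝ} (h : ∃ᶠ x in 𝓝[>] r ⊓ ae (volume : Measure ℝ), P x)
    {ε : ℝ} (hε : 0 < ε) : volume ({x | P x} ∩ Ioo r (r + ε)) ≠ 0 := by
  intro h0
  refine h (ev_right_iff.2 ⟨ε, hε, ?_⟩)
  rw [ae_iff]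
  refine measure_mono_null ?_ h0
  intro x hx
  have hx : ¬ (x ∈ Ioo r (r + ε) → ¬ P x) := hx
  push Not at hx
  exact ⟨hx.2, hx.1⟩

theorem freq_left {P : ℝ → Prop} {r : ℝ} (h : ∃ᶠ x in 𝓝[<] r ⊓ ae (volume : Measure ℝ), P x)
    {ε : ℝ} (hε : 0 < ε) : volume ({x | P x} ∩ Ioo (r - ε) r) ≠ 0 := by
  intro h0
  refine h (ev_left_iff.2 ⟨ε, hε, ?_⟩)
  rw [ae_iff]
  refine measure_mono_null ?_ h0
  intro x hx
  have hx : ¬ (x ∈ Ioo (r - ε) r → ¬ P x) := hx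
  push Not at hx
  exact ⟨hx.2, hx.1⟩

theorem small_right (μ : Measure ℝ) [IsFiniteMeasure μ] (r : ℝ) {η : ℝ≥0∞} (hη : 0 < η) :
    ∃ ε > 0, ∀ ε' ≤ ε, μ (Ioo r (r + ε')) < η := by
  have h := tendsto_measure_iInter_atTop (μ := μ) (s := fun k : ℕ => Ioo r (r + 1 / ((k:ℝ) + 1)))
    (fun k => measurableSet_Ioo.nullMeasurableSet)
    (fun i j hij => Ioo_subset_Ioo_right (by
      have : 1 / ((j:ℝ) + 1) ≤ 1 / ((i:ℝ) + 1) := Nat.one_div_le_one_div hij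
      linarith)) ⟨0, measure_ne_top _ _⟩
  have h0 : ⋂ k : ℕ, Ioo r (r + 1 / ((k:ℝ) + 1)) = ∅ := by
    ext x
    simp only [mem_iInter, mem_empty_iff_false, iff_false, not_forall]
    by_cases hx : r < x
    · obtain ⟨k, hk⟩ := exists_nat_one_div_lt (sub_pos.2 hx)
      exact ⟨k, fun h => by linarith [h.2]⟩
    · exact ⟨0, fun h => hx h.1⟩
  rw [h0, measure_empty] at h
  obtain ⟨k, hk⟩ := ((tendsto_order.1 h).2 η hη).exists
  exact ⟨1 / ((k:ℝ) + 1), by positivity, fun ε' hε' =>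
    (measure_mono (Ioo_subset_Ioo_right (by linarith))).trans_lt hk⟩

theorem small_left (μ : Measure ℝ) [IsFiniteMeasure μ] (r : ℝ) {η : ℝ≥0∞} (hη : 0 < η) :
    ∃ ε > 0, ∀ ε' ≤ ε, μ (Ioo (r - ε') r) < η := by
  have h := tendsto_measure_iInter_atTop (μ := μ) (s := fun k : ℕ => Ioo (r - 1 / ((k:ℝ) + 1)) r)
    (fun k => measurableSet_Ioo.nullMeasurableSet)
    (fun i j hij => Ioo_subset_Ioo_left (by
      have : 1 / ((j:ℝ) + 1) ≤ 1 / ((i:ℝ) + 1) := Nat.one_div_le_one_div hij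
      linarith)) ⟨0, measure_ne_top _ _⟩
  have h0 : ⋂ k : ℕ, Ioo (r - 1 / ((k:ℝ) + 1)) r = ∅ := by
    ext x
    simp only [mem_iInter, mem_empty_iff_false, iff_false, not_forall]
    by_cases hx : x < r
    · obtain ⟨k, hk⟩ := exists_nat_one_div_lt (sub_pos.2 hx)
      exact ⟨k, fun h => by linarith [h.1]⟩
    · exact ⟨0, fun h => hx h.2⟩
  rw [h0, measure_empty] at h
  obtain ⟨k, hk⟩ := ((tendsto_order.1 h).2 η hη).exists
  exact ⟨1 / ((k:ℝ) + 1), by positivity, fun ε' hε' =>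
    (measure_mono (Ioo_subset_Ioo_left (by linarith))).trans_lt hk⟩

theorem osc_contra {C x : ℝ} {m : ℝ≥0∞} (hC : 0 < C) (hx : 0 < x)
    (h : ENNReal.ofReal x ≤ ENNReal.ofReal C * m) (hm : m < ENNReal.ofReal (x / C)) : False := by
  have h1 : ENNReal.ofReal C * m < ENNReal.ofReal C * ENNReal.ofReal (x / C) :=
    (ENNReal.mul_lt_mul_iff_right (by simpa using hC) ENNReal.ofReal_ne_top).2 hm
  rw [← ENNReal.ofReal_mul hC.le, mul_div_cancel₀ _ hC.ne'] at h1
  exact absurd (h.trans_lt h1) (lt_irrefl _)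

theorem exists_RLim {n : ℕ} (hn : 2 ≤ n) {β : ℝ → ℝ} (hβ : Measurable β) (hβ1 : ∀ r, β r ∈ Icc (-1:ℝ) 1)
    [IsFiniteMeasure (radPerim (capE (fun _ => e1 n (Nat.zero_lt_of_lt hn)) β))] {r : ℝ} (hr : 0 < r) :
    ∃ y ∈ Icc (-1:ℝ) 1, RLim β r y := by
  obtain ⟨y, hy⟩ : ∃ y, RLim β r y := by
    refine tendsto_of_no_upcrossings (s := univ) dense_univ ?_ ?_ ?_
    · rintro a - b - hab ⟨hfa, hfb⟩
      have ha1 : -1 < a := by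
        obtain ⟨x, hx⟩ := hfa.exists
        linarith [(hβ1 x).1]
      have hb1 : b < 1 := by
        obtain ⟨x, hx⟩ := hfb.exists
        linarith [(hβ1 x).2]
      have hδ : 0 < min (1 + a) (1 - b) := lt_min (by linarith) (by linarith)
      have hm1 := min_le_left (1 + a) (1 - b)
      have hm2 := min_le_right (1 + a) (1 - b)
      obtain ⟨C, hC, hosc⟩ := osc_lemma hn hβ hr hδ (by linarith)
      obtain ⟨ε, hε, hsm⟩ := small_right (radPerim (capE (fun _ => e1 n _) β)) r
        (η := ENNReal.ofReal ((b - a) / C)) (by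
          rw [ENNReal.ofReal_pos]; exact div_pos (by linarith) hC)
      exact osc_contra hC (by linarith : 0 < b - a) (hosc r (r + ε) a b le_rfl (by linarith)
        (by linarith) (by linarith) (freq_right hfa hε) (freq_right hfb hε)) (hsm ε le_rfl)
    · exact isBoundedUnder_of ⟨1, fun x => (hβ1 x).2⟩
    · exact isBoundedUnder_of ⟨-1, fun x => (hβ1 x).1⟩
  exact ⟨y, isClosed_Icc.mem_of_tendsto hy (Eventually.of_forall hβ1), hy⟩

theorem exists_LLim {n : ℕ} (hn : 2 ≤ n) {β : ℝ → ℝ} (hβ : Measurable β) (hβ1 : ∀ r, β r ∈ Icc (-1:ℝ) 1)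
    [IsFiniteMeasure (radPerim (capE (fun _ => e1 n (Nat.zero_lt_of_lt hn)) β))] {r : ℝ} (hr : 0 < r) :
    ∃ y ∈ Icc (-1:ℝ) 1, LLim β r y := by
  obtain ⟨y, hy⟩ : ∃ y, LLim β r y := by
    refine tendsto_of_no_upcrossings (s := univ) dense_univ ?_ ?_ ?_
    · rintro a - b - hab ⟨hfa, hfb⟩
      have ha1 : -1 < a := by
        obtain ⟨x, hx⟩ := hfa.exists
        linarith [(hβ1 x).1]
      have hb1 : b < 1 := by
        obtain ⟨x, hx⟩ := hfb.exists
        linarith [(hβ1 x).2]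
      have hδ : 0 < min (1 + a) (1 - b) := lt_min (by linarith) (by linarith)
      have hm1 := min_le_left (1 + a) (1 - b)
      have hm2 := min_le_right (1 + a) (1 - b)
      obtain ⟨C, hC, hosc⟩ := osc_lemma hn hβ (a := r / 2) (by positivity) hδ (by linarith)
      obtain ⟨ε, hε, hsm⟩ := small_left (radPerim (capE (fun _ => e1 n _) β)) r
        (η := ENNReal.ofReal ((b - a) / C)) (by
          rw [ENNReal.ofReal_pos]; exact div_pos (by linarith) hC)
      have hε2 : 0 < min ε (r / 2) := by positivity
      exact osc_contra hC (by linarith : 0 < b - a) (hosc (r - min ε (r / 2)) r a b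
        (by linarith [min_le_right ε (r / 2)]) (by linarith)
        (by linarith) (by linarith) (freq_left hfa hε2) (freq_left hfb hε2)) (hsm _ (min_le_left _ _))
    · exact isBoundedUnder_of ⟨1, fun x => (hβ1 x).2⟩
    · exact isBoundedUnder_of ⟨-1, fun x => (hβ1 x).1⟩
  exact ⟨y, isClosed_Icc.mem_of_tendsto hy (Eventually.of_forall hβ1), hy⟩

theorem rdensity0_of_ae {A : Set ℝ} {r ε : ℝ} (hε : 0 < ε)
    (h : ∀ᵐ x ∂(volume : Measure ℝ), x ∈ Ioo (r - ε) (r + ε) → x ∉ A) : RDensity0 A r := by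
  refine tendsto_const_nhds.congr' ?_
  filter_upwards [Ioo_mem_nhdsGT hε] with ρ hρ
  have : volume (A ∩ ball r ρ) = 0 := by
    rw [ae_iff] at h
    refine measure_mono_null ?_ h
    rintro x ⟨hxA, hxb⟩ hcon
    rw [Real.ball_eq_Ioo] at hxb
    exact hcon ⟨by linarith [hxb.1, hρ.2], by linarith [hxb.2, hρ.2]⟩ hxA
  rw [this, ENNReal.zero_div]

theorem apInf_eq {f : ℝ → ℝ} {r a b : ℝ} (ha : LLim f r a) (hb : RLim f r b) : apInf f r = min a b := by
  unfold apInf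
  have h1 : Iio (min a b) ⊆ {t : ℝ | RDensity0 {y | f y < t} r} := by
    intro t ht
    obtain ⟨ε, hε, h⟩ := ev_nhds_of_sides (hb.eventually (lt_mem_nhds (lt_of_lt_of_le ht (min_le_right a b))))
      (ha.eventually (lt_mem_nhds (lt_of_lt_of_le ht (min_le_left a b))))
    exact rdensity0_of_ae hε (h.mono fun x hx hx2 hx3 => lt_asymm (hx hx2) hx3)
  have h2 : {t : ℝ | RDensity0 {y | f y < t} r} ⊆ Iic (min a b) := by
    intro t ht
    by_contra! hc
    have hc : min a b < t := not_le.1 hc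
    rcases min_lt_iff.1 hc with h | h
    · exact not_rdensity0_left (ha.eventually (gt_mem_nhds h)) ht
    · exact not_rdensity0_right (hb.eventually (gt_mem_nhds h)) ht
  refine le_antisymm (csSup_le ⟨min a b - 1, h1 (show min a b - 1 < min a b by linarith)⟩ h2) ?_
  refine le_of_forall_lt fun c hc => ?_
  obtain ⟨x, hx1, hx2⟩ := exists_between hc
  exact hx1.trans_le (le_csSup ⟨min a b, h2⟩ (h1 hx2))

theorem apSup_eq {f : ℝ → ℝ} {r a b : ℝ} (ha : LLim f r a) (hb : RLim f r b) : apSup f r = max a b := by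
  unfold apSup
  have h1 : Ioi (max a b) ⊆ {t : ℝ | RDensity0 {y | t < f y} r} := by
    intro t ht
    obtain ⟨ε, hε, h⟩ := ev_nhds_of_sides (hb.eventually (gt_mem_nhds (lt_of_le_of_lt (le_max_right a b) ht)))
      (ha.eventually (gt_mem_nhds (lt_of_le_of_lt (le_max_left a b) ht)))
    exact rdensity0_of_ae hε (h.mono fun x hx hx2 hx3 => lt_asymm (hx hx2) hx3)
  have h2 : {t : ℝ | RDensity0 {y | t < f y} r} ⊆ Ici (max a b) := by
    intro t ht
    by_contra! hc
    have hc : t < max a b := not_le.1 hc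
    rcases lt_max_iff.1 hc with h | h
    · exact not_rdensity0_left (ha.eventually (lt_mem_nhds h)) ht
    · exact not_rdensity0_right (hb.eventually (lt_mem_nhds h)) ht
  refine le_antisymm ?_ (le_csInf ⟨max a b + 1, h1 (show max a b < max a b + 1 by linarith)⟩ h2)
  refine le_of_forall_gt fun c hc => ?_
  obtain ⟨x, hx1, hx2⟩ := exists_between hc
  exact (csInf_le ⟨max a b, h2⟩ (h1 hx1)).trans_lt hx2

/-- Membership in the set `I`, in terms of the one-sided essential limits of `cos α`. -/
theorem mem_I_iff {α : ℝ → ℝ} (hα : ∀ r, α r ∈ Icc (0:ℝ) Real.pi) {r y z : ℝ}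
    (hy : y ∈ Icc (-1:ℝ) 1) (hz : z ∈ Icc (-1:ℝ) 1)
    (hL : LLim (fun r => Real.cos (α r)) r y) (hR : RLim (fun r => Real.cos (α r)) r z) :
    (0 < apInf α r ∧ apInf α r ≤ apSup α r ∧ apSup α r < Real.pi) ↔ y ∈ Ioo (-1:ℝ) 1 ∧ z ∈ Ioo (-1:ℝ) 1 := by
  have hac : α = fun r => Real.arccos (Real.cos (α r)) := by
    ext s; rw [Real.arccos_cos (hα s).1 (hα s).2]
  have hL' : LLim α r (Real.arccos y) := by
    rw [hac]; exact (Real.continuous_arccos.tendsto y).comp hL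
  have hR' : RLim α r (Real.arccos z) := by
    rw [hac]; exact (Real.continuous_arccos.tendsto z).comp hR
  rw [apInf_eq hL' hR', apSup_eq hL' hR', lt_min_iff, max_lt_iff]
  simp only [Real.arccos_pos, Real.arccos_lt_pi, mem_Ioo]
  have : min (Real.arccos y) (Real.arccos z) ≤ max (Real.arccos y) (Real.arccos z) := min_le_max
  tauto


/-- Two distinct unit directions are separated at every level in `(-1,1)`. -/
theorem exists_sep {n : ℕ} {d0 d1 : Euc n} (h0 : ‖d0‖ = 1) (h1 : ‖d1‖ = 1) (hne : d0 ≠ d1)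
    {y : ℝ} (hy : y ∈ Ioo (-1:ℝ) 1) : ∃ q : Euc n, ‖q‖ = 1 ∧ ⟪q, d1⟫ < y ∧ y < ⟪q, d0⟫ := by
  set c := ⟪d0, d1⟫ with hc
  have h00 : ⟪d0, d0⟫ = 1 := by rw [real_inner_self_eq_norm_sq, h0]; norm_num
  have h11 : ⟪d1, d1⟫ = 1 := by rw [real_inner_self_eq_norm_sq, h1]; norm_num
  have h10 : ⟪d1, d0⟫ = c := real_inner_comm _ _
  have hc1 : c < 1 := by
    refine lt_of_le_of_ne ?_ ?_
    · have := real_inner_le_norm d0 d1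
      rw [h0, h1] at this; linarith
    · intro h; exact hne ((inner_eq_one_iff_of_norm_eq_one h0 h1).1 h)
  by_cases hA : c < y
  · exact ⟨d0, h0, hA, by rw [h00]; exact hy.2⟩
  by_cases hB : y < -c
  · refine ⟨-d1, by rw [norm_neg, h1], ?_, ?_⟩
    · rw [inner_neg_left, h11]; exact hy.1
    · rw [inner_neg_left, h10]; exact hB
  push Not at hA hB
  have hcp : 0 ≤ c := by linarith
  have hy2 : y ^ 2 ≤ c ^ 2 := sq_le_sq' (by linarith) hA
  set x := y / (1 + c) with hx
  have hxy : x * (1 + c) = y := by rw [hx]; field_simp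
  have hpos : 0 < 1 - x ^ 2 * (2 + 2 * c) := by
    have : x ^ 2 * (2 + 2 * c) * (1 + c) = 2 * y ^ 2 := by rw [← hxy]; ring
    by_contra! hcon
    nlinarith
  set z := Real.sqrt ((1 - x ^ 2 * (2 + 2 * c)) / (2 - 2 * c)) with hz
  have hzpos : 0 < z := Real.sqrt_pos.2 (div_pos hpos (by linarith))
  have hz2 : z ^ 2 * (2 - 2 * c) = 1 - x ^ 2 * (2 + 2 * c) := by
    rw [hz, Real.sq_sqrt (div_pos hpos (by linarith)).le]
    exact div_mul_cancel₀ _ (by linarith)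
  refine ⟨x • (d0 + d1) + z • (d0 - d1), ?_, ?_, ?_⟩
  · have : ‖x • (d0 + d1) + z • (d0 - d1)‖ ^ 2 = 1 := by
      rw [← real_inner_self_eq_norm_sq]
      simp only [inner_add_left, inner_add_right, inner_sub_left, inner_sub_right, real_inner_smul_left,
        real_inner_smul_right, h00, h11, h10, ← hc]
      linarith
    nlinarith [norm_nonneg (x • (d0 + d1) + z • (d0 - d1))]
  · simp only [inner_add_left, inner_sub_left, real_inner_smul_left, h11, ← hc]
    nlinarith
  · simp only [inner_add_left, inner_sub_left, real_inner_smul_left, h00, h10]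
    nlinarith

theorem sector_pos {n : ℕ} {A : Set ℝ} (hA : MeasurableSet A) (hA0 : volume (A ∩ Ioi 0) ≠ 0)
    {N : Set (Euc n)} (hN : IsOpen N) {q : Euc n} (hq : ‖q‖ = 1) (hqN : q ∈ N) :
    volume (sector A N) ≠ 0 := by
  rw [polar_volume hA hN.measurableSet]
  refine mul_ne_zero ?_ ?_
  · intro h
    have h1 : volume (sector (Ioi 0) N) = 0 := by
      rw [polar_volume measurableSet_Ioi hN.measurableSet, h, zero_mul]
    have hq0 : q ≠ 0 := by intro h; rw [h] at hq; simp at hq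
    have hcont : ContinuousAt (hatv : Euc n → Euc n) q := by
      unfold hatv
      exact (continuous_norm.continuousAt.inv₀ (norm_ne_zero_iff.2 hq0)).smul continuousAt_id
    have hmem : sector (Ioi 0) N ∈ 𝓝 q := by
      have h1 : hatv ⁻¹' N ∈ 𝓝 q := by
        refine hcont (hN.mem_nhds ?_)
        have := hatv_smul hq one_pos
        rw [one_smul] at this; rwa [this]
      filter_upwards [h1, isOpen_ne.mem_nhds hq0] with x hx1 hx2
      exact ⟨hx2, norm_pos_iff.2 hx2, hx1⟩
    exact (Measure.measure_pos_of_mem_nhds volume hmem).ne' h1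
  · have : 0 < ∫⁻ r in A ∩ Ioi 0, ENNReal.ofReal (r ^ (n - 1)) := by
      rw [setLIntegral_pos_iff (by fun_prop)]
      refine lt_of_lt_of_le (pos_iff_ne_zero.2 hA0) (measure_mono ?_)
      intro r hr
      refine ⟨?_, hr⟩
      have : (0:ℝ) < r := hr.2
      simp only [Function.mem_support, ne_eq, ENNReal.ofReal_eq_zero, not_le]
      positivity
    exact this.ne'

theorem capE_dir_unique {n : ℕ} {β : ℝ → ℝ} (hβ : Measurable β) {d : ℝ → Euc n} {d0 p : Euc n}
    (h0 : ‖d0‖ = 1) (hp : ‖p‖ = 1) {A : Set ℝ} (hA : MeasurableSet A) (hdA : ∀ r ∈ A, d r = d0)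
    (hA0 : volume ({r ∈ A | β r ∈ Ioo (-1:ℝ) 1} ∩ Ioi 0) ≠ 0)
    (hE : volume (symmDiff (capE d β) (capE (fun _ => p) β)) = 0) : p = d0 := by
  by_contra hne
  have hne : d0 ≠ p := fun h => hne h.symm
  -- cover by rational windows
  have hcov : {r ∈ A | β r ∈ Ioo (-1:ℝ) 1} ∩ Ioi 0 ⊆ ⋃ u : ℚ, ⋃ w : ℚ,
      ⋃ _ : ∃ q : Euc n, ‖q‖ = 1 ∧ ⟪q, p⟫ < u ∧ (w:ℝ) < ⟪q, d0⟫,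
      {r ∈ A | β r ∈ Ioo (u:ℝ) w} ∩ Ioi 0 := by
    rintro r ⟨⟨hrA, hrβ⟩, hr0⟩
    obtain ⟨q, hq, hq1, hq2⟩ := exists_sep h0 hp hne hrβ
    obtain ⟨u, hu1, hu2⟩ := exists_rat_btwn hq1
    obtain ⟨w, hw1, hw2⟩ := exists_rat_btwn hq2
    simp only [mem_iUnion]
    exact ⟨u, w, ⟨q, hq, hu1, hw2⟩, ⟨hrA, hu2, hw1⟩, hr0⟩
  refine hA0 (measure_mono_null hcov ?_)
  refine measure_iUnion_null fun u => measure_iUnion_null fun w => measure_iUnion_null ?_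
  rintro ⟨q, hq, hqu, hqw⟩
  by_contra hpos
  have hN : IsOpen {q : Euc n | ⟪q, p⟫ < (u:ℝ) ∧ (w:ℝ) < ⟪q, d0⟫} := by
    have h1 : IsOpen {q : Euc n | ⟪q, p⟫ < (u:ℝ)} := isOpen_lt (by fun_prop) (by fun_prop)
    have h2 : IsOpen {q : Euc n | (w:ℝ) < ⟪q, d0⟫} := isOpen_lt (by fun_prop) (by fun_prop)
    exact h1.inter h2
  refine sector_pos (hA.inter (hβ measurableSet_Ioo)) hpos hN hq ⟨hqu, hqw⟩
    (measure_mono_null ?_ hE)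
  rintro x ⟨hx0, ⟨hxA, hxβ⟩, hx1, hx2⟩
  left
  have hxβ : β ‖x‖ ∈ Ioo (u:ℝ) w := hxβ
  refine ⟨⟨hx0, ?_⟩, ?_⟩
  · rw [hdA _ hxA]; exact hxβ.2.trans hx2
  · rintro ⟨-, h⟩
    linarith [hxβ.1]

theorem densityAt_image {n : ℕ} (R : Euc n ≃ₗᵢ[ℝ] Euc n) (E : Set (Euc n)) (x : Euc n) (t : ℝ≥0∞) :
    DensityAt (R '' E) (R x) t ↔ DensityAt E x t := by
  unfold DensityAt
  have h (s : Set (Euc n)) : volume (R '' s) = volume s := by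
    rw [← R.measurePreserving.measure_preimage_emb R.toHomeomorph.measurableEmbedding,
      preimage_image_eq _ R.injective]
  refine tendsto_congr fun ρ => ?_
  rw [← R.image_ball, ← image_inter R.injective, h, h]

theorem essBoundary_image {n : ℕ} (R : Euc n ≃ₗᵢ[ℝ] Euc n) (E : Set (Euc n)) :
    essBoundary (R '' E) = R '' essBoundary E := by
  ext x
  obtain ⟨x, rfl⟩ := R.surjective x
  rw [R.injective.mem_set_image]
  simp only [essBoundary, mem_setOf_eq, densityAt_image]

theorem hatv_map {n : ℕ} (R : Euc n ≃ₗᵢ[ℝ] Euc n) (x : Euc n) : hatv (R x) = R (hatv x) := by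
  unfold hatv; simp

theorem capE_image {n : ℕ} (R : Euc n ≃ₗᵢ[ℝ] Euc n) (d0 : Euc n) (β : ℝ → ℝ) :
    R '' capE (fun _ => d0) β = capE (fun _ => R d0) β := by
  ext x
  obtain ⟨x, rfl⟩ := R.surjective x
  rw [R.injective.mem_set_image]
  simp [capE, hatv_map]

theorem radPerim_image {n : ℕ} (R : Euc n ≃ₗᵢ[ℝ] Euc n) (E : Set (Euc n)) :
    radPerim (R '' E) = radPerim E := by
  ext B hB
  rw [radPerim_apply _ hB, radPerim_apply _ hB, essBoundary_image,
    ← hmeas_isom R ((n:ℝ) - 1) (norm ⁻¹' B ∩ essBoundary E), image_inter R.injective]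
  congr 2
  ext x
  obtain ⟨x, rfl⟩ := R.surjective x
  rw [R.injective.mem_set_image]; simp

theorem radPerim_dir {n : ℕ} {d d' : Euc n} (hd : ‖d‖ = 1) (hd' : ‖d'‖ = 1) (β : ℝ → ℝ) :
    radPerim (capE (fun _ => d) β) = radPerim (capE (fun _ => d') β) := by
  obtain ⟨R, rfl⟩ := exists_isometry hd hd'
  rw [← capE_image, radPerim_image]

theorem radPerim_local {n : ℕ} {E E' : Set (Euc n)} {a b : ℝ}
    (h : ∀ᵐ x : Euc n, ‖x‖ ∈ Ioo a b → (x ∈ E ↔ x ∈ E')) :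
    (radPerim E).restrict (Ioo a b) = (radPerim E').restrict (Ioo a b) := by
  ext B hB
  rw [Measure.restrict_apply hB, Measure.restrict_apply hB, radPerim_apply _ (hB.inter measurableSet_Ioo),
    radPerim_apply _ (hB.inter measurableSet_Ioo)]
  congr 1
  ext x
  refine and_congr_right fun hx => ?_
  have hx2 : ‖x‖ ∈ Ioo a b := hx.2
  have ho : IsOpen {x : Euc n | ‖x‖ ∈ Ioo a b} := isOpen_Ioo.preimage continuous_norm
  obtain ⟨ε, hε, hs⟩ := Metric.isOpen_iff.1 ho x hx2
  exact essBoundary_congr hε (h.mono fun z hz hz2 => hz (hs hz2))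

/-- Rigidity, restricted to competitors of cap type. -/
def Rig (n : ℕ) (e : Euc n) (β : ℝ → ℝ) : Prop :=
  ∀ d : ℝ → Euc n, Measurable d → (∀ r, ‖d r‖ = 1) →
    radPerim (capE d β) univ = radPerim (capE (fun _ => e) β) univ →
    ∃ R : Euc n ≃ₗᵢ[ℝ] Euc n, volume (symmDiff (capE d β) (R '' capE (fun _ => e) β)) = 0

theorem radPerim_nonpos {n : ℕ} (hn : 2 ≤ n) (E : Set (Euc n)) : radPerim E (Iic 0) = 0 := by
  rw [radPerim_apply _ measurableSet_Iic]
  refine measure_mono_null ?_ (hmeas_singleton hn (0 : Euc n))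
  rintro x ⟨hx, -⟩
  have : ‖x‖ ≤ 0 := hx
  simpa using this

theorem rigid_contra {n : ℕ} (hn : 2 ≤ n) {e : Euc n} (he : ‖e‖ = 1) {β : ℝ → ℝ} (hβ : Measurable β)
    (hrig : Rig n e β) {S : Set ℝ} (hS : MeasurableSet S) {d : ℝ → Euc n} (hd : Measurable d)
    (hdn : ∀ r, ‖d r‖ = 1)
    (hloc : ∀ r, 0 < r → r ∉ S → ∃ ε > 0, ∀ s ∈ Ioo (r - ε) (r + ε), d s = d r)
    (hSeq : radPerim (capE d β) S = radPerim (capE (fun _ => e) β) S)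
    {A1 A2 : Set ℝ} (hA1 : MeasurableSet A1) (hA2 : MeasurableSet A2) {d1 d2 : Euc n} (hne : d1 ≠ d2)
    (h1 : ∀ r ∈ A1, d r = d1) (h2 : ∀ r ∈ A2, d r = d2)
    (hp1 : volume ({r ∈ A1 | β r ∈ Ioo (-1:ℝ) 1} ∩ Ioi 0) ≠ 0)
    (hp2 : volume ({r ∈ A2 | β r ∈ Ioo (-1:ℝ) 1} ∩ Ioi 0) ≠ 0) : False := by
  have hnA1 : ‖d1‖ = 1 := by
    obtain ⟨r, hr⟩ := nonempty_of_measure_ne_zero hp1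
    rw [← h1 r hr.1.1]; exact hdn r
  have hnA2 : ‖d2‖ = 1 := by
    obtain ⟨r, hr⟩ := nonempty_of_measure_ne_zero hp2
    rw [← h2 r hr.1.1]; exact hdn r
  have hout : (radPerim (capE d β)).restrict (Ioi 0 \ S) =
      (radPerim (capE (fun _ => e) β)).restrict (Ioi 0 \ S) := by
    choose! ε hε hεd using hloc
    obtain ⟨t, hts, htc, htcov⟩ := TopologicalSpace.countable_cover_nhdsWithin
      (s := Ioi 0 \ S) (f := fun r => Ioo (r - ε r) (r + ε r)) (by
        intro r hr
        refine mem_nhdsWithin_of_mem_nhds (Ioo_mem_nhds ?_ ?_) <;>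
        linarith [hε r hr.1 hr.2])
    have key : (radPerim (capE d β)).restrict (⋃ r ∈ t, Ioo (r - ε r) (r + ε r)) =
        (radPerim (capE (fun _ => e) β)).restrict (⋃ r ∈ t, Ioo (r - ε r) (r + ε r)) := by
      rw [Measure.restrict_biUnion_congr htc]
      intro r hr
      rw [radPerim_dir he (hdn r) β]
      refine radPerim_local (Eventually.of_forall fun x hx => ?_)
      simp only [capE, mem_setOf_eq]
      rw [hεd r (hts hr).1 (hts hr).2 _ hx]
    rw [← Measure.restrict_restrict_of_subset htcov, key, Measure.restrict_restrict_of_subset htcov]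
  have htot : radPerim (capE d β) univ = radPerim (capE (fun _ => e) β) univ := by
    have hdec (μ : Measure ℝ) (h0 : μ (Iic 0) = 0) : μ univ = μ (S ∩ Ioi 0) + μ (Ioi 0 \ S) := by
      rw [inter_comm, measure_inter_add_diff _ hS, ← compl_Iic, measure_compl measurableSet_Iic (by simp [h0]), h0]
      simp
    have hdec2 (μ : Measure ℝ) (h0 : μ (Iic 0) = 0) : μ (S ∩ Ioi 0) = μ S := by
      rw [← compl_Iic, ← diff_eq]; exact measure_diff_null h0
    rw [hdec _ (radPerim_nonpos hn _), hdec _ (radPerim_nonpos hn _), hdec2 _ (radPerim_nonpos hn _),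
      hdec2 _ (radPerim_nonpos hn _), hSeq]
    congr 1
    have := congrArg (fun μ => μ univ) hout
    simpa using this
  obtain ⟨R, hR⟩ := hrig d hd hdn htot
  rw [capE_image] at hR
  have hRe : ‖R e‖ = 1 := by rw [R.norm_map, he]
  exact hne ((capE_dir_unique hβ hnA1 hRe hA1 h1 hp1 hR).symm.trans
    (capE_dir_unique hβ hnA2 hRe hA2 h2 hp2 hR))


theorem side_not_density0 {n : ℕ} (hn : 1 ≤ n) {d : ℝ → Euc n} {β : ℝ → ℝ} (hβ : Measurable β)
    {U : Set ℝ} (hU : MeasurableSet U) {r : ℝ} (hr : 0 < r)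
    (hUd : ∀ A : Set ℝ, (∀ᶠ x in 𝓝[U] r ⊓ ae (volume : Measure ℝ), x ∈ A) → ¬ RDensity0 A r)
    {e p : Euc n} (he : ‖e‖ = 1) (hp : ‖p‖ = 1) (hd : ∀ s ∈ U, d s = e) {y : ℝ}
    (hy : Tendsto β (𝓝[U] r ⊓ ae (volume : Measure ℝ)) (𝓝 y)) (hpe : |⟪p, e⟫| < 1) (hyp : y < ⟪p, e⟫) :
    ¬ DensityAt (capE d β) (r • p) 0 := by
  refine cap_not_density0 hn hp he hpe hr (A := {s | β s < ⟪p, e⟫} ∩ U)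
    ((hβ measurableSet_Iio).inter hU) (hUd _ ?_) ?_ ?_
  · filter_upwards [hy.eventually (gt_mem_nhds hyp), (inf_le_left : 𝓝[U] r ⊓ ae volume ≤ _) self_mem_nhdsWithin]
      with s h1 h2
    exact ⟨h1, h2⟩
  · refine Eventually.of_forall fun s hs => ?_
    rw [hd s hs.2]; exact le_of_lt hs.1
  · intro ε hε
    refine Eventually.of_forall fun s hs => ?_
    rw [hd s hs.2, sub_self, norm_zero]; exact hε

theorem side_not_density_compl {n : ℕ} (hn : 1 ≤ n) {d : ℝ → Euc n} {β : ℝ → ℝ} (hβ : Measurable β)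
    {U : Set ℝ} (hU : MeasurableSet U) {r : ℝ} (hr : 0 < r)
    (hUd : ∀ A : Set ℝ, (∀ᶠ x in 𝓝[U] r ⊓ ae (volume : Measure ℝ), x ∈ A) → ¬ RDensity0 A r)
    {e p : Euc n} (he : ‖e‖ = 1) (hp : ‖p‖ = 1) (hd : ∀ s ∈ U, d s = e) {y : ℝ}
    (hy : Tendsto β (𝓝[U] r ⊓ ae (volume : Measure ℝ)) (𝓝 y)) (hpe : |⟪p, e⟫| < 1) (hyp : ⟪p, e⟫ < y) :
    ¬ DensityAt (capE d β)ᶜ (r • p) 0 := by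
  refine cap_not_density_compl hn hp he hpe hr (A := {s | ⟪p, e⟫ < β s} ∩ U)
    ((hβ measurableSet_Ioi).inter hU) (hUd _ ?_) ?_ ?_
  · filter_upwards [hy.eventually (lt_mem_nhds hyp), (inf_le_left : 𝓝[U] r ⊓ ae volume ≤ _) self_mem_nhdsWithin]
      with s h1 h2
    exact ⟨h1, h2⟩
  · refine Eventually.of_forall fun s hs => ?_
    rw [hd s hs.2]; exact le_of_lt hs.1
  · intro ε hε
    refine Eventually.of_forall fun s hs => ?_
    rw [hd s hs.2, sub_self, norm_zero]; exact hε

/-- The essential boundary on a sphere across which direction and level jump. -/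
theorem jump_mem {n : ℕ} (hn : 1 ≤ n) {d : ℝ → Euc n} (hd : Measurable d) (hdn : ∀ s, ‖d s‖ = 1)
    {β : ℝ → ℝ} (hβ : Measurable β)
    {r : ℝ} (hr : 0 < r) {e e' p : Euc n} (he : ‖e‖ = 1) (he' : ‖e'‖ = 1) (hp : ‖p‖ = 1)
    (hdL : ∀ s ∈ Iio r, d s = e) (hdR : ∀ s ∈ Ioi r, d s = e') {y z : ℝ}
    (hy : LLim β r y) (hz : RLim β r z) (hpe : |⟪p, e⟫| < 1) (hpe' : |⟪p, e'⟫| < 1)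
    (h1 : ⟪p, e⟫ ≠ y) (h2 : ⟪p, e'⟫ ≠ z) :
    r • p ∈ essBoundary (capE d β) ↔ p ∈ (ucap e y \ ucap e' z) ∪ (ucap e' z \ ucap e y) := by
  have hE := capE_measurable hd hβ
  have hLU := fun A h => not_rdensity0_left (A := A) (r := r) h
  have hRU := fun A h => not_rdensity0_right (A := A) (r := r) h
  rcases lt_or_gt_of_ne h1 with h1 | h1 <;> rcases lt_or_gt_of_ne h2 with h2 | h2
  · -- outside both
    have hm : ¬ p ∈ (ucap e y \ ucap e' z) ∪ (ucap e' z \ ucap e y) := by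
      rintro (⟨⟨-, h⟩, -⟩ | ⟨⟨-, h⟩, -⟩)
      · exact lt_asymm h h1
      · exact lt_asymm h h2
    refine iff_of_false ?_ hm
    set η := min (y - ⟪p, e⟫) (z - ⟪p, e'⟫) / 2 with hη
    have hηp : 0 < η := by
      have : 0 < min (y - ⟪p, e⟫) (z - ⟪p, e'⟫) := lt_min (by linarith) (by linarith)
      linarith
    have hη1 : ⟪p, e⟫ + η < y := by linarith [min_le_left (y - ⟪p, e⟫) (z - ⟪p, e'⟫)]
    have hη2 : ⟪p, e'⟫ + η < z := by linarith [min_le_right (y - ⟪p, e⟫) (z - ⟪p, e'⟫)]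
    have hs : ∃ ε > 0, ∀ᵐ s ∂(volume : Measure ℝ), s ∈ Ioo (r - ε) (r + ε) → ⟪p, d s⟫ + η ≤ β s := by
      refine ev_nhds_of_sides ?_ ?_
      · filter_upwards [hz.eventually (lt_mem_nhds hη2),
          (inf_le_left : 𝓝[>] r ⊓ ae volume ≤ _) self_mem_nhdsWithin] with s h1 h2
        rw [hdR s h2]; exact h1.le
      · filter_upwards [hy.eventually (lt_mem_nhds hη1),
          (inf_le_left : 𝓝[<] r ⊓ ae volume ≤ _) self_mem_nhdsWithin] with s h1 h2
        rw [hdL s h2]; exact h1.le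
    obtain ⟨ε, hε, hs⟩ := hs
    exact cap_not_mem_of_above hdn hp hr hηp hε hs
  · have hm : p ∈ (ucap e y \ ucap e' z) ∪ (ucap e' z \ ucap e y) :=
      Or.inr ⟨⟨hp, h2⟩, fun h => lt_asymm h.2 h1⟩
    refine iff_of_true (mem_essBoundary_of hE ?_ ?_) hm
    · exact side_not_density0 hn hβ measurableSet_Ioi hr hRU he' hp hdR hz hpe' h2
    · exact side_not_density_compl hn hβ measurableSet_Iio hr hLU he hp hdL hy hpe h1
  · have hm : p ∈ (ucap e y \ ucap e' z) ∪ (ucap e' z \ ucap e y) :=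
      Or.inl ⟨⟨hp, h1⟩, fun h => lt_asymm h.2 h2⟩
    refine iff_of_true (mem_essBoundary_of hE ?_ ?_) hm
    · exact side_not_density0 hn hβ measurableSet_Iio hr hLU he hp hdL hy hpe h1
    · exact side_not_density_compl hn hβ measurableSet_Ioi hr hRU he' hp hdR hz hpe' h2
  · -- inside both
    have hm : ¬ p ∈ (ucap e y \ ucap e' z) ∪ (ucap e' z \ ucap e y) := by
      rintro (⟨-, h⟩ | ⟨-, h⟩)
      · exact h ⟨hp, h2⟩
      · exact h ⟨hp, h1⟩
    refine iff_of_false ?_ hm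
    set η := min (⟪p, e⟫ - y) (⟪p, e'⟫ - z) / 2 with hη
    have hηp : 0 < η := by
      have : 0 < min (⟪p, e⟫ - y) (⟪p, e'⟫ - z) := lt_min (by linarith) (by linarith)
      linarith
    have hη1 : y < ⟪p, e⟫ - η := by linarith [min_le_left (⟪p, e⟫ - y) (⟪p, e'⟫ - z)]
    have hη2 : z < ⟪p, e'⟫ - η := by linarith [min_le_right (⟪p, e⟫ - y) (⟪p, e'⟫ - z)]
    have hs : ∃ ε > 0, ∀ᵐ s ∂(volume : Measure ℝ), s ∈ Ioo (r - ε) (r + ε) → β s ≤ ⟪p, d s⟫ - η := by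
      refine ev_nhds_of_sides ?_ ?_
      · filter_upwards [hz.eventually (gt_mem_nhds hη2),
          (inf_le_left : 𝓝[>] r ⊓ ae volume ≤ _) self_mem_nhdsWithin] with s h1 h2
        rw [hdR s h2]; exact h1.le
      · filter_upwards [hy.eventually (gt_mem_nhds hη1),
          (inf_le_left : 𝓝[<] r ⊓ ae volume ≤ _) self_mem_nhdsWithin] with s h1 h2
        rw [hdL s h2]; exact h1.le
    obtain ⟨ε, hε, hs⟩ := hs
    exact cap_not_mem_of_below hdn hp hr hηp hε hs

theorem jump_measure {n : ℕ} (hn : 2 ≤ n) (hfin : μH[(n:ℝ) - 1] (sphere (0 : Euc n) 1) < ⊤)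
    {d : ℝ → Euc n} (hd : Measurable d) (hdn : ∀ s, ‖d s‖ = 1)
    {β : ℝ → ℝ} (hβ : Measurable β)
    {r : ℝ} (hr : 0 < r) {e e' : Euc n} (he : ‖e‖ = 1) (he' : ‖e'‖ = 1)
    (hdL : ∀ s ∈ Iio r, d s = e) (hdR : ∀ s ∈ Ioi r, d s = e') {y z : ℝ}
    (hy : LLim β r y) (hz : RLim β r z) :
    radPerim (capE d β) {r} = ENNReal.ofReal r ^ ((n:ℝ) - 1) *
      μH[(n:ℝ) - 1] ((ucap e y \ ucap e' z) ∪ (ucap e' z \ ucap e y)) := by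
  rw [radPerim_apply _ (measurableSet_singleton r), ← hmeas_smul (by omega) hr]
  refine measure_congr ?_
  set N : Set (Euc n) := ulev e y ∪ ulev e' z ∪ (ulev e 1 ∪ ulev e (-1)) ∪ (ulev e' 1 ∪ ulev e' (-1)) with hN
  have hNnull : μH[(n:ℝ) - 1] ((fun x : Euc n => r • x) '' N) = 0 := by
    rw [hmeas_smul (by omega) hr]
    have : μH[(n:ℝ) - 1] N = 0 := by
      simp only [hN, measure_union_null_iff]
      have h := fun y => level_null hn hfin he y
      have h' := fun y => level_null hn hfin he' y
      exact ⟨⟨⟨h _, h' _⟩, h _, h _⟩, h' _, h' _⟩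
    rw [this, mul_zero]
  have hae : ∀ᵐ x ∂(μH[(n:ℝ) - 1] : Measure (Euc n)), x ∉ (fun x : Euc n => r • x) '' N :=
    measure_eq_zero_iff_ae_notMem.1 hNnull
  filter_upwards [hae] with x hx
  refine propext ?_
  change x ∈ norm ⁻¹' {r} ∩ essBoundary (capE d β) ↔ _ ∈ (fun x : Euc n => r • x) '' _
  have habs {p e : Euc n} (hp : ‖p‖ = 1) (he : ‖e‖ = 1) (h1 : p ∉ ulev e 1) (h2 : p ∉ ulev e (-1)) :
      |⟪p, e⟫| < 1 := by
    refine lt_of_le_of_ne (abs_inner_le_one hp he) fun h => ?_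
    rcases eq_or_eq_neg_of_abs_eq h with h | h
    · exact h1 ⟨hp, h⟩
    · exact h2 ⟨hp, h⟩
  have key (p : Euc n) (hp : ‖p‖ = 1) (hpN : p ∉ N) :
      r • p ∈ essBoundary (capE d β) ↔ p ∈ (ucap e y \ ucap e' z) ∪ (ucap e' z \ ucap e y) := by
    simp only [hN, mem_union, not_or] at hpN
    obtain ⟨⟨⟨a1, a2⟩, a3, a4⟩, a5, a6⟩ := hpN
    exact jump_mem (by omega) hd hdn hβ hr he he' hp hdL hdR hy hz (habs hp he a3 a4) (habs hp he' a5 a6)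
      (fun h => a1 ⟨hp, h⟩) (fun h => a2 ⟨hp, h⟩)
  constructor
  · rintro ⟨hxr, hxE⟩
    have hxr : ‖x‖ = r := hxr
    have hx0 : x ≠ 0 := by rw [← norm_pos_iff, hxr]; exact hr
    have hxx : r • hatv x = x := by rw [← hxr]; exact smul_hatv x hx0
    have hnx := norm_hatv hx0
    refine ⟨hatv x, (key _ hnx fun h => hx ⟨_, h, hxx⟩).1 (by rwa [hxx]), hxx⟩
  · rintro ⟨p, hp, rfl⟩
    have hp1 : ‖p‖ = 1 := by
      rcases hp with ⟨⟨h, -⟩, -⟩ | ⟨⟨h, -⟩, -⟩ <;> exact h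
    refine ⟨?_, (key p hp1 fun h => hx ⟨_, h, rfl⟩).2 hp⟩
    change ‖r • p‖ = r
    rw [norm_smul, hp1, mul_one, Real.norm_of_nonneg hr.le]

theorem ucap_measurable {n : ℕ} (e : Euc n) (y : ℝ) : MeasurableSet (ucap e y) := by
  have h1 : IsOpen {q : Euc n | y < ⟪q, e⟫} := isOpen_lt (by fun_prop) (by fun_prop)
  have h2 : IsClosed {q : Euc n | ‖q‖ = 1} := isClosed_eq (by fun_prop) (by fun_prop)
  exact h2.measurableSet.inter h1.measurableSet

theorem nested_measure {X : Type*} [MeasurableSpace X] {μ : Measure X} {A B B' : Set X}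
    (hA : MeasurableSet A) (hB : MeasurableSet B) (hB' : MeasurableSet B') (hfin : μ A ≠ ⊤)
    (h : μ B = μ B') (h1 : μ (B \ A) = 0) (h2 : μ (B' \ A) = 0) :
    μ ((A \ B) ∪ (B \ A)) = μ ((A \ B') ∪ (B' \ A)) := by
  have key {B : Set X} (hB : MeasurableSet B) (h1 : μ (B \ A) = 0) :
      μ ((A \ B) ∪ (B \ A)) = μ A - μ B := by
    have e1 : μ ((A \ B) ∪ (B \ A)) = μ (A \ B) := by
      refine le_antisymm ((measure_union_le _ _).trans (by rw [h1, add_zero])) (measure_mono subset_union_left)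
    have e2 := measure_inter_add_diff (μ := μ) A hB
    have e3 := measure_inter_add_diff (μ := μ) B hA
    rw [h1, add_zero, inter_comm] at e3
    rw [e1, ← e2, e3]
    have hBf : μ B ≠ ⊤ := by
      rw [← e3]; exact ne_top_of_le_ne_top hfin (measure_mono inter_subset_left)
    rw [ENNReal.add_sub_cancel_left hBf]
  rw [key hB h1, key hB' h2, h]

theorem nested_measure' {X : Type*} [MeasurableSpace X] {μ : Measure X} {A B B' : Set X}
    (hA : MeasurableSet A) (hB : MeasurableSet B) (hB' : MeasurableSet B') (hfin : μ B ≠ ⊤)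
    (h : μ B = μ B') (h1 : μ (A \ B) = 0) (h2 : μ (A \ B') = 0) :
    μ ((A \ B) ∪ (B \ A)) = μ ((A \ B') ∪ (B' \ A)) := by
  have key {B : Set X} (hB : MeasurableSet B) (hfin : μ B ≠ ⊤) (h1 : μ (A \ B) = 0) :
      μ ((A \ B) ∪ (B \ A)) = μ B - μ A := by
    have e1 : μ ((A \ B) ∪ (B \ A)) = μ (B \ A) := by
      refine le_antisymm ((measure_union_le _ _).trans (by rw [h1, zero_add])) (measure_mono subset_union_right)
    have e2 := measure_inter_add_diff (μ := μ) B hA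
    have e3 := measure_inter_add_diff (μ := μ) A hB
    rw [h1, add_zero, inter_comm] at e3
    rw [e1, ← e2, e3]
    have hBf : μ A ≠ ⊤ := by
      rw [← e3]; exact ne_top_of_le_ne_top hfin (measure_mono inter_subset_left)
    rw [ENNReal.add_sub_cancel_left hBf]
  rw [key hB hfin h1, key hB' (h ▸ hfin) h2, h]

theorem ucap_diff_null {n : ℕ} (hn : 2 ≤ n) (hfin : μH[(n:ℝ) - 1] (sphere (0 : Euc n) 1) < ⊤)
    {e e' : Euc n} (he : ‖e‖ = 1) (he' : ‖e'‖ = 1) {y z : ℝ}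
    (h : y = -1 ∨ 1 ≤ z ∨ ‖e' - e‖ ≤ z - y) : μH[(n:ℝ) - 1] (ucap e' z \ ucap e y) = 0 := by
  rcases h with h | h | h
  · refine measure_mono_null ?_ (level_null hn hfin he (-1))
    rintro q ⟨⟨hq, -⟩, hq2⟩
    refine ⟨hq, le_antisymm ?_ (abs_le.1 (abs_inner_le_one hq he)).1⟩
    by_contra! hcon
    exact hq2 ⟨hq, by rw [h]; exact hcon⟩
  · convert measure_empty (μ := (μH[(n:ℝ) - 1] : Measure (Euc n)))
    ext q
    simp only [mem_empty_iff_false, iff_false]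
    rintro ⟨⟨hq, hq1⟩, -⟩
    linarith [(abs_le.1 (abs_inner_le_one hq he')).2]
  · convert measure_empty (μ := (μH[(n:ℝ) - 1] : Measure (Euc n)))
    ext q
    simp only [mem_empty_iff_false, iff_false]
    rintro ⟨⟨hq, hq1⟩, hq2⟩
    refine hq2 ⟨hq, ?_⟩
    have h1 : ⟪q, e' - e⟫ ≤ ‖e' - e‖ := by
      have := real_inner_le_norm q (e' - e)
      rwa [hq, one_mul] at this
    rw [inner_sub_right] at h1
    linarith

theorem jump_eq {n : ℕ} (hn : 2 ≤ n) (hfin : μH[(n:ℝ) - 1] (sphere (0 : Euc n) 1) < ⊤)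
    {d : ℝ → Euc n} (hd : Measurable d) (hdn : ∀ s, ‖d s‖ = 1)
    {β : ℝ → ℝ} (hβ : Measurable β)
    {r : ℝ} (hr : 0 < r) {e e' : Euc n} (he : ‖e‖ = 1) (he' : ‖e'‖ = 1)
    (hdL : ∀ s ∈ Iio r, d s = e) (hdR : ∀ s ∈ Ioi r, d s = e') {y z : ℝ}
    (hy : LLim β r y) (hz : RLim β r z) (hy1 : y ∈ Icc (-1:ℝ) 1) (hz1 : z ∈ Icc (-1:ℝ) 1)
    (hnest : y = 1 ∨ y = -1 ∨ z = 1 ∨ z = -1 ∨ ‖e' - e‖ ≤ |y - z|) :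
    radPerim (capE d β) {r} = radPerim (capE (fun _ => e) β) {r} := by
  rw [jump_measure hn hfin hd hdn hβ hr he he' hdL hdR hy hz,
    jump_measure hn hfin measurable_const (fun _ => he) hβ hr he he (fun _ _ => rfl) (fun _ _ => rfl) hy hz]
  congr 1
  have hf (e : Euc n) (y : ℝ) : μH[(n:ℝ) - 1] (ucap e y) ≠ ⊤ := by
    refine ne_top_of_le_ne_top hfin.ne (measure_mono ?_)
    rintro q ⟨hq, -⟩; simpa using hq
  rcases le_total y z with h | h
  · have hc : y = -1 ∨ 1 ≤ z ∨ ‖e' - e‖ ≤ z - y := by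
      rcases hnest with h' | h' | h' | h' | h'
      · right; left; linarith
      · left; exact h'
      · right; left; linarith
      · left; linarith [hy1.1]
      · right; right; rwa [abs_sub_comm, abs_of_nonneg (by linarith)] at h'
    refine nested_measure (ucap_measurable _ _) (ucap_measurable _ _) (ucap_measurable _ _) (hf _ _)
      (hmeas_ucap he' he _ _) (ucap_diff_null hn hfin he he' hc) (ucap_diff_null hn hfin he he ?_)
    right; right; simpa using h
  · have hc : z = -1 ∨ 1 ≤ y ∨ ‖e - e'‖ ≤ y - z := by
      rcases hnest with h' | h' | h' | h' | h'
      · right; left; linarith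
      · left; linarith [hz1.1]
      · right; left; linarith
      · left; exact h'
      · right; right; rwa [norm_sub_rev, abs_of_nonneg (by linarith)] at h'
    refine nested_measure' (ucap_measurable _ _) (ucap_measurable _ _) (ucap_measurable _ _) (hf _ _)
      (hmeas_ucap he' he _ _) (ucap_diff_null hn hfin he' he hc) (ucap_diff_null hn hfin he he ?_)
    right; right; simpa using h


/-- Rotation of `e` towards `w` by the angle `t`. -/
noncomputable def rot {n : ℕ} (e w : Euc n) (t : ℝ) : Euc n := Real.cos t • e + Real.sin t • w

theorem rot_zero {n : ℕ} (e w : Euc n) : rot e w 0 = e := by simp [rot]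

theorem rot_inner {n : ℕ} {e w : Euc n} (he : ‖e‖ = 1) (hw : ‖w‖ = 1) (hew : ⟪e, w⟫ = 0) (s t : ℝ) :
    ⟪rot e w s, rot e w t⟫ = Real.cos (s - t) := by
  have h00 : ⟪e, e⟫ = 1 := by rw [real_inner_self_eq_norm_sq, he]; norm_num
  have h11 : ⟪w, w⟫ = 1 := by rw [real_inner_self_eq_norm_sq, hw]; norm_num
  have h10 : ⟪w, e⟫ = 0 := by rw [real_inner_comm]; exact hew
  simp only [rot, inner_add_left, inner_add_right, real_inner_smul_left, real_inner_smul_right, h00, h11, h10, hew,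
    Real.cos_sub]
  ring

theorem rot_norm {n : ℕ} {e w : Euc n} (he : ‖e‖ = 1) (hw : ‖w‖ = 1) (hew : ⟪e, w⟫ = 0) (t : ℝ) :
    ‖rot e w t‖ = 1 := by
  have : ‖rot e w t‖ ^ 2 = 1 := by
    rw [← real_inner_self_eq_norm_sq, rot_inner he hw hew]; simp
  nlinarith [norm_nonneg (rot e w t)]

theorem rot_dist {n : ℕ} {e w : Euc n} (he : ‖e‖ = 1) (hw : ‖w‖ = 1) (hew : ⟪e, w⟫ = 0) (s t : ℝ) :
    ‖rot e w s - rot e w t‖ ≤ |s - t| := by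
  refine (sq_le_sq₀ (norm_nonneg _) (abs_nonneg _)).1 ?_
  rw [sq_abs]
  rw [norm_sub_sq_real, rot_norm he hw hew, rot_norm he hw hew, rot_inner he hw hew]
  linarith [Real.one_sub_sq_div_two_le_cos (x := s - t)]

theorem rot_ne {n : ℕ} {e w : Euc n} (hw : ‖w‖ = 1) (hew : ⟪e, w⟫ = 0) {t : ℝ} (ht : 0 < t)
    (ht1 : t < Real.pi) : e ≠ rot e w t := by
  intro h
  have h1 : ⟪rot e w t, w⟫ = Real.sin t := by
    rw [rot, inner_add_left, real_inner_smul_left, real_inner_smul_left, hew,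
      real_inner_self_eq_norm_sq, hw]; ring
  rw [← h, hew] at h1
  exact (Real.sin_pos_of_pos_of_lt_pi ht ht1).ne h1

/-- The standing assumptions. -/
structure Ctx (n : ℕ) (e w : Euc n) (β yL yR : ℝ → ℝ) : Prop where
  hn : 2 ≤ n
  he : ‖e‖ = 1
  hw : ‖w‖ = 1
  hew : ⟪e, w⟫ = 0
  hβ : Measurable β
  hβ1 : ∀ r, β r ∈ Icc (-1:ℝ) 1
  hfin : μH[(n:ℝ) - 1] (sphere (0 : Euc n) 1) < ⊤
  hF : radPerim (capE (fun _ => e) β) univ < ⊤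
  rig : Rig n e β
  hL : ∀ r, 0 < r → LLim β r (yL r)
  hR : ∀ r, 0 < r → RLim β r (yR r)
  hL1 : ∀ r, 0 < r → yL r ∈ Icc (-1:ℝ) 1
  hR1 : ∀ r, 0 < r → yR r ∈ Icc (-1:ℝ) 1

/-- The set `I`. -/
def Iset (yL yR : ℝ → ℝ) : Set ℝ := {r | 0 < r ∧ yL r ∈ Ioo (-1:ℝ) 1 ∧ yR r ∈ Ioo (-1:ℝ) 1}

theorem Ctx.no_jump {n : ℕ} {e w : Euc n} {β yL yR : ℝ → ℝ} (c : Ctx n e w β yL yR) {r : ℝ} (hr : 0 < r)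
    {t : ℝ} (ht : 0 < t) (ht1 : t < Real.pi)
    (hnest : yL r = 1 ∨ yL r = -1 ∨ yR r = 1 ∨ yR r = -1 ∨ t ≤ |yL r - yR r|)
    (h1 : volume ({s | β s ∈ Ioo (-1:ℝ) 1} ∩ Ioo 0 r) ≠ 0)
    (h2 : volume ({s | β s ∈ Ioo (-1:ℝ) 1} ∩ Ioi r) ≠ 0) : False := by
  have he' := rot_norm c.he c.hw c.hew t
  set d : ℝ → Euc n := fun s => if s ≤ r then e else rot e w t with hd
  have hdm : Measurable d := Measurable.ite measurableSet_Iic measurable_const measurable_const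
  have hdn : ∀ s, ‖d s‖ = 1 := by
    intro s; simp only [hd]; split_ifs
    · exact c.he
    · exact he'
  have hdL : ∀ s ∈ Iic r, d s = e := fun s hs => if_pos hs
  have hdR : ∀ s ∈ Ioi r, d s = rot e w t := fun s hs => if_neg (not_le.2 hs)
  have hj := jump_eq c.hn c.hfin hdm hdn c.hβ hr c.he he' (fun s hs => hdL s (le_of_lt (mem_Iio.1 hs))) hdR (c.hL r hr) (c.hR r hr)
    (c.hL1 r hr) (c.hR1 r hr) (by
      rcases hnest with h | h | h | h | h
      · exact Or.inl h
      · exact Or.inr (Or.inl h)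
      · exact Or.inr (Or.inr (Or.inl h))
      · exact Or.inr (Or.inr (Or.inr (Or.inl h)))
      · refine Or.inr (Or.inr (Or.inr (Or.inr (le_trans ?_ h))))
        have := rot_dist c.he c.hw c.hew t 0
        rwa [rot_zero, sub_zero, abs_of_pos ht] at this)
  refine rigid_contra c.hn c.he c.hβ c.rig (measurableSet_singleton r) hdm hdn ?_ hj
    (measurableSet_Iio (a := r)) (measurableSet_Ioi (a := r)) (rot_ne c.hw c.hew ht ht1)
    (fun s hs => hdL s (le_of_lt (mem_Iio.1 hs))) hdR ?_ ?_
  · intro s hs0 hs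
    rcases lt_or_gt_of_ne (show s ≠ r from hs) with h | h
    · refine ⟨r - s, by linarith, fun x hx => ?_⟩
      rw [hdL s h.le, hdL x (show x ≤ r by linarith [hx.2])]
    · refine ⟨s - r, by linarith, fun x hx => ?_⟩
      rw [hdR s h, hdR x (show r < x by linarith [hx.1])]
  · intro h0
    refine h1 (measure_mono_null ?_ h0)
    rintro x ⟨hx1, hx2, hx3⟩
    exact ⟨⟨hx3, hx1⟩, hx2⟩
  · intro h0
    refine h2 (measure_mono_null ?_ h0)
    rintro x ⟨hx1, hx2⟩
    exact ⟨⟨hx2, hx1⟩, hr.trans hx2⟩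

theorem Ctx.pos_right {n : ℕ} {e w : Euc n} {β yL yR : ℝ → ℝ} (c : Ctx n e w β yL yR) {r : ℝ}
    (hr : r ∈ Iset yL yR) {r' : ℝ} (h : r < r') :
    volume ({s | β s ∈ Ioo (-1:ℝ) 1} ∩ Ioo r r') ≠ 0 := by
  have := freq_right ((c.hR r hr.1).eventually (Ioo_mem_nhds hr.2.2.1 hr.2.2.2)).frequently (sub_pos.2 h)
  rwa [add_sub_cancel] at this

theorem Ctx.pos_left {n : ℕ} {e w : Euc n} {β yL yR : ℝ → ℝ} (c : Ctx n e w β yL yR) {r : ℝ}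
    (hr : r ∈ Iset yL yR) {r' : ℝ} (h : r' < r) :
    volume ({s | β s ∈ Ioo (-1:ℝ) 1} ∩ Ioo r' r) ≠ 0 := by
  have := freq_left ((c.hL r hr.1).eventually (Ioo_mem_nhds hr.2.1.1 hr.2.1.2)).frequently (sub_pos.2 h)
  rwa [sub_sub_cancel] at this

theorem Ctx.ordConnected {n : ℕ} {e w : Euc n} {β yL yR : ℝ → ℝ} (c : Ctx n e w β yL yR) :
    OrdConnected (Iset yL yR) := by
  refine ⟨fun a ha b hb r hr => ?_⟩
  have hr0 : 0 < r := lt_of_lt_of_le ha.1 hr.1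
  rcases eq_or_lt_of_le hr.1 with h | har
  · rwa [← h]
  rcases eq_or_lt_of_le hr.2 with h | hrb
  · rwa [h]
  by_contra hnot
  refine c.no_jump hr0 (t := 1) one_pos (by linarith [Real.pi_gt_three]) ?_ ?_ ?_
  · have h1 := c.hL1 r hr0
    have h2 := c.hR1 r hr0
    by_contra! hcon
    obtain ⟨a1, a2, a3, a4, -⟩ := hcon
    exact hnot ⟨hr0, ⟨lt_of_le_of_ne h1.1 a2.symm, lt_of_le_of_ne h1.2 a1⟩,
      ⟨lt_of_le_of_ne h2.1 a4.symm, lt_of_le_of_ne h2.2 a3⟩⟩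
  · intro h0
    refine c.pos_right ha har (measure_mono_null ?_ h0)
    exact inter_subset_inter_right _ (Ioo_subset_Ioo_left ha.1.le)
  · intro h0
    refine c.pos_left hb hrb (measure_mono_null ?_ h0)
    exact inter_subset_inter_right _ (fun x hx => hx.1)

theorem Ctx.eq_lim {n : ℕ} {e w : Euc n} {β yL yR : ℝ → ℝ} (c : Ctx n e w β yL yR) {r : ℝ}
    (hr : r ∈ Iset yL yR) : yL r = yR r := by
  by_contra hne
  have hp : 0 < |yL r - yR r| := abs_pos.2 (sub_ne_zero.2 hne)
  refine c.no_jump hr.1 (t := min 1 |yL r - yR r|) (lt_min one_pos hp)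
    (by linarith [Real.pi_gt_three, min_le_left 1 |yL r - yR r|]) ?_ (c.pos_left hr hr.1) ?_
  · exact Or.inr (Or.inr (Or.inr (Or.inr (min_le_right _ _))))
  · intro h0
    refine c.pos_right hr (lt_add_one r) (measure_mono_null ?_ h0)
    exact inter_subset_inter_right _ (fun x hx => hx.1)

theorem Ctx.near {n : ℕ} {e w : Euc n} {β yL yR : ℝ → ℝ} (c : Ctx n e w β yL yR) {r : ℝ}
    (hr : r ∈ Iset yL yR) {η : ℝ} (hη : 0 < η) :
    ∃ ε > 0, ∀ᵐ s ∂(volume : Measure ℝ), s ∈ Ioo (r - ε) (r + ε) → β s ∈ Icc (yL r - η) (yL r + η) := by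
  refine ev_nhds_of_sides ?_ ?_
  · exact (c.hR r hr.1).eventually (by
      rw [← c.eq_lim hr]; exact Icc_mem_nhds (by linarith) (by linarith))
  · exact (c.hL r hr.1).eventually (Icc_mem_nhds (by linarith) (by linarith))

theorem Ctx.cont {n : ℕ} {e w : Euc n} {β yL yR : ℝ → ℝ} (c : Ctx n e w β yL yR) {r : ℝ}
    (hr : r ∈ Iset yL yR) : ContinuousAt yL r := by
  rw [Metric.continuousAt_iff]
  intro η hη
  obtain ⟨ε, hε, h⟩ := c.near hr (half_pos hη)
  refine ⟨min ε r, lt_min hε hr.1, fun {s} hs => ?_⟩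
  rw [Real.dist_eq] at hs ⊢
  have hs1 := abs_lt.1 (hs.trans_le (min_le_left _ _))
  have hs2 := abs_lt.1 (hs.trans_le (min_le_right _ _))
  have hs0 : 0 < s := by linarith
  have : yL s ∈ Icc (yL r - η / 2) (yL r + η / 2) := by
    refine isClosed_Icc.mem_of_tendsto (c.hL s hs0) (ev_left_iff.2 ⟨s - (r - ε), by linarith, ?_⟩)
    filter_upwards [h] with x hx hx2
    exact hx ⟨by linarith [hx2.1], by linarith [hx2.2]⟩
  rw [abs_lt]
  constructor <;> linarith [this.1, this.2]

theorem Ctx.ae_eq {n : ℕ} {e w : Euc n} {β yL yR : ℝ → ℝ} (c : Ctx n e w β yL yR) :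
    volume {r ∈ Iset yL yR | β r ≠ yL r} = 0 := by
  have hcov : {r ∈ Iset yL yR | β r ≠ yL r} ⊆
      ⋃ k : ℕ, {r ∈ Iset yL yR | 1 / ((k:ℝ) + 1) < |β r - yL r|} := by
    rintro r ⟨hr, hne⟩
    obtain ⟨k, hk⟩ := exists_nat_one_div_lt (abs_pos.2 (sub_ne_zero.2 hne))
    exact mem_iUnion.2 ⟨k, hr, hk⟩
  refine measure_mono_null hcov (measure_iUnion_null fun k => ?_)
  refine measure_null_of_locally_null _ fun r hr => ?_
  have hη : (0:ℝ) < 1 / ((k:ℝ) + 1) := by positivity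
  obtain ⟨ε, hε, h⟩ := c.near hr.1 (half_pos hη)
  have hc := Metric.continuousAt_iff.1 (c.cont hr.1) _ (half_pos hη)
  obtain ⟨δ, hδ, hc⟩ := hc
  refine ⟨_, inter_mem_nhdsWithin _ (inter_mem (Ioo_mem_nhds (a := r - ε) (b := r + ε) (by linarith) (by linarith))
    (Metric.ball_mem_nhds r hδ)), ?_⟩
  rw [ae_iff] at h
  refine measure_mono_null ?_ h
  rintro s ⟨⟨-, hs⟩, hs1, hs2⟩ hcon
  have h1 := hcon hs1
  have h2 := hc hs2
  rw [Real.dist_eq, abs_lt] at h2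
  refine absurd hs (not_lt.2 (abs_le.2 ⟨?_, ?_⟩)) <;> linarith [h1.1, h1.2]

theorem Ctx.no_atom {n : ℕ} {e w : Euc n} {β yL yR : ℝ → ℝ} (c : Ctx n e w β yL yR) {r : ℝ}
    (hr : r ∈ Iset yL yR) : radPerim (capE (fun _ => e) β) {r} = 0 := by
  rw [jump_measure c.hn c.hfin measurable_const (fun _ => c.he) c.hβ hr.1 c.he c.he (fun _ _ => rfl)
    (fun _ _ => rfl) (c.hL r hr.1) (c.hR r hr.1), ← c.eq_lim hr]
  simp

theorem Ctx.osc {n : ℕ} {e w : Euc n} {β yL yR : ℝ → ℝ} (c : Ctx n e w β yL yR) {a b : ℝ}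
    (hab : Icc a b ⊆ Iset yL yR) (hle : a ≤ b) : ∃ C > 0, ∀ r ∈ Icc a b, ∀ r' ∈ Icc a b, r < r' →
      |yL r' - yL r| ≤ C * (radPerim (capE (fun _ => e) β)).real (Ioo r r') := by
  have hco : ContinuousOn yL (Icc a b) := fun r hr => (c.cont (hab hr)).continuousWithinAt
  have ha0 : 0 < a := (hab (left_mem_Icc.2 hle)).1
  obtain ⟨δ, hδ, hδ1, hδy⟩ : ∃ δ > 0, δ ≤ 1 ∧ ∀ r ∈ Icc a b, -1 + δ ≤ yL r ∧ yL r ≤ 1 - δ := by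
    obtain ⟨r1, hr1, hm1⟩ := isCompact_Icc.exists_isMinOn (nonempty_Icc.2 hle) hco
    obtain ⟨r2, hr2, hm2⟩ := isCompact_Icc.exists_isMaxOn (nonempty_Icc.2 hle) hco
    have p1 := (hab hr1).2.1
    have p2 := (hab hr2).2.1
    refine ⟨min (1 + yL r1) (1 - yL r2) , lt_min (by linarith [p1.1]) (by linarith [p2.2]), ?_, fun r hr => ⟨?_, ?_⟩⟩
    · have : yL r1 ≤ yL r2 := hm1 hr2
      rcases le_total (yL r1) 0 with h | h
      · exact (min_le_left _ _).trans (by linarith)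
      · exact (min_le_right _ _).trans (by linarith)
    · have : yL r1 ≤ yL r := hm1 hr
      linarith [min_le_left (1 + yL r1) (1 - yL r2)]
    · have : yL r ≤ yL r2 := hm2 hr
      linarith [min_le_right (1 + yL r1) (1 - yL r2)]
  obtain ⟨C, hC, hosc⟩ := osc_lemma c.hn c.hβ ha0 hδ hδ1
  have hee := radPerim_dir (norm_e1 (by have := c.hn; omega)) c.he β
  rw [hee] at hosc
  have hFfin : IsFiniteMeasure (radPerim (capE (fun _ => e) β)) := ⟨c.hF⟩
  refine ⟨C, hC, fun r hr r' hr' hrr => ?_⟩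
  have hreal : ENNReal.ofReal C * radPerim (capE (fun _ => e) β) (Ioo r r') =
      ENNReal.ofReal (C * (radPerim (capE (fun _ => e) β)).real (Ioo r r')) := by
    rw [ENNReal.ofReal_mul hC.le, Measure.real, ENNReal.ofReal_toReal (measure_ne_top _ _)]
  have hfR (P : Set ℝ) (hP : P ∈ 𝓝 (yL r)) : volume ({s | β s ∈ P} ∩ Ioo r r') ≠ 0 := by
    rw [c.eq_lim (hab hr)] at hP
    have := freq_right ((c.hR r (hab hr).1).eventually hP).frequently (sub_pos.2 hrr)
    rwa [add_sub_cancel] at this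
  have hfL (P : Set ℝ) (hP : P ∈ 𝓝 (yL r')) : volume ({s | β s ∈ P} ∩ Ioo r r') ≠ 0 := by
    have := freq_left ((c.hL r' (hab hr').1).eventually hP).frequently (sub_pos.2 hrr)
    rwa [sub_sub_cancel] at this
  refine le_of_forall_pos_le_add fun η hη => ?_
  have hpos : 0 ≤ C * (radPerim (capE (fun _ => e) β)).real (Ioo r r') := by positivity
  rcases le_total (yL r) (yL r') with h | h
  · rw [abs_of_nonneg (by linarith)]
    have h1 := hosc r r' (yL r + η / 2) (yL r' - η / 2) hr.1 hrr (by linarith [(hδy r hr).1])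
      (by linarith [(hδy r' hr').2]) (hfR (Iio _) (gt_mem_nhds (by linarith))) (hfL (Ioi _) (lt_mem_nhds (by linarith)))
    rw [hreal, ENNReal.ofReal_le_ofReal_iff hpos] at h1
    linarith
  · rw [abs_sub_comm, abs_of_nonneg (by linarith)]
    have h1 := hosc r r' (yL r' + η / 2) (yL r - η / 2) hr.1 hrr (by linarith [(hδy r' hr').1])
      (by linarith [(hδy r hr).2]) (hfL (Iio _) (gt_mem_nhds (by linarith))) (hfR (Ioi _) (lt_mem_nhds (by linarith)))
    rw [hreal, ENNReal.ofReal_le_ofReal_iff hpos] at h1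
    linarith


/-- A bi-monotone change of parameter: `m` expands, `ρ` is its inverse. -/
structure Param (m ρ : ℝ → ℝ) : Prop where
  mono : ∀ r r', r ≤ r' → r' - r ≤ m r' - m r
  cont : Continuous m
  left : ∀ r, ρ (m r) = r
  right : ∀ s, m (ρ s) = s

theorem Param.strictMono {m ρ : ℝ → ℝ} (p : Param m ρ) : StrictMono m := fun a b h => by
  linarith [p.mono a b h.le]

theorem Param.strictMono' {m ρ : ℝ → ℝ} (p : Param m ρ) : StrictMono ρ := fun a b h => by
  by_contra! hcon
  have := p.strictMono.monotone hcon
  rw [p.right, p.right] at this; linarith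

theorem Param.lip {m ρ : ℝ → ℝ} (p : Param m ρ) : LipschitzWith 1 ρ := by
  refine LipschitzWith.of_dist_le_mul fun a b => ?_
  rw [Real.dist_eq, Real.dist_eq, NNReal.coe_one, one_mul]
  wlog h : a ≤ b generalizing a b
  · rw [abs_sub_comm, abs_sub_comm a b]; exact this b a (le_of_not_ge h)
  have h1 := p.strictMono'.monotone h
  have h2 := p.mono _ _ h1
  rw [p.right, p.right] at h2
  rw [abs_sub_comm, abs_of_nonneg (by linarith), abs_sub_comm, abs_of_nonneg (by linarith)]
  exact h2

theorem exists_param {m : ℝ → ℝ} (h : ∀ r r', r ≤ r' → r' - r ≤ m r' - m r) (hc : Continuous m) :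
    ∃ ρ, Param m ρ := by
  have hs : StrictMono m := fun a b hab => by linarith [h a b hab.le]
  have hsurj : Function.Surjective m := by
    refine hc.surjective ?_ ?_
    · refine tendsto_atTop_mono' atTop (f₁ := fun r => r + m 0) ?_ (tendsto_atTop_add_const_right _ _ tendsto_id)
      filter_upwards [eventually_ge_atTop 0] with r hr
      linarith [h 0 r hr]
    · refine tendsto_atBot_mono' atBot (f₁ := fun r => r + m 0) ?_ (tendsto_atBot_add_const_right _ _ tendsto_id)
      filter_upwards [eventually_le_atBot 0] with r hr
      linarith [h r 0 hr]
  refine ⟨Function.surjInv hsurj, h, hc, fun r => ?_, Function.surjInv_eq hsurj⟩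
  exact hs.injective (Function.surjInv_eq hsurj (m r))

theorem lip_image_null {K : ℝ≥0} {f : ℝ → ℝ} (hf : LipschitzWith K f) {s : Set ℝ} (hs : volume s = 0) :
    volume (f '' s) = 0 := by
  rw [← hausdorffMeasure_real] at hs ⊢
  refine le_antisymm ((hf.hausdorffMeasure_image_le zero_le_one s).trans ?_) (zero_le)
  rw [hs, mul_zero]

theorem deriv_zero_image_null {f : ℝ → ℝ} {s : Set ℝ} (h : ∀ x ∈ s, HasDerivAt f 0 x) :
    volume (f '' s) = 0 := by
  refine addHaar_image_eq_zero_of_det_fderivWithin_eq_zero volume (f' := fun _ => 0)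
    (fun x hx => ?_) (fun x _ => ?_)
  · have := (h x hx).hasFDerivAt.hasFDerivWithinAt (s := s)
    have h0 : ContinuousLinearMap.toSpanSingleton ℝ (0:ℝ) = 0 := by ext; simp
    rw [h0] at this
    exact this
  · simp

/-- Absolute continuity from the absence of a Cantor part. -/
theorem ac_of_param {m ρ ω : ℝ → ℝ} (p : Param m ρ) {L : ℝ≥0} (hω : LipschitzWith L ω)
    (hZ : ∀ᵐ s, deriv ρ s = 0 → deriv ω s = 0) {r1 r2 : ℝ} (h12 : r1 ≤ r2) :
    IntegrableOn (deriv (ω ∘ m)) (Icc r1 r2) ∧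
      ω (m r2) - ω (m r1) = ∫ r in r1..r2, deriv (ω ∘ m) r := by
  set T : Set ℝ := {s | DifferentiableAt ℝ ρ s ∧ DifferentiableAt ℝ ω s ∧ deriv ρ s ≠ 0} ∩ Icc (m r1) (m r2)
    with hT
  have hTm : MeasurableSet T := by
    refine MeasurableSet.inter ?_ measurableSet_Icc
    exact (measurableSet_of_differentiableAt ℝ ρ).inter
      ((measurableSet_of_differentiableAt ℝ ω).inter
        ((measurable_deriv ρ) (measurableSet_singleton 0).compl))
  have hm12 := p.strictMono.monotone h12
  have himg : ρ '' Icc (m r1) (m r2) = Icc r1 r2 := by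
    ext r
    constructor
    · rintro ⟨s, hs, rfl⟩
      have h1 := p.strictMono'.monotone hs.1
      have h2 := p.strictMono'.monotone hs.2
      rw [p.left] at h1 h2
      exact ⟨h1, h2⟩
    · intro hr
      exact ⟨m r, ⟨p.strictMono.monotone hr.1, p.strictMono.monotone hr.2⟩, p.left r⟩
  have hnull : volume (Icc r1 r2 \ ρ '' T) = 0 := by
    have hsub : Icc r1 r2 \ ρ '' T ⊆ ρ '' {s | ¬ (DifferentiableAt ℝ ρ s ∧ DifferentiableAt ℝ ω s)} ∪
        ρ '' {s | HasDerivAt ρ 0 s} := by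
      rw [← himg]
      rintro _ ⟨⟨s, hs, rfl⟩, hnot⟩
      by_cases hd : DifferentiableAt ℝ ρ s ∧ DifferentiableAt ℝ ω s
      · right
        refine ⟨s, ?_, rfl⟩
        by_contra hcon
        refine hnot ⟨s, ⟨⟨hd.1, hd.2, fun h0 => hcon ?_⟩, hs⟩, rfl⟩
        have := hd.1.hasDerivAt
        rwa [h0] at this
      · exact Or.inl ⟨s, hd, rfl⟩
    refine measure_mono_null hsub (measure_union_null (lip_image_null p.lip ?_) (deriv_zero_image_null fun x hx => hx))
    have := p.lip.ae_differentiableAt_real.and hω.ae_differentiableAt_real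
    exact this
  have hTsub : ρ '' T ⊆ Icc r1 r2 := by
    rw [← himg]; exact image_mono inter_subset_right
  have hae : (ρ '' T : Set ℝ) =ᵐ[volume] Icc r1 r2 := by
    refine (ae_eq_set).2 ⟨?_, hnull⟩
    rw [diff_eq_empty.2 hTsub]; simp
  have hder : ∀ s ∈ T, HasDerivWithinAt ρ (deriv ρ s) T s := fun s hs => hs.1.1.hasDerivAt.hasDerivWithinAt
  have hcomp : ∀ s ∈ T, |deriv ρ s| • deriv (ω ∘ m) (ρ s) = deriv ω s := by
    intro s hs
    have hpos : 0 ≤ deriv ρ s := p.strictMono'.monotone.deriv_nonneg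
    have h1 : HasDerivAt ρ (deriv ρ s) (m (ρ s)) := by rw [p.right]; exact hs.1.1.hasDerivAt
    have h2 := HasDerivAt.of_local_left_inverse (p.cont.continuousAt (x := ρ s)) h1 hs.1.2.2 (Eventually.of_forall p.left)
    have h3 : HasDerivAt ω (deriv ω s) (m (ρ s)) := by rw [p.right]; exact hs.1.2.1.hasDerivAt
    rw [(h3.comp _ h2).deriv, abs_of_nonneg hpos, smul_eq_mul]
    have := hs.1.2.2
    field_simp
  have hac : AbsolutelyContinuousOnInterval ω (m r1) (m r2) :=
    hω.lipschitzOnWith.absolutelyContinuousOnInterval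
  have hIntg : IntegrableOn (deriv ω) (Icc (m r1) (m r2)) := by
    have := hac.intervalIntegrable_deriv
    rwa [intervalIntegrable_iff_integrableOn_Icc_of_le hm12] at this
  constructor
  · rw [← integrableOn_congr_set_ae hae, integrableOn_image_iff_integrableOn_abs_deriv_smul hTm hder p.strictMono'.injective.injOn]
    exact (integrableOn_congr_fun hcomp hTm).2 (hIntg.mono_set inter_subset_right)
  · rw [intervalIntegral.integral_of_le h12, ← integral_Icc_eq_integral_Ioc, ← setIntegral_congr_set hae,
      integral_image_eq_integral_abs_deriv_smul hTm hder p.strictMono'.injective.injOn,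
      setIntegral_congr_fun hTm hcomp, ← hac.integral_deriv_eq_sub, intervalIntegral.integral_of_le hm12,
      ← integral_Icc_eq_integral_Ioc]
    refine (setIntegral_eq_of_subset_of_ae_diff_eq_zero measurableSet_Icc.nullMeasurableSet inter_subset_right ?_)
    filter_upwards [hZ, p.lip.ae_differentiableAt_real, hω.ae_differentiableAt_real] with s h1 h2 h3 h4
    refine h1 ?_
    by_contra hcon
    exact h4.2 ⟨⟨h2, h3, hcon⟩, h4.1⟩


theorem Ctx.exists_param {n : ℕ} {e w : Euc n} {β yL yR : ℝ → ℝ} (c : Ctx n e w β yL yR) {a b : ℝ}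
    (hab : Icc a b ⊆ Iset yL yR) (hle : a ≤ b) : ∃ m ρ : ℝ → ℝ, Param m ρ ∧
      ∀ r r', r ≤ r' → |yL (max a (min b r')) - yL (max a (min b r))| ≤ m r' - m r := by
  obtain ⟨C, hC, hosc⟩ := c.osc hab hle
  set μ := radPerim (capE (fun _ => e) β) with hμ
  haveI : IsFiniteMeasure μ := ⟨c.hF⟩
  set μ' := μ.restrict (Icc a b) with hμ'
  haveI : NullSingletonClass μ' := by
    refine ⟨fun x => ?_⟩
    rw [hμ', Measure.restrict_apply (measurableSet_singleton x)]
    by_cases hx : x ∈ Icc a b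
    · exact measure_mono_null inter_subset_left (c.no_atom (hab hx))
    · have : {x} ∩ Icc a b = ∅ := by
        rw [singleton_inter_eq_empty]; exact hx
      rw [this]; simp
  have hIntg : ∀ x y : ℝ, IntervalIntegrable (fun _ => (1:ℝ)) μ' x y := fun x y =>
    (integrable_const (1:ℝ)).intervalIntegrable
  set m : ℝ → ℝ := fun r => r + C * ∫ x in a..r, (1:ℝ) ∂μ' with hm
  have hdiff : ∀ r r', r ≤ r' → m r' - m r = (r' - r) + C * μ'.real (Ioc r r') := by
    intro r r' h
    have h1 := intervalIntegral.integral_add_adjacent_intervals (hIntg a r) (hIntg r r')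
    have h2 : ∫ x in r..r', (1:ℝ) ∂μ' = μ'.real (Ioc r r') := by
      rw [intervalIntegral.integral_of_le h]
      simp
    simp only [hm]
    rw [← h1, h2]; ring
  have hcont : Continuous m :=
    continuous_id.add (continuous_const.mul (intervalIntegral.continuous_primitive hIntg a))
  have hmono : ∀ r r', r ≤ r' → r' - r ≤ m r' - m r := by
    intro r r' h
    rw [hdiff r r' h]
    have : 0 ≤ C * μ'.real (Ioc r r') := mul_nonneg hC.le measureReal_nonneg
    linarith
  obtain ⟨ρ, p⟩ := _root_.exists_param hmono hcont
  refine ⟨m, ρ, p, fun r r' h => ?_⟩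
  set u := max a (min b r) with hu
  set u' := max a (min b r') with hu'
  have huu : u ≤ u' := max_le_max le_rfl (min_le_min le_rfl h)
  have hum : u ∈ Icc a b := ⟨le_max_left _ _, max_le hle (min_le_left _ _)⟩
  have hum' : u' ∈ Icc a b := ⟨le_max_left _ _, max_le hle (min_le_left _ _)⟩
  rcases eq_or_lt_of_le huu with heq | hlt
  · rw [heq, sub_self, abs_zero]
    linarith [hmono r r' h]
  · refine (hosc u hum u' hum' hlt).trans ?_
    rw [hdiff r r' h]
    have hsub : Ioo u u' ⊆ Ioc r r' ∩ Icc a b := by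
      intro x hx
      refine ⟨⟨?_, ?_⟩, hum.1.trans hx.1.le, hx.2.le.trans hum'.2⟩
      · by_contra! hcon
        have h1 : x ≤ u := by
          rw [hu]
          exact le_max_of_le_right (le_min (hx.2.le.trans hum'.2) hcon)
        exact absurd hx.1 (not_lt.2 h1)
      · by_contra! hcon
        have h1 : u' ≤ x := by
          rw [hu']
          exact max_le (hum.1.trans hx.1.le) ((min_le_right _ _).trans hcon.le)
        exact absurd hx.2 (not_lt.2 h1)
    have : μ.real (Ioo u u') ≤ μ'.real (Ioc r r') := by
      rw [hμ', measureReal_restrict_apply measurableSet_Ioc]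
      exact measureReal_mono hsub
    have := mul_le_mul_of_nonneg_left this hC.le
    linarith


theorem hmeas_le_level {n : ℕ} {d d' : Euc n} (hd : ‖d‖ = 1) (hd' : ‖d'‖ = 1) (t y : ℝ) :
    μH[t] {q : Euc n | ‖q‖ = 1 ∧ ⟪q, d⟫ ≤ y} = μH[t] {q : Euc n | ‖q‖ = 1 ∧ ⟪q, d'⟫ ≤ y} := by
  obtain ⟨R, hR⟩ := exists_isometry hd hd'
  rw [← hmeas_isom R]
  congr 1
  ext q
  constructor
  · rintro ⟨x, ⟨h1, h2⟩, rfl⟩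
    refine ⟨by rw [R.norm_map]; exact h1, ?_⟩
    rw [← hR, R.inner_map_map]; exact h2
  · rintro ⟨h1, h2⟩
    refine ⟨R.symm q, ⟨by rw [R.symm.norm_map]; exact h1, ?_⟩, R.apply_symm_apply q⟩
    rw [← R.inner_map_map, R.apply_symm_apply, hR]; exact h2

theorem push_indep {n : ℕ} {k : ℝ} (hfin : μH[k] (sphere (0 : Euc n) 1) < ⊤) {e : Euc n} (he : ‖e‖ = 1)
    {D : ℝ → Euc n} (hD1 : ∀ t, ‖D t‖ = 1) (hDL : ∀ t t', ‖D t - D t'‖ ≤ (1/2) * |t - t'|)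
    {T : Set ℝ} (hT : MeasurableSet T) :
    μH[k] {q : Euc n | ‖q‖ = 1 ∧ ∃ t ∈ T, ⟪q, D t⟫ = t} = μH[k] {q : Euc n | ‖q‖ = 1 ∧ ⟪q, e⟫ ∈ T} := by
  have hDc : Continuous D := by
    have : LipschitzWith (1/2) D := LipschitzWith.of_dist_le_mul fun t t' => by
      rw [dist_eq_norm, Real.dist_eq]; simpa using hDL t t'
    exact this.continuous
  have hex : ∀ q : Euc n, ∃ t : ℝ, ‖q‖ = 1 → ⟪q, D t⟫ = t := by
    intro q
    by_cases hq : ‖q‖ = 1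
    · have hc : Continuous fun t : ℝ => t - ⟪q, D t⟫ := by fun_prop
      have h2 := abs_le.1 (abs_inner_le_one hq (hD1 2))
      have h3 := abs_le.1 (abs_inner_le_one hq (hD1 (-2)))
      obtain ⟨t, ht⟩ := mem_range_of_exists_le_of_exists_ge hc (c := 0) ⟨-2, by linarith [h3.1]⟩ ⟨2, by linarith [h2.2]⟩
      refine ⟨t, fun _ => ?_⟩
      have : t - ⟪q, D t⟫ = 0 := ht
      linarith
    · exact ⟨0, fun h => absurd h hq⟩
  choose Y0 hY0 using hex
  have hkey : ∀ (q q' : Euc n) (t t' : ℝ), ‖q‖ = 1 → ‖q'‖ = 1 → ⟪q, D t⟫ = t → ⟪q', D t'⟫ = t' →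
      |t - t'| ≤ 2 * ‖q - q'‖ := by
    intro q q' t t' hq hq' h h'
    have e1 : t - t' = ⟪q - q', D t⟫ + ⟪q', D t - D t'⟫ := by
      rw [inner_sub_left, inner_sub_right, h, h']; ring
    have e2 := abs_real_inner_le_norm (q - q') (D t)
    have e3 := abs_real_inner_le_norm q' (D t - D t')
    rw [hD1, mul_one] at e2
    rw [hq', one_mul] at e3
    have e4 := abs_add_le ⟪q - q', D t⟫ ⟪q', D t - D t'⟫
    rw [← e1] at e4
    linarith [hDL t t']
  have hlip : LipschitzOnWith 2 Y0 (sphere (0 : Euc n) 1) := by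
    refine LipschitzOnWith.of_dist_le_mul fun q hq q' hq' => ?_
    rw [mem_sphere_zero_iff_norm] at hq hq'
    rw [Real.dist_eq, dist_eq_norm]
    exact hkey q q' _ _ hq hq' (hY0 q hq) (hY0 q' hq')
  obtain ⟨Y, hYL, hYeq⟩ := hlip.extend_real
  have hYm : Measurable Y := hYL.continuous.measurable
  set σ := (μH[k] : Measure (Euc n)).restrict (sphere (0 : Euc n) 1) with hσ
  haveI : IsFiniteMeasure σ := ⟨by rw [hσ, Measure.restrict_apply_univ]; exact hfin⟩
  have hem : Measurable fun q : Euc n => ⟪q, e⟫ := by fun_prop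
  have hYs : ∀ q : Euc n, ‖q‖ = 1 → ⟪q, D (Y q)⟫ = Y q := by
    intro q hq
    rw [← hYeq (mem_sphere_zero_iff_norm.2 hq)]
    exact hY0 q hq
  have hmeas : σ.map Y = σ.map fun q : Euc n => ⟪q, e⟫ := by
    haveI : IsFiniteMeasure (σ.map Y) := Measure.isFiniteMeasure_map σ Y
    refine Measure.ext_of_Iic _ _ fun t0 => ?_
    rw [Measure.map_apply hYm measurableSet_Iic, Measure.map_apply hem measurableSet_Iic, hσ,
      Measure.restrict_apply (hYm measurableSet_Iic), Measure.restrict_apply (hem measurableSet_Iic)]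
    have h1 : Y ⁻¹' Iic t0 ∩ sphere 0 1 = {q : Euc n | ‖q‖ = 1 ∧ ⟪q, D t0⟫ ≤ t0} := by
      ext q
      rw [mem_inter_iff, mem_sphere_zero_iff_norm]
      constructor
      · rintro ⟨h, hq⟩
        refine ⟨hq, ?_⟩
        have h : Y q ≤ t0 := h
        have e3 := abs_real_inner_le_norm q (D t0 - D (Y q))
        rw [hq, one_mul, inner_sub_right, hYs q hq] at e3
        have e4 := hDL t0 (Y q)
        rw [abs_of_nonneg (by linarith : 0 ≤ t0 - Y q)] at e4
        have := (abs_le.1 e3).2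
        linarith
      · rintro ⟨hq, h⟩
        refine ⟨?_, hq⟩
        show Y q ≤ t0
        by_contra! hcon
        have e3 := abs_real_inner_le_norm q (D t0 - D (Y q))
        rw [hq, one_mul, inner_sub_right, hYs q hq] at e3
        have e4 := hDL t0 (Y q)
        rw [abs_of_neg (by linarith : t0 - Y q < 0)] at e4
        have := (abs_le.1 e3).1
        linarith
    have h2 : (fun q : Euc n => ⟪q, e⟫) ⁻¹' Iic t0 ∩ sphere 0 1 = {q : Euc n | ‖q‖ = 1 ∧ ⟪q, e⟫ ≤ t0} := by
      ext q
      rw [mem_inter_iff, mem_sphere_zero_iff_norm]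
      exact and_comm
    rw [h1, h2]
    exact hmeas_le_level (hD1 t0) he k t0
  have hfinal : σ.map Y T = (σ.map fun q : Euc n => ⟪q, e⟫) T := by rw [hmeas]
  rw [Measure.map_apply hYm hT, Measure.map_apply hem hT, hσ,
      Measure.restrict_apply (hYm hT), Measure.restrict_apply (hem hT)] at hfinal
  convert hfinal using 2
  · ext q
    rw [mem_inter_iff, mem_sphere_zero_iff_norm]
    constructor
    · rintro ⟨hq, t, ht, h⟩
      refine ⟨?_, hq⟩
      have := hkey q q _ _ hq hq h (hYs q hq)
      rw [sub_self, norm_zero, mul_zero] at this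
      have : t = Y q := by
        have := abs_nonpos_iff.1 this; linarith
      show Y q ∈ T
      rwa [← this]
    · rintro ⟨h, hq⟩
      exact ⟨hq, Y q, h, hYs q hq⟩
  · ext q
    rw [mem_inter_iff, mem_sphere_zero_iff_norm]
    exact and_comm

/-- The graph over `S` in polar coordinates. -/
def gph {n : ℕ} (S : Set ℝ) (y : ℝ → ℝ) (d : ℝ → Euc n) : Set (Euc n) :=
  {x | ∃ r ∈ S, ∃ q : Euc n, ‖q‖ = 1 ∧ ⟪q, d r⟫ = y r ∧ r • q = x}

/-- The spherical projection of `gph`. -/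
def pgph {n : ℕ} (S : Set ℝ) (y : ℝ → ℝ) (d : ℝ → Euc n) : Set (Euc n) :=
  {q | ‖q‖ = 1 ∧ ∃ r ∈ S, ⟪q, d r⟫ = y r}

theorem piece_up {n : ℕ} {k : ℝ} (hk : 0 ≤ k) {S : Set ℝ} {y : ℝ → ℝ} {d : ℝ → Euc n} (hd1 : ∀ r, ‖d r‖ = 1)
    (hdL : ∀ r ∈ S, ∀ r' ∈ S, ‖d r - d r'‖ ≤ (1/2) * |y r - y r'|) {ε r0 : ℝ} (hε : 0 ≤ ε) (hr0 : r0 ∈ S)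
    (hS0 : ∀ r ∈ S, 0 ≤ r) (hy : ∀ r ∈ S, |y r| ≤ 1)
    (hS : ∀ r ∈ S, ∀ r' ∈ S, |r - r'| ≤ ε * |y r - y r'|) :
    μH[k] (gph S y d) ≤ ENNReal.ofReal (r0 + 4 * ε) ^ k * μH[k] (pgph S y d) := by
  have hex : ∀ q : Euc n, ∃ r, q ∈ pgph S y d → r ∈ S ∧ ⟪q, d r⟫ = y r := by
    intro q
    by_cases hq : q ∈ pgph S y d
    · obtain ⟨r, hr⟩ := hq.2
      exact ⟨r, fun _ => hr⟩
    · exact ⟨0, fun h => absurd h hq⟩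
  choose f hf using hex
  have hkey : ∀ (q q' : Euc n) (r r' : ℝ), ‖q‖ = 1 → ‖q'‖ = 1 → r ∈ S → r' ∈ S → ⟪q, d r⟫ = y r →
      ⟪q', d r'⟫ = y r' → |y r - y r'| ≤ 2 * ‖q - q'‖ := by
    intro q q' t t' hq hq' hr hr' h h'
    have e1 : y t - y t' = ⟪q - q', d t⟫ + ⟪q', d t - d t'⟫ := by
      rw [inner_sub_left, inner_sub_right, h, h']; ring
    have e2 := abs_real_inner_le_norm (q - q') (d t)
    have e3 := abs_real_inner_le_norm q' (d t - d t')
    rw [hd1, mul_one] at e2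
    rw [hq', one_mul] at e3
    have e4 := abs_add_le ⟪q - q', d t⟫ ⟪q', d t - d t'⟫
    rw [← e1] at e4
    linarith [hdL t hr t' hr']
  have himg : gph S y d ⊆ (fun q => f q • q) '' pgph S y d := by
    rintro x ⟨r, hr, q, hq, hqd, rfl⟩
    have hqp : q ∈ pgph S y d := ⟨hq, r, hr, hqd⟩
    refine ⟨q, hqp, ?_⟩
    obtain ⟨h1, h2⟩ := hf q hqp
    have h3 := hkey q q _ _ hq hq h1 hr h2 hqd
    rw [sub_self, norm_zero, mul_zero] at h3
    have h4 := hS _ h1 _ hr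
    have h5 : |f q - r| ≤ 0 := h4.trans (mul_nonpos_of_nonneg_of_nonpos hε h3)
    have h6 := abs_nonpos_iff.1 h5
    have h7 : f q = r := by linarith
    simp only [h7]
  refine (measure_mono himg).trans ?_
  have hr00 := hS0 r0 hr0
  have hL : LipschitzOnWith (r0 + 4 * ε).toNNReal (fun q => f q • q) (pgph S y d) := by
    refine LipschitzOnWith.of_dist_le_mul fun q hq q' hq' => ?_
    rw [dist_eq_norm, dist_eq_norm, Real.coe_toNNReal _ (by positivity)]
    obtain ⟨h1, h2⟩ := hf q hq
    obtain ⟨h1', h2'⟩ := hf q' hq'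
    have h3 := hkey q q' _ _ hq.1 hq'.1 h1 h1' h2 h2'
    have h4 := hS _ h1 _ h1'
    have h5 := hS _ h1 _ hr0
    have h6 : |y (f q) - y r0| ≤ 2 := by
      have := abs_sub (y (f q)) (y r0)
      linarith [hy _ h1, hy _ hr0]
    have h7 : f q ≤ r0 + 2 * ε := by
      have := mul_le_mul_of_nonneg_left h6 hε
      linarith [le_abs_self (f q - r0)]
    have e1 : f q • q - f q' • q' = f q • (q - q') + (f q - f q') • q' := by
      rw [smul_sub, sub_smul]; abel
    rw [e1]
    refine (norm_add_le _ _).trans ?_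
    rw [norm_smul, norm_smul, hq'.1, mul_one, Real.norm_eq_abs, Real.norm_eq_abs, abs_of_nonneg (hS0 _ h1)]
    have h8 := mul_le_mul_of_nonneg_left h3 hε
    have h9 := mul_le_mul_of_nonneg_right h7 (norm_nonneg (q - q'))
    linarith
  exact hL.hausdorffMeasure_image_le hk

theorem piece_down {n : ℕ} {k : ℝ} (hk : 0 ≤ k) {S : Set ℝ} {y : ℝ → ℝ} {d : ℝ → Euc n}
    {ε r0 : ℝ} (hε : 0 ≤ ε) (hr0 : r0 ∈ S) (h0 : 0 < r0 - 2 * ε)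
    (hy : ∀ r ∈ S, |y r| ≤ 1)
    (hS : ∀ r ∈ S, ∀ r' ∈ S, |r - r'| ≤ ε * |y r - y r'|) :
    μH[k] (pgph S y d) ≤ ENNReal.ofReal (r0 - 2 * ε)⁻¹ ^ k * μH[k] (gph S y d) := by
  have hge : ∀ r ∈ S, r0 - 2 * ε ≤ r := by
    intro r hr
    have h5 := hS _ hr _ hr0
    have h6 : |y r - y r0| ≤ 2 := by
      have := abs_sub (y r) (y r0)
      linarith [hy _ hr, hy _ hr0]
    have := mul_le_mul_of_nonneg_left h6 hε
    linarith [neg_abs_le (r - r0)]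
  have himg : pgph S y d ⊆ hatv '' gph S y d := by
    rintro q ⟨hq, r, hr, hqd⟩
    exact ⟨r • q, ⟨r, hr, q, hq, hqd, rfl⟩, hatv_smul hq (h0.trans_le (hge r hr))⟩
  refine (measure_mono himg).trans ?_
  have hnorm : ∀ x ∈ gph S y d, r0 - 2 * ε ≤ ‖x‖ := by
    rintro x ⟨r, hr, q, hq, hqd, rfl⟩
    rw [norm_smul, hq, mul_one, Real.norm_eq_abs, abs_of_pos (h0.trans_le (hge r hr))]
    exact hge r hr
  have hL : LipschitzOnWith ((r0 - 2 * ε)⁻¹).toNNReal hatv (gph S y d) := by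
    refine LipschitzOnWith.of_dist_le_mul fun x hx x' hx' => ?_
    rw [dist_eq_norm, dist_eq_norm, Real.coe_toNNReal _ (by positivity)]
    exact norm_hatv_sub_le h0 (hnorm x hx) (hnorm x' hx')
  exact hL.hausdorffMeasure_image_le hk


theorem pgph_eq {n : ℕ} (S : Set ℝ) (y : ℝ → ℝ) (D : ℝ → Euc n) :
    pgph S y (fun r => D (y r)) = {q : Euc n | ‖q‖ = 1 ∧ ∃ t ∈ y '' S, ⟪q, D t⟫ = t} := by
  ext q
  constructor
  · rintro ⟨hq, r, hr, h⟩
    exact ⟨hq, y r, ⟨r, hr, rfl⟩, h⟩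
  · rintro ⟨hq, _, ⟨r, hr, rfl⟩, h⟩
    exact ⟨hq, r, hr, h⟩

theorem piece_le {n : ℕ} {k : ℝ} (hk : 0 ≤ k) (hfin : μH[k] (sphere (0 : Euc n) 1) < ⊤)
    {D1 D2 : ℝ → Euc n} (h11 : ∀ t, ‖D1 t‖ = 1) (h12 : ∀ t, ‖D2 t‖ = 1)
    (hL1 : ∀ t t', ‖D1 t - D1 t'‖ ≤ (1/2) * |t - t'|) (hL2 : ∀ t t', ‖D2 t - D2 t'‖ ≤ (1/2) * |t - t'|)
    {S : Set ℝ} {y : ℝ → ℝ} (hT : MeasurableSet (y '' S)) {ε a : ℝ} (hε : 0 ≤ ε) (ha : 0 < a - 2 * ε)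
    (hSa : ∀ r ∈ S, a ≤ r) (hy : ∀ r ∈ S, |y r| ≤ 1)
    (hS : ∀ r ∈ S, ∀ r' ∈ S, |r - r'| ≤ ε * |y r - y r'|) :
    μH[k] (gph S y fun r => D1 (y r)) ≤
      ENNReal.ofReal ((a + 4 * ε) / (a - 2 * ε)) ^ k * μH[k] (gph S y fun r => D2 (y r)) := by
  rcases S.eq_empty_or_nonempty with rfl | ⟨r0, hr0⟩
  · have : gph ∅ y (fun r => D1 (y r)) = ∅ := by
      ext x; simp [gph]
    rw [this]; simp
  have hr0a := hSa r0 hr0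
  have hup := piece_up (d := fun r => D1 (y r)) hk (fun r => h11 _) (fun r _ r' _ => hL1 _ _) hε hr0
    (fun r hr => by linarith [hSa r hr]) hy hS
  have hdown := piece_down (n := n) (d := fun r => D2 (y r)) hk hε hr0 (by linarith) hy hS
  have heq : μH[k] (pgph S y fun r => D1 (y r)) = μH[k] (pgph S y fun r => D2 (y r)) := by
    rw [pgph_eq, pgph_eq, push_indep hfin (h12 0) h11 hL1 hT, push_indep hfin (h12 0) h12 hL2 hT]
  rw [heq] at hup
  refine hup.trans ((mul_le_mul_right hdown _).trans ?_)
  rw [← mul_assoc, ← ENNReal.mul_rpow_of_nonneg _ _ hk, ← ENNReal.ofReal_mul (by linarith)]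
  gcongr
  rw [← div_eq_mul_inv, div_le_div_iff₀ (by linarith) ha]
  nlinarith

theorem graph_le {n : ℕ} {k : ℝ} (hk : 0 ≤ k) (hfin : μH[k] (sphere (0 : Euc n) 1) < ⊤)
    {D1 D2 : ℝ → Euc n} (h11 : ∀ t, ‖D1 t‖ = 1) (h12 : ∀ t, ‖D2 t‖ = 1)
    (hL1 : ∀ t t', ‖D1 t - D1 t'‖ ≤ (1/2) * |t - t'|) (hL2 : ∀ t t', ‖D2 t - D2 t'‖ ≤ (1/2) * |t - t'|)
    {S : Set ℝ} (hSm : MeasurableSet S) {y : ℝ → ℝ} (hT : ∀ B ⊆ S, MeasurableSet B → MeasurableSet (y '' B))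
    {a : ℝ} (ha : 0 < a)
    (hSa : ∀ r ∈ S, a ≤ r) (hy : ∀ r ∈ S, |y r| ≤ 1)
    (hP : ∀ ε > 0, ∃ P : ℕ → Set ℝ, (∀ i, MeasurableSet (P i)) ∧ S ⊆ ⋃ i, P i ∧
      ∀ i, ∀ r ∈ S ∩ P i, ∀ r' ∈ S ∩ P i, |r - r'| ≤ ε * |y r - y r'|)
    {μ1 μ2 : Measure ℝ}
    (hμ1 : ∀ B ⊆ S, MeasurableSet B → μ1 B = μH[k] (gph B y fun r => D1 (y r)))
    (hμ2 : ∀ B ⊆ S, MeasurableSet B → μ2 B = μH[k] (gph B y fun r => D2 (y r))) :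
    μ1 S ≤ μ2 S := by
  have hstep : ∀ ε > 0, 0 < a - 2 * ε →
      μ1 S ≤ ENNReal.ofReal ((a + 4 * ε) / (a - 2 * ε)) ^ k * μ2 S := by
    intro ε hε hae
    obtain ⟨P, hPm, hPS, hPe⟩ := hP ε hε
    have hdec : S = ⋃ i, S ∩ disjointed P i := by
      rw [← inter_iUnion, iUnion_disjointed, inter_eq_left.2 hPS]
    have hmeas : ∀ i, MeasurableSet (S ∩ disjointed P i) := fun i =>
      hSm.inter (MeasurableSet.disjointed hPm i)
    have hdisj : Pairwise (Function.onFun Disjoint fun i => S ∩ disjointed P i) := fun i j hij =>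
      (disjoint_disjointed P hij).mono inter_subset_right inter_subset_right
    have e1 : μ1 S = ∑' i, μ1 (S ∩ disjointed P i) := by
      conv_lhs => rw [hdec]
      exact measure_iUnion hdisj hmeas
    have e2 : μ2 S = ∑' i, μ2 (S ∩ disjointed P i) := by
      conv_lhs => rw [hdec]
      exact measure_iUnion hdisj hmeas
    rw [e1, e2, ← ENNReal.tsum_mul_left]
    refine ENNReal.tsum_le_tsum fun i => ?_
    rw [hμ1 _ inter_subset_left (hmeas i), hμ2 _ inter_subset_left (hmeas i)]
    have hsub : S ∩ disjointed P i ⊆ S ∩ P i := inter_subset_inter_right _ (disjointed_subset P i)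
    exact piece_le hk hfin h11 h12 hL1 hL2 (hT _ inter_subset_left (hmeas i)) hε.le hae
      (fun r hr => hSa r hr.1) (fun r hr => hy r hr.1)
      (fun r hr r' hr' => hPe i r (hsub hr) r' (hsub hr'))
  have hlim : Tendsto (fun ε : ℝ => ENNReal.ofReal ((a + 4 * ε) / (a - 2 * ε)) ^ k * μ2 S) (𝓝[>] 0)
      (𝓝 (1 * μ2 S)) := by
    refine ENNReal.Tendsto.mul_const ?_ (Or.inl one_ne_zero)
    have h1 : Tendsto (fun ε : ℝ => (a + 4 * ε) / (a - 2 * ε)) (𝓝[>] 0) (𝓝 1) := by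
      have : ContinuousAt (fun ε : ℝ => (a + 4 * ε) / (a - 2 * ε)) 0 := by
        refine ContinuousAt.div (by fun_prop) (by fun_prop) (by simpa using ha.ne')
      have h := this.tendsto
      simp only [mul_zero, add_zero, sub_zero, div_self ha.ne'] at h
      exact h.mono_left nhdsWithin_le_nhds
    have h2 := (ENNReal.continuous_rpow_const (y := k)).continuousAt (x := 1)
    have h3 := (ENNReal.tendsto_ofReal h1)
    rw [ENNReal.ofReal_one] at h3
    have := h2.tendsto.comp h3
    simp only [ENNReal.one_rpow] at this
    exact this
  rw [one_mul] at hlim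
  refine ge_of_tendsto hlim ?_
  have h0 : ∀ᶠ ε : ℝ in 𝓝[>] 0, ε < a / 2 := nhdsWithin_le_nhds (eventually_lt_nhds (by linarith))
  filter_upwards [self_mem_nhdsWithin, h0] with ε h1 h2
  exact hstep ε h1 (by linarith)


theorem Ctx.yy_cont {n : ℕ} {e w : Euc n} {β yL yR : ℝ → ℝ} (c : Ctx n e w β yL yR) {a b : ℝ}
    (hab : Icc a b ⊆ Iset yL yR) (hle : a ≤ b) : Continuous fun r => yL (max a (min b r)) := by
  have hco : ContinuousOn yL (Icc a b) := fun r hr => (c.cont (hab hr)).continuousWithinAt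
  refine hco.comp_continuous (by fun_prop) fun r => ⟨le_max_left _ _, max_le hle (min_le_left _ _)⟩

theorem pr_eq {a b r : ℝ} (hr : r ∈ Icc a b) : max a (min b r) = r := by
  rw [min_eq_right hr.2, max_eq_right hr.1]

theorem Ctx.side_right {n : ℕ} {e w : Euc n} {β yL yR : ℝ → ℝ} (c : Ctx n e w β yL yR) {a b : ℝ}
    (hab : Icc a b ⊆ Iset yL yR) {r : ℝ} (hr : r ∈ Ioo a b) :
    ∃ A : Set ℝ, MeasurableSet A ∧ ¬ RDensity0 A r ∧ ∀ s ∈ A, r < s ∧ β s = yL s := by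
  have hle : a ≤ b := (hr.1.trans hr.2).le
  refine ⟨Ioo r b ∩ {s | β s = yL (max a (min b s))}, measurableSet_Ioo.inter
    (measurableSet_eq_fun c.hβ (c.yy_cont hab hle).measurable), ?_, ?_⟩
  · refine not_rdensity0_right (ev_right_iff.2 ⟨b - r, sub_pos.2 hr.2, ?_⟩)
    have h := c.ae_eq
    rw [measure_eq_zero_iff_ae_notMem] at h
    filter_upwards [h] with s hs hsI
    rw [add_sub_cancel] at hsI
    have hsab : s ∈ Icc a b := ⟨hr.1.le.trans hsI.1.le, hsI.2.le⟩
    refine ⟨hsI, ?_⟩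
    show β s = yL (max a (min b s))
    rw [pr_eq hsab]
    by_contra hcon
    exact hs ⟨hab hsab, hcon⟩
  · rintro s ⟨hs, h⟩
    have h : β s = yL (max a (min b s)) := h
    rw [pr_eq ⟨hr.1.le.trans hs.1.le, hs.2.le⟩] at h
    exact ⟨hs.1, h⟩

theorem Ctx.side_left {n : ℕ} {e w : Euc n} {β yL yR : ℝ → ℝ} (c : Ctx n e w β yL yR) {a b : ℝ}
    (hab : Icc a b ⊆ Iset yL yR) {r : ℝ} (hr : r ∈ Ioo a b) :
    ∃ A : Set ℝ, MeasurableSet A ∧ ¬ RDensity0 A r ∧ ∀ s ∈ A, s < r ∧ β s = yL s := by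
  have hle : a ≤ b := (hr.1.trans hr.2).le
  refine ⟨Ioo a r ∩ {s | β s = yL (max a (min b s))}, measurableSet_Ioo.inter
    (measurableSet_eq_fun c.hβ (c.yy_cont hab hle).measurable), ?_, ?_⟩
  · refine not_rdensity0_left (ev_left_iff.2 ⟨r - a, sub_pos.2 hr.1, ?_⟩)
    have h := c.ae_eq
    rw [measure_eq_zero_iff_ae_notMem] at h
    filter_upwards [h] with s hs hsI
    rw [sub_sub_cancel] at hsI
    have hsab : s ∈ Icc a b := ⟨hsI.1.le, hsI.2.le.trans hr.2.le⟩
    refine ⟨hsI, ?_⟩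
    show β s = yL (max a (min b s))
    rw [pr_eq hsab]
    by_contra hcon
    exact hs ⟨hab hsab, hcon⟩
  · rintro s ⟨hs, h⟩
    have h : β s = yL (max a (min b s)) := h
    rw [pr_eq ⟨hs.1.le, hs.2.le.trans hr.2.le⟩] at h
    exact ⟨hs.2, h⟩

theorem Ctx.bdry {n : ℕ} {e w : Euc n} {β yL yR : ℝ → ℝ} (c : Ctx n e w β yL yR) {a b : ℝ}
    (hab : Icc a b ⊆ Iset yL yR) {S : Set ℝ} (hS : S ⊆ Ioo a b) {d : ℝ → Euc n} (hdc : Continuous d)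
    (hdn : ∀ r, ‖d r‖ = 1) {ς : ℝ} (hς : ς = 1 ∨ ς = -1)
    (hmono : ∀ r ∈ S, ∀ᶠ r' in 𝓝 r, ‖d r' - d r‖ * |r' - r| ≤ ς * (yL r' - yL r) * (r' - r)) :
    norm ⁻¹' S ∩ essBoundary (capE d β) = gph S yL d := by
  have hn1 : 1 ≤ n := by have := c.hn; omega
  have hdinner : ∀ (q : Euc n), ‖q‖ = 1 → ∀ r r', |⟪q, d r'⟫ - ⟪q, d r⟫| ≤ ‖d r' - d r‖ := by
    intro q hq r r'
    rw [← inner_sub_right]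
    refine (abs_real_inner_le_norm _ _).trans ?_
    rw [hq, one_mul]
  have hdt : ∀ r, ∀ ε > 0, ∀ᶠ s in 𝓝 r, ‖d s - d r‖ < ε := by
    intro r ε hε
    have := (Metric.tendsto_nhds.1 (hdc.tendsto r)) ε hε
    simpa [dist_eq_norm] using this
  ext x
  constructor
  · rintro ⟨hx, hxb⟩
    have hx : ‖x‖ ∈ S := hx
    have hrI := hab (Ioo_subset_Icc_self (hS hx))
    have hr0 : 0 < ‖x‖ := hrI.1
    have hx0 : x ≠ 0 := norm_pos_iff.1 hr0
    have hq : ‖hatv x‖ = 1 := norm_hatv hx0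
    have hxe : ‖x‖ • hatv x = x := smul_hatv x hx0
    refine ⟨‖x‖, hx, hatv x, hq, ?_, hxe⟩
    by_contra hne
    rcases lt_or_gt_of_ne hne with hlt | hgt
    · set η := (yL ‖x‖ - ⟪hatv x, d ‖x‖⟫) / 3 with hη
      have hηp : 0 < η := by rw [hη]; linarith
      obtain ⟨ε, hε, hβ⟩ := c.near hrI hηp
      obtain ⟨ε', hε', hd'⟩ := Metric.eventually_nhds_iff.1 (hdt ‖x‖ η hηp)
      refine cap_not_mem_of_above (d := d) (β := β) hdn hq hr0 hηp (lt_min hε hε') ?_ (by rw [hxe]; exact hxb)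
      filter_upwards [hβ] with s hs hsI
      have h1 := hs ⟨by linarith [hsI.1, min_le_left ε ε'], by linarith [hsI.2, min_le_left ε ε']⟩
      have h2 := hd' (y := s) (by
        rw [Real.dist_eq, abs_lt]
        constructor
        · linarith [hsI.1, min_le_right ε ε']
        · linarith [hsI.2, min_le_right ε ε'])
      have h3 := (abs_le.1 (hdinner _ hq ‖x‖ s)).2
      linarith [h1.1]
    · set η := (⟪hatv x, d ‖x‖⟫ - yL ‖x‖) / 3 with hη
      have hηp : 0 < η := by rw [hη]; linarith
      obtain ⟨ε, hε, hβ⟩ := c.near hrI hηp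
      obtain ⟨ε', hε', hd'⟩ := Metric.eventually_nhds_iff.1 (hdt ‖x‖ η hηp)
      refine cap_not_mem_of_below (d := d) (β := β) hdn hq hr0 hηp (lt_min hε hε') ?_ (by rw [hxe]; exact hxb)
      filter_upwards [hβ] with s hs hsI
      have h1 := hs ⟨by linarith [hsI.1, min_le_left ε ε'], by linarith [hsI.2, min_le_left ε ε']⟩
      have h2 := hd' (y := s) (by
        rw [Real.dist_eq, abs_lt]
        constructor
        · linarith [hsI.1, min_le_right ε ε']
        · linarith [hsI.2, min_le_right ε ε'])
      have h3 := (abs_le.1 (hdinner _ hq ‖x‖ s)).1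
      linarith [h1.2]
  · rintro ⟨r, hr, q, hq, hqd, rfl⟩
    have hrI := hab (Ioo_subset_Icc_self (hS hr))
    have hr0 : 0 < r := hrI.1
    refine ⟨?_, ?_⟩
    · show ‖r • q‖ ∈ S
      rw [norm_smul, hq, mul_one, Real.norm_eq_abs, abs_of_pos hr0]; exact hr
    have hlt1 : |⟪q, d r⟫| < 1 := by rw [hqd, abs_lt]; exact hrI.2.1
    obtain ⟨A, hA, hA0, hAs⟩ := c.side_right hab (hS hr)
    obtain ⟨A', hA', hA0', hAs'⟩ := c.side_left hab (hS hr)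
    have hdA : ∀ A : Set ℝ, ∀ ε > 0, ∀ᶠ s in 𝓝 r, s ∈ A → ‖d s - d r‖ < ε := fun A ε hε =>
      (hdt r ε hε).mono fun s hs _ => hs
    refine mem_essBoundary_of (capE_measurable hdc.measurable c.hβ) ?_ ?_
    · rcases hς with rfl | rfl
      · refine cap_not_density0 hn1 hq (hdn r) hlt1 hr0 hA' hA0' ?_ (hdA A')
        filter_upwards [hmono r hr] with s hs hsA
        obtain ⟨h1, h2⟩ := hAs' s hsA
        have h3 := (abs_le.1 (hdinner q hq r s)).1
        rw [abs_of_neg (by linarith)] at hs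
        have h4 : ‖d s - d r‖ ≤ yL r - yL s := by nlinarith
        linarith
      · refine cap_not_density0 hn1 hq (hdn r) hlt1 hr0 hA hA0 ?_ (hdA A)
        filter_upwards [hmono r hr] with s hs hsA
        obtain ⟨h1, h2⟩ := hAs s hsA
        have h3 := (abs_le.1 (hdinner q hq r s)).1
        rw [abs_of_pos (by linarith)] at hs
        have h4 : ‖d s - d r‖ ≤ yL r - yL s := by nlinarith
        linarith
    · rcases hς with rfl | rfl
      · refine cap_not_density_compl hn1 hq (hdn r) hlt1 hr0 hA hA0 ?_ (hdA A)
        filter_upwards [hmono r hr] with s hs hsA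
        obtain ⟨h1, h2⟩ := hAs s hsA
        have h3 := (abs_le.1 (hdinner q hq r s)).2
        rw [abs_of_pos (by linarith)] at hs
        have h4 : ‖d s - d r‖ ≤ yL s - yL r := by nlinarith
        linarith
      · refine cap_not_density_compl hn1 hq (hdn r) hlt1 hr0 hA' hA0' ?_ (hdA A')
        filter_upwards [hmono r hr] with s hs hsA
        obtain ⟨h1, h2⟩ := hAs' s hsA
        have h3 := (abs_le.1 (hdinner q hq r s)).2
        rw [abs_of_neg (by linarith)] at hs
        have h4 : ‖d s - d r‖ ≤ yL s - yL r := by nlinarith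
        linarith


theorem closed_loc {f g : ℝ → ℝ → ℝ} (hf : ∀ s', Continuous fun s => f s s') (hg : ∀ s', Continuous fun s => g s s')
    (δ : ℝ) : IsClosed {s : ℝ | ∀ s', |s' - s| < δ → f s s' ≤ g s s'} := by
  rw [setOf_forall]
  refine isClosed_iInter fun s' => ?_
  have : {s : ℝ | |s' - s| < δ → f s s' ≤ g s s'} = {s | δ ≤ |s' - s|} ∪ {s | f s s' ≤ g s s'} := by
    ext s
    simp only [mem_setOf_eq, mem_union]
    rw [← @not_lt _ _ |s' - s| δ]
    exact imp_iff_not_or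
  rw [this]
  exact (isClosed_le continuous_const (by fun_prop)).union (isClosed_le (hf s') (hg s'))

theorem exists_piece {ρ η : ℝ → ℝ} (hη : Continuous η) {u v : ℝ}
    (hZ : volume ({s : ℝ | DifferentiableAt ℝ ρ s ∧ deriv ρ s = 0 ∧ DifferentiableAt ℝ η s ∧ deriv η s ≠ 0} ∩
      Ioo u v) ≠ 0) :
    ∃ ς : ℝ, (ς = 1 ∨ ς = -1) ∧ ∃ c > 0, ∃ δ > 0, ∃ K : Set ℝ, IsCompact K ∧ K ⊆ Ioo u v ∧ volume K ≠ 0 ∧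
      (∀ s ∈ K, HasDerivAt ρ 0 s) ∧
      (∀ s ∈ K, ∀ s', |s' - s| < δ → c * (s' - s) ^ 2 ≤ ς * (η s' - η s) * (s' - s)) ∧
      ∀ s ∈ K, ∀ s' ∈ K, |s' - s| < δ := by
  set Z := {s : ℝ | DifferentiableAt ℝ ρ s ∧ deriv ρ s = 0 ∧ DifferentiableAt ℝ η s ∧ deriv η s ≠ 0} ∩
      Ioo u v with hZd
  have hZm : MeasurableSet Z := by
    refine MeasurableSet.inter ?_ measurableSet_Ioo
    exact (measurableSet_of_differentiableAt ℝ ρ).inter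
      (((measurable_deriv ρ) (measurableSet_singleton 0)).inter
      ((measurableSet_of_differentiableAt ℝ η).inter
        ((measurable_deriv η) (measurableSet_singleton 0).compl)))
  set sg : Bool → ℝ := fun b => if b then 1 else -1 with hsg
  set C : Bool → ℕ → Set ℝ := fun b k => {s | ∀ s', |s' - s| < 1 / ((k:ℝ) + 1) →
    1 / ((k:ℝ) + 1) * (s' - s) ^ 2 ≤ sg b * (η s' - η s) * (s' - s)} with hC
  have hCc : ∀ b k, IsClosed (C b k) := fun b k =>
    closed_loc (f := fun s s' => 1 / ((k:ℝ) + 1) * (s' - s) ^ 2)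
      (g := fun s s' => sg b * (η s' - η s) * (s' - s)) (fun s' => by fun_prop) (fun s' => by fun_prop) _
  set J : ℕ → ℤ → Set ℝ := fun k j => {s | ⌊s * ((k:ℝ) + 1)⌋ = j} with hJ
  have hJm : ∀ k j, MeasurableSet (J k j) := fun k j => by
    have : Measurable fun s : ℝ => ⌊s * ((k:ℝ) + 1)⌋ := Int.measurable_floor.comp (by fun_prop)
    exact this (measurableSet_singleton j)
  have hcov : Z ⊆ ⋃ b, ⋃ k, ⋃ j, (Z ∩ C b k ∩ J k j) := by
    intro s hs
    have hs0 := hs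
    obtain ⟨⟨_, _, hd, hne⟩, _⟩ := hs0
    set l := deriv η s with hl
    have hlp : 0 < |l| := abs_pos.2 hne
    have ho := hd.hasDerivAt.isLittleO.bound (half_pos hlp)
    obtain ⟨δ, hδ, h⟩ := Metric.eventually_nhds_iff.1 ho
    obtain ⟨k, hk⟩ := exists_nat_one_div_lt (lt_min hδ (half_pos hlp))
    have hb : ∃ b, sg b * l = |l| := by
      rcases lt_or_gt_of_ne hne with h0 | h0
      · exact ⟨false, by simp [hsg, abs_of_neg h0]⟩
      · exact ⟨true, by simp [hsg, abs_of_pos h0]⟩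
    obtain ⟨b, hb⟩ := hb
    have hsb : |sg b| = 1 := by cases b <;> simp [hsg]
    refine mem_iUnion.2 ⟨b, mem_iUnion.2 ⟨k, mem_iUnion.2 ⟨⌊s * ((k:ℝ) + 1)⌋, ⟨hs, ?_⟩, rfl⟩⟩⟩
    intro s' hs'
    have h1 := h (y := s') (by rw [Real.dist_eq]; exact hs'.trans (hk.trans_le (min_le_left _ _)))
    rw [Real.norm_eq_abs, Real.norm_eq_abs, smul_eq_mul] at h1
    have h2 : |sg b * (η s' - η s) * (s' - s) - |l| * (s' - s) ^ 2| ≤ |l| / 2 * (s' - s) ^ 2 := by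
      rw [← hb, show sg b * (η s' - η s) * (s' - s) - sg b * l * (s' - s) ^ 2 =
        sg b * ((η s' - η s - (s' - s) * l) * (s' - s)) by ring, abs_mul, hsb, one_mul, abs_mul, hb,
        ← sq_abs (s' - s)]
      have := mul_le_mul_of_nonneg_right h1 (abs_nonneg (s' - s))
      calc _ ≤ _ := this
        _ = _ := by ring
    have h3 := (abs_le.1 h2).1
    have h4 := mul_le_mul_of_nonneg_right (hk.le.trans (min_le_right _ _)) (sq_nonneg (s' - s))
    linarith
  have hex : ∃ b k j, volume (Z ∩ C b k ∩ J k j) ≠ 0 := by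
    by_contra! hcon
    exact hZ (measure_mono_null hcov (measure_iUnion_null fun b => measure_iUnion_null fun k =>
      measure_iUnion_null fun j => hcon b k j))
  obtain ⟨b, k, j, hpos⟩ := hex
  have hm : MeasurableSet (Z ∩ C b k ∩ J k j) := (hZm.inter (hCc b k).measurableSet).inter (hJm k j)
  obtain ⟨K, hKsub, hKc, hKpos⟩ := hm.exists_lt_isCompact (pos_iff_ne_zero.2 hpos)
  have hk1 : (0:ℝ) < (k:ℝ) + 1 := by positivity
  refine ⟨sg b, by cases b <;> simp [hsg], 1 / ((k:ℝ) + 1), by positivity, 1 / ((k:ℝ) + 1), by positivity, K, hKc,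
    fun s hs => (hKsub hs).1.1.2, hKpos.ne', fun s hs => ?_, fun s hs => (hKsub hs).1.2, fun s hs s' hs' => ?_⟩
  · have h := (hKsub hs).1.1.1
    have := h.1.hasDerivAt
    rwa [h.2.1] at this
  · have h1 : ⌊s' * ((k:ℝ) + 1)⌋ = ⌊s * ((k:ℝ) + 1)⌋ := (hKsub hs').2.trans (hKsub hs).2.symm
    have h2 := Int.abs_sub_lt_one_of_floor_eq_floor h1
    rw [← sub_mul, abs_mul, abs_of_pos hk1] at h2
    rwa [lt_div_iff₀ hk1]


theorem gph_congr {n : ℕ} {S : Set ℝ} {y : ℝ → ℝ} {d d' : ℝ → Euc n} (h : ∀ r ∈ S, d r = d' r) :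
    gph S y d = gph S y d' := by
  ext x
  constructor
  · rintro ⟨r, hr, q, hq, hqd, rfl⟩
    exact ⟨r, hr, q, hq, by rw [← h r hr]; exact hqd, rfl⟩
  · rintro ⟨r, hr, q, hq, hqd, rfl⟩
    exact ⟨r, hr, q, hq, by rw [h r hr]; exact hqd, rfl⟩

theorem phi_mono {K : Set ℝ} (hK : IsCompact K) {s s' : ℝ} (h : s ≤ s') :
    volume.real (K ∩ Iic s) ≤ volume.real (K ∩ Iic s') ∧
      volume.real (K ∩ Iic s') ≤ volume.real (K ∩ Iic s) + (s' - s) := by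
  have hf : ∀ t, volume (K ∩ Iic t) ≠ ⊤ := fun t =>
    ((measure_mono inter_subset_left).trans_lt hK.measure_lt_top).ne
  refine ⟨measureReal_mono (inter_subset_inter_right _ (Iic_subset_Iic.2 h)) (hf s'), ?_⟩
  have hsub : K ∩ Iic s' ⊆ (K ∩ Iic s) ∪ Ioc s s' := by
    rintro x ⟨hx, hx'⟩
    by_cases hxs : x ≤ s
    · exact Or.inl ⟨hx, hxs⟩
    · exact Or.inr ⟨not_le.1 hxs, hx'⟩
  have h1 : volume.real (K ∩ Iic s') ≤ volume.real ((K ∩ Iic s) ∪ Ioc s s') :=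
    measureReal_mono hsub ((measure_union_lt_top (hf s).lt_top (by simp)).ne)
  refine h1.trans ((measureReal_union_le _ _).trans ?_)
  rw [Real.volume_real_Ioc_of_le h]

theorem phi_abs {K : Set ℝ} (hK : IsCompact K) (s s' : ℝ) :
    |volume.real (K ∩ Iic s') - volume.real (K ∩ Iic s)| ≤ |s' - s| := by
  rcases le_total s s' with h | h
  · have := phi_mono hK h
    rw [abs_of_nonneg (by linarith), abs_of_nonneg (by linarith)]; linarith
  · have := phi_mono hK h
    rw [abs_of_nonpos (by linarith), abs_of_nonpos (by linarith)]; linarith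

theorem Ctx.no_cantor {n : ℕ} {e w : Euc n} {β yL yR : ℝ → ℝ} (c : Ctx n e w β yL yR) {a b : ℝ}
    (hab : Icc a b ⊆ Iset yL yR) (hlt : a < b) {m ρ : ℝ → ℝ} (p : Param m ρ) {η : ℝ → ℝ}
    (hη : η = fun s => yL (max a (min b (ρ s)))) :
    volume ({s : ℝ | DifferentiableAt ℝ ρ s ∧ deriv ρ s = 0 ∧ DifferentiableAt ℝ η s ∧ deriv η s ≠ 0} ∩
      Ioo (m a) (m b)) = 0 := by
  by_contra hpos
  have hρc : Continuous ρ := p.lip.continuous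
  have hyc := c.yy_cont hab hlt.le
  have hηc : Continuous η := by rw [hη]; exact hyc.comp hρc
  obtain ⟨ς, hς, c0, hc0, δ, hδ, K, hK, hKsub, hKpos, hKρ, hKη, hKδ⟩ := exists_piece hηc hpos
  have hηm : ∀ r ∈ Icc a b, η (m r) = yL r := by
    intro r hr
    rw [hη]; simp only [p.left]; rw [pr_eq hr]
  have ha0 : 0 < a := (hab (left_mem_Icc.2 hlt.le)).1
  set M := volume.real K with hM
  have hMpos : 0 < M := by
    rw [hM, measureReal_def]
    exact ENNReal.toReal_pos hKpos hK.measure_lt_top.ne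
  set lam := min (c0 / 2) (1 / (M + 1)) with hlam
  have hlampos : 0 < lam := lt_min (by positivity) (by positivity)
  have hlam1 : lam ≤ c0 / 2 := min_le_left _ _
  have hΘ : lam * M < 1 := by
    have : lam * M ≤ 1 / (M + 1) * M := mul_le_mul_of_nonneg_right (min_le_right _ _) hMpos.le
    refine this.trans_lt ?_
    rw [one_div, inv_mul_lt_iff₀ (by positivity)]; linarith
  set Φ : ℝ → ℝ := fun r => lam * volume.real (K ∩ Iic (m r)) with hΦ
  have hΦL : ∀ r r', |Φ r' - Φ r| ≤ lam * |m r' - m r| := by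
    intro r r'
    simp only [hΦ]
    rw [← mul_sub, abs_mul, abs_of_pos hlampos]
    exact mul_le_mul_of_nonneg_left (phi_abs hK _ _) hlampos.le
  set d : ℝ → Euc n := fun r => rot e w (Φ r) with hd
  have hdn : ∀ r, ‖d r‖ = 1 := fun r => rot_norm c.he c.hw c.hew _
  have hdL : ∀ r r', ‖d r' - d r‖ ≤ lam * |m r' - m r| := fun r r' =>
    (rot_dist c.he c.hw c.hew _ _).trans (hΦL r r')
  have hdc : Continuous d := by
    refine continuous_iff_continuousAt.2 fun r => ?_
    rw [ContinuousAt, tendsto_iff_norm_sub_tendsto_zero]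
    refine squeeze_zero (fun _ => norm_nonneg _) (fun r' => hdL r r') ?_
    have : Continuous fun r' => lam * |m r' - m r| := by
      have := p.cont
      fun_prop
    have h := this.tendsto r
    simpa using h
  set S := ρ '' K with hS
  have hSc : IsCompact S := hK.image hρc
  have hSK : ∀ r ∈ S, m r ∈ K := by
    rintro _ ⟨s, hs, rfl⟩
    rwa [p.right]
  have hSK' : ∀ r, m r ∈ K → r ∈ S := fun r hr => ⟨m r, hr, p.left r⟩
  have hSab : S ⊆ Ioo a b := by
    intro r hr
    have := hKsub (hSK r hr)
    exact ⟨p.strictMono.lt_iff_lt.1 this.1, p.strictMono.lt_iff_lt.1 this.2⟩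
  have hmono : ∀ d' : ℝ → Euc n, (∀ r r', ‖d' r' - d' r‖ ≤ lam * |m r' - m r|) → ∀ r ∈ S, ∀ᶠ r' in 𝓝 r,
      ‖d' r' - d' r‖ * |r' - r| ≤ ς * (yL r' - yL r) * (r' - r) := by
    intro d' hd' r hr
    have h1 : ∀ᶠ r' in 𝓝 r, |m r' - m r| < δ := by
      have := Metric.tendsto_nhds.1 (p.cont.tendsto r) δ hδ
      simpa [Real.dist_eq] using this
    filter_upwards [h1, Ioo_mem_nhds (hSab hr).1 (hSab hr).2] with r' h1 h2
    have h3 := hKη (m r) (hSK r hr) (m r') h1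
    rw [hηm r (Ioo_subset_Icc_self (hSab hr)), hηm r' (Ioo_subset_Icc_self h2)] at h3
    have h4 := hd' r r'
    set X := ς * (yL r' - yL r) with hX
    have hlc : lam ≤ c0 := by linarith
    rcases lt_trichotomy r r' with h | h | h
    · have hm := p.strictMono h
      have h5 : c0 * (m r' - m r) ≤ X := by
        have : 0 < m r' - m r := by linarith
        nlinarith
      rw [abs_of_pos (by linarith)] at h4 ⊢
      have h6 : ‖d' r' - d' r‖ ≤ X :=
        h4.trans ((mul_le_mul_of_nonneg_right hlc (by linarith)).trans h5)
      exact mul_le_mul_of_nonneg_right h6 (by linarith)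
    · rw [h]; simp
    · have hm := p.strictMono h
      have h5 : c0 * (m r - m r') ≤ - X := by
        have : 0 < m r - m r' := by linarith
        nlinarith
      rw [abs_of_neg (by linarith)] at h4 ⊢
      have h6 : ‖d' r' - d' r‖ ≤ - X := by
        refine h4.trans ((mul_le_mul_of_nonneg_right hlc (by linarith)).trans ?_)
        linarith
      have := mul_le_mul_of_nonneg_right h6 (by linarith : 0 ≤ -(r' - r))
      linarith
  have hyS : ∀ r ∈ S, ∀ r' ∈ S, c0 * |m r' - m r| ≤ |yL r' - yL r| := by
    intro r hr r' hr'
    have h3 := hKη (m r) (hSK r hr) (m r') (hKδ _ (hSK r hr) _ (hSK r' hr'))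
    rw [hηm r (Ioo_subset_Icc_self (hSab hr)), hηm r' (Ioo_subset_Icc_self (hSab hr'))] at h3
    have hςa : |ς| = 1 := by rcases hς with h | h <;> simp [h]
    have h4 := h3.trans (le_abs_self _)
    rw [abs_mul, abs_mul, hςa, one_mul, ← sq_abs (m r' - m r)] at h4
    rcases eq_or_lt_of_le (abs_nonneg (m r' - m r)) with h | h
    · rw [← h, mul_zero]; exact abs_nonneg _
    · nlinarith
  have hmL : ∀ r r', |r' - r| ≤ |m r' - m r| := by
    intro r r'
    have := p.lip.dist_le_mul (m r') (m r)
    rwa [p.left, p.left, Real.dist_eq, Real.dist_eq, NNReal.coe_one, one_mul] at this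
  have hinj : InjOn yL S := by
    intro r hr r' hr' h
    have h1 := hyS r hr r' hr'
    rw [h, sub_self, abs_zero] at h1
    have h2 := hmL r r'
    have h3 : |r' - r| ≤ 0 := by nlinarith
    have := abs_nonpos_iff.1 h3
    linarith
  have hΦy : ∀ r ∈ S, ∀ r' ∈ S, |Φ r' - Φ r| ≤ (1/2) * |yL r' - yL r| := by
    intro r hr r' hr'
    refine (hΦL r r').trans ?_
    have := mul_le_mul_of_nonneg_right hlam1 (abs_nonneg (m r' - m r))
    linarith [hyS r hr r' hr']
  obtain ⟨f, hfL, hfΦ⟩ : ∃ f : ℝ → ℝ, LipschitzWith (1/2) f ∧ ∀ r ∈ S, f (yL r) = Φ r := by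
    set g := Function.invFunOn yL S with hg
    have hgl : ∀ r ∈ S, g (yL r) = r := fun r hr => hinj.leftInvOn_invFunOn hr
    have : LipschitzOnWith (1/2) (fun t => Φ (g t)) (yL '' S) := by
      refine LipschitzOnWith.of_dist_le_mul ?_
      rintro _ ⟨r, hr, rfl⟩ _ ⟨r', hr', rfl⟩
      simp only [hgl r hr, hgl r' hr', Real.dist_eq]
      simpa using hΦy r' hr' r hr
    obtain ⟨f, hf, heq⟩ := this.extend_real
    refine ⟨f, hf, fun r hr => ?_⟩
    rw [← heq ⟨r, hr, rfl⟩]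
    simp only [hgl r hr]
  have hDL : ∀ t t', ‖rot e w (f t) - rot e w (f t')‖ ≤ (1/2) * |t - t'| := by
    intro t t'
    refine (rot_dist c.he c.hw c.hew _ _).trans ?_
    have := hfL.dist_le_mul t t'
    rw [Real.dist_eq, Real.dist_eq] at this
    simpa using this
  have hcL : ∀ t t' : ℝ, ‖(fun _ => e) t - (fun _ => e) t'‖ ≤ (1/2) * |t - t'| := by
    intro t t'
    simp only [sub_self, norm_zero]; positivity
  have hycS : ContinuousOn yL S := fun r hr => (c.cont (hab (Ioo_subset_Icc_self (hSab hr)))).continuousWithinAt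
  have hT : ∀ B ⊆ S, MeasurableSet B → MeasurableSet (yL '' B) := fun B hB hBm =>
    hBm.image_of_continuousOn_injOn (hycS.mono hB) (hinj.mono hB)
  have hk0 : (0:ℝ) ≤ (n:ℝ) - 1 := by
    have : (2:ℝ) ≤ n := by exact_mod_cast c.hn
    linarith
  have hSa : ∀ r ∈ S, a ≤ r := fun r hr => (hSab hr).1.le
  have hy1 : ∀ r ∈ S, |yL r| ≤ 1 := by
    intro r hr
    have := (hab (Ioo_subset_Icc_self (hSab hr))).2.1
    exact abs_le.2 ⟨this.1.le, this.2.le⟩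
  have hP : ∀ ε > 0, ∃ P : ℕ → Set ℝ, (∀ i, MeasurableSet (P i)) ∧ S ⊆ ⋃ i, P i ∧
      ∀ i, ∀ r ∈ S ∩ P i, ∀ r' ∈ S ∩ P i, |r - r'| ≤ ε * |yL r - yL r'| := by
    intro ε hε
    obtain ⟨enc, henc⟩ := exists_surjective_nat (ℕ × ℤ)
    set Q : ℕ × ℤ → Set ℝ := fun kj => {s : ℝ | ∀ s', |s' - s| < 1 / ((kj.1:ℝ) + 1) →
      |ρ s' - ρ s| ≤ ε * c0 * |s' - s|} ∩ {s : ℝ | ⌊s * ((kj.1:ℝ) + 1)⌋ = kj.2} with hQ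
    have hQm : ∀ kj, MeasurableSet (Q kj) := by
      intro kj
      refine (closed_loc (f := fun s s' => |ρ s' - ρ s|) (g := fun s s' => ε * c0 * |s' - s|)
        (fun s' => by fun_prop) (fun s' => by fun_prop) _).measurableSet.inter ?_
      have : Measurable fun s : ℝ => ⌊s * ((kj.1:ℝ) + 1)⌋ := Int.measurable_floor.comp (by fun_prop)
      exact this (measurableSet_singleton kj.2)
    refine ⟨fun i => m ⁻¹' Q (enc i), fun i => p.cont.measurable (hQm _), ?_, ?_⟩
    · intro r hr
      have ho := (hKρ (m r) (hSK r hr)).isLittleO.bound (mul_pos hε hc0)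
      obtain ⟨δ', hδ', h⟩ := Metric.eventually_nhds_iff.1 ho
      obtain ⟨k, hk⟩ := exists_nat_one_div_lt hδ'
      obtain ⟨i, hi⟩ := henc (k, ⌊m r * ((k:ℝ) + 1)⌋)
      refine mem_iUnion.2 ⟨i, ?_⟩
      show m r ∈ Q (enc i)
      rw [hi]
      refine ⟨fun s' hs' => ?_, rfl⟩
      have h1 := h (y := s') (by rw [Real.dist_eq]; exact hs'.trans hk)
      simpa using h1
    · rintro i r ⟨hr, hri⟩ r' ⟨hr', hri'⟩
      have hri : m r ∈ Q (enc i) := hri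
      have hri' : m r' ∈ Q (enc i) := hri'
      have h1 : ⌊m r * (((enc i).1:ℝ) + 1)⌋ = ⌊m r' * (((enc i).1:ℝ) + 1)⌋ := hri.2.trans hri'.2.symm
      have hk1 : (0:ℝ) < ((enc i).1:ℝ) + 1 := by positivity
      have h2 := Int.abs_sub_lt_one_of_floor_eq_floor h1
      rw [← sub_mul, abs_mul, abs_of_pos hk1, ← lt_div_iff₀ hk1] at h2
      have h3 := hri'.1 (m r) h2
      rw [p.left, p.left] at h3
      have h4 := mul_le_mul_of_nonneg_left (hyS r' hr' r hr) hε.le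
      linarith
  have hμ1 : ∀ B ⊆ S, MeasurableSet B → radPerim (capE d β) B =
      μH[(n:ℝ) - 1] (gph B yL fun r => (fun t => rot e w (f t)) (yL r)) := by
    intro B hB hBm
    rw [radPerim_apply _ hBm, c.bdry hab (hB.trans hSab) hdc hdn hς (fun r hr => hmono d hdL r (hB hr))]
    congr 1
    refine gph_congr fun r hr => ?_
    simp only [hd, hfΦ r (hB hr)]
  have hμ2 : ∀ B ⊆ S, MeasurableSet B → radPerim (capE (fun _ => e) β) B =
      μH[(n:ℝ) - 1] (gph B yL fun r => (fun _ : ℝ => e) (yL r)) := by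
    intro B hB hBm
    rw [radPerim_apply _ hBm, c.bdry hab (hB.trans hSab) continuous_const (fun _ => c.he) hς
      (fun r hr => hmono (fun _ => e) (fun r r' => by
        simp only [sub_self, norm_zero]; positivity) r (hB hr))]
  have hSeq : radPerim (capE d β) S = radPerim (capE (fun _ => e) β) S :=
    le_antisymm
      (graph_le (D1 := fun t => rot e w (f t)) (D2 := fun _ => e) hk0 c.hfin (fun t => rot_norm c.he c.hw c.hew _) (fun _ => c.he) hDL hcL hSc.measurableSet hT ha0
        hSa hy1 hP hμ1 hμ2)
      (graph_le (D2 := fun t => rot e w (f t)) (D1 := fun _ => e) hk0 c.hfin (fun _ => c.he) (fun t => rot_norm c.he c.hw c.hew _) hcL hDL hSc.measurableSet hT ha0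
        hSa hy1 hP hμ2 hμ1)
  have hKne : K.Nonempty := by
    rw [nonempty_iff_ne_empty]
    rintro rfl
    simp at hKpos
  obtain ⟨s1, hs1, hs1le⟩ := hK.exists_isLeast hKne
  obtain ⟨s2, hs2, hs2ge⟩ := hK.exists_isGreatest hKne
  have hb1 : a < ρ s1 := (hSab ⟨s1, hs1, rfl⟩).1
  have hb2 : ρ s2 < b := (hSab ⟨s2, hs2, rfl⟩).2
  refine rigid_contra c.hn c.he c.hβ c.rig hSc.measurableSet hdc.measurable hdn ?_ hSeq
    (A1 := Ioo a (ρ s1)) (A2 := Ioo (ρ s2) b) measurableSet_Ioo measurableSet_Ioo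
    (rot_ne c.hw c.hew (mul_pos hlampos hMpos) (by linarith [Real.pi_gt_three])) ?_ ?_ ?_ ?_
  · intro r _ hrS
    have hrK : m r ∉ K := fun h => hrS (hSK' r h)
    obtain ⟨ε', hε', hball⟩ := Metric.isOpen_iff.1 hK.isClosed.isOpen_compl (m r) hrK
    obtain ⟨ε, hε, h⟩ := Metric.continuousAt_iff.1 (p.cont.continuousAt (x := r)) ε' hε'
    refine ⟨ε, hε, fun s hs => ?_⟩
    have h1 := h (x := s) (by
      rw [Real.dist_eq, abs_lt]; constructor <;> linarith [hs.1, hs.2])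
    rw [Real.dist_eq] at h1
    have h2 := abs_lt.1 h1
    have h3 : K ∩ Iic (m s) = K ∩ Iic (m r) := by
      ext x
      refine and_congr_right fun hx => ?_
      have hxb : x ∉ ball (m r) ε' := fun hb => hball hb hx
      rw [Metric.mem_ball, Real.dist_eq, abs_lt, not_and_or] at hxb
      show x ≤ m s ↔ x ≤ m r
      rcases hxb with hxb | hxb
      · constructor <;> intro _ <;> linarith
      · constructor <;> intro _ <;> linarith
    simp only [hd, hΦ, h3]
  · intro r hr
    have h1 : m r < s1 := by
      have := p.strictMono hr.2
      rwa [p.right] at this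
    have h2 : K ∩ Iic (m r) = ∅ := by
      rw [eq_empty_iff_forall_notMem]
      rintro x ⟨hx, hx'⟩
      have := hs1le hx
      have hx' : x ≤ m r := hx'
      linarith
    simp only [hd, hΦ, h2, measureReal_empty, mul_zero, rot_zero]
  · intro r hr
    have h1 : s2 < m r := by
      have := p.strictMono hr.1
      rwa [p.right] at this
    have h2 : K ∩ Iic (m r) = K := by
      refine inter_eq_left.2 fun x hx => ?_
      exact (hs2ge hx).trans h1.le
    simp only [hd, hΦ, h2]
    rfl
  · intro h0
    refine c.pos_right (hab (left_mem_Icc.2 hlt.le)) hb1 (measure_mono_null ?_ h0)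
    rintro x ⟨hx, hx'⟩
    exact ⟨⟨hx', hx⟩, ha0.trans hx'.1⟩
  · intro h0
    refine c.pos_left (hab (right_mem_Icc.2 hlt.le)) hb2 (measure_mono_null ?_ h0)
    rintro x ⟨hx, hx'⟩
    exact ⟨⟨hx', hx⟩, ha0.trans ((hSab ⟨s2, hs2, rfl⟩).1.trans hx'.1)⟩


theorem arccos_lip {δ : ℝ} (hδ : 0 < δ) : ∃ L : ℝ≥0, LipschitzOnWith L Real.arccos (Icc (-1 + δ) (1 - δ)) := by
  refine ⟨⟨1 / δ, by positivity⟩, (convex_Icc _ _).lipschitzOnWith_of_nnnorm_deriv_le ?_ ?_⟩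
  · intro x hx
    exact (Real.differentiableAt_arccos.2 ⟨by have := hx.1; intro h; linarith,
      by have := hx.2; intro h; linarith⟩)
  · intro x hx
    have key : ‖-(1 / √(1 - x ^ 2))‖ ≤ 1 / δ := by
     have h1 := hx.1
     have h2 := hx.2
     have h3 : δ ≤ √(1 - x ^ 2) := Real.le_sqrt_of_sq_le (by nlinarith)
     rw [norm_neg, Real.norm_of_nonneg (by positivity)]
     exact one_div_le_one_div_of_le hδ h3
    rw [Real.deriv_arccos]
    exact key

theorem Ctx.ac {n : ℕ} {e w : Euc n} {β yL yR : ℝ → ℝ} (c : Ctx n e w β yL yR) {a b : ℝ}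
    (hab : Icc a b ⊆ Iset yL yR) (hlt : a < b) :
    IntegrableOn (deriv fun r => Real.arccos (yL r)) (Ioo a b) ∧
      Real.arccos (yL b) - Real.arccos (yL a) = ∫ r in a..b, deriv (fun r => Real.arccos (yL r)) r := by
  obtain ⟨m, ρ, p, hp⟩ := c.exists_param hab hlt.le
  have hco : ContinuousOn yL (Icc a b) := fun r hr => (c.cont (hab hr)).continuousWithinAt
  obtain ⟨δ, hδ, hδy⟩ : ∃ δ > 0, ∀ r ∈ Icc a b, -1 + δ ≤ yL r ∧ yL r ≤ 1 - δ := by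
    obtain ⟨r1, hr1, hm1⟩ := isCompact_Icc.exists_isMinOn (nonempty_Icc.2 hlt.le) hco
    obtain ⟨r2, hr2, hm2⟩ := isCompact_Icc.exists_isMaxOn (nonempty_Icc.2 hlt.le) hco
    have p1 := (hab hr1).2.1
    have p2 := (hab hr2).2.1
    refine ⟨min (1 + yL r1) (1 - yL r2) , lt_min (by linarith [p1.1]) (by linarith [p2.2]), fun r hr => ⟨?_, ?_⟩⟩
    · have : yL r1 ≤ yL r := hm1 hr
      linarith [min_le_left (1 + yL r1) (1 - yL r2)]
    · have : yL r ≤ yL r2 := hm2 hr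
      linarith [min_le_right (1 + yL r1) (1 - yL r2)]
  obtain ⟨L, hL⟩ := arccos_lip hδ
  set η : ℝ → ℝ := fun s => yL (max a (min b (ρ s))) with hη
  have hηI : ∀ s, η s ∈ Icc (-1 + δ) (1 - δ) := fun s =>
    hδy _ ⟨le_max_left _ _, max_le hlt.le (min_le_left _ _)⟩
  have hηl : LipschitzWith 1 η := by
    refine LipschitzWith.of_dist_le_mul fun x y => ?_
    rw [Real.dist_eq, Real.dist_eq, NNReal.coe_one, one_mul]
    wlog h : x ≤ y generalizing x y
    · rw [abs_sub_comm, abs_sub_comm x y]; exact this y x (le_of_not_ge h)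
    have h1 := hp _ _ (p.strictMono'.monotone h)
    rw [p.right, p.right] at h1
    rw [abs_sub_comm, abs_sub_comm x y, abs_of_nonneg (sub_nonneg.2 h)]
    exact h1
  have hωl : LipschitzWith (L * 1) (fun s => Real.arccos (η s)) := by
    rw [← lipschitzOnWith_univ]
    exact hL.comp hηl.lipschitzOnWith (fun s _ => hηI s)
  have hout : ∀ s, s ∉ Icc (m a) (m b) → deriv (fun s => Real.arccos (η s)) s = 0 := by
    intro s hs
    rw [mem_Icc, not_and_or, not_le, not_le] at hs
    rcases hs with hs | hs
    · have : (fun s => Real.arccos (η s)) =ᶠ[𝓝 s] fun _ => Real.arccos (yL a) := by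
        filter_upwards [Iio_mem_nhds hs] with t ht
        have h1 : ρ t ≤ a := by
          have := p.strictMono'.monotone (le_of_lt ht)
          rwa [p.left] at this
        simp only [hη]
        rw [max_eq_left ((min_le_right _ _).trans h1)]
      rw [this.deriv_eq]; simp
    · have : (fun s => Real.arccos (η s)) =ᶠ[𝓝 s] fun _ => Real.arccos (yL b) := by
        filter_upwards [Ioi_mem_nhds hs] with t ht
        have h1 : b ≤ ρ t := by
          have := p.strictMono'.monotone (le_of_lt ht)
          rwa [p.left] at this
        simp only [hη]
        rw [min_eq_left h1, max_eq_right hlt.le]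
      rw [this.deriv_eq]; simp
  have hZ : ∀ᵐ s, deriv ρ s = 0 → deriv (fun s => Real.arccos (η s)) s = 0 := by
    have h0 := c.no_cantor hab hlt p hη
    have h0' := compl_mem_ae_iff.2 h0
    have ha' : ∀ᵐ s : ℝ, s ≠ m a := by simp [ae_iff]
    have hb' : ∀ᵐ s : ℝ, s ≠ m b := by simp [ae_iff]
    filter_upwards [h0', ha', hb', p.lip.ae_differentiableAt_real, hηl.ae_differentiableAt_real]
      with s hs hsa hsb hd1 hd2 hd
    by_cases hmem : s ∈ Icc (m a) (m b)
    · have hio : s ∈ Ioo (m a) (m b) :=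
        ⟨lt_of_le_of_ne hmem.1 hsa.symm, lt_of_le_of_ne hmem.2 hsb⟩
      have hη0 : deriv η s = 0 := by
        by_contra hne
        exact hs ⟨⟨hd1, hd, hd2, hne⟩, hio⟩
      have hI := hηI s
      have hA : HasDerivAt Real.arccos (-(1 / √(1 - η s ^ 2))) (η s) :=
        Real.hasDerivAt_arccos (by have := hI.1; intro h; linarith) (by have := hI.2; intro h; linarith)
      have hB := hd2.hasDerivAt
      rw [hη0] at hB
      have := (hA.comp s hB).deriv
      rw [mul_zero] at this
      exact this
    · exact hout s hmem
  have hval : ∀ r ∈ Icc a b, Real.arccos (η (m r)) = Real.arccos (yL r) := by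
    intro r hr
    simp only [hη]
    rw [p.left, pr_eq hr]
  obtain ⟨hIntg, heq⟩ := ac_of_param p hωl hZ hlt.le
  have hder : ∀ r ∈ Ioo a b, deriv ((fun s => Real.arccos (η s)) ∘ m) r = deriv (fun r => Real.arccos (yL r)) r := by
    intro r hr
    apply EventuallyEq.deriv_eq
    filter_upwards [Icc_mem_nhds hr.1 hr.2] with t ht
    exact hval t ht
  refine ⟨?_, ?_⟩
  · exact (hIntg.mono_set Ioo_subset_Icc_self).congr_fun hder measurableSet_Ioo
  · rw [hval a (left_mem_Icc.2 hlt.le), hval b (right_mem_Icc.2 hlt.le)] at heq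
    rw [heq, intervalIntegral.integral_of_le hlt.le, intervalIntegral.integral_of_le hlt.le,
      integral_Ioc_eq_integral_Ioo, integral_Ioc_eq_integral_Ioo]
    exact setIntegral_congr_fun measurableSet_Ioo hder


/-- **Theorem 1.2, (i) ⟹ (ii).** If rigidity holds for the perimeter inequality under
spherical symmetrisation, then `{0 < α_v^∧ ≤ α_v^∨ < π}` is an interval and `α_v` is
`W^{1,1}_loc` in its interior. -/
theorem spherical_rigidity_necessary
    (n : ℕ) (hn : 2 ≤ n)
    (v : ℝ → ℝ) (hv_meas : Measurable v) (hv_nonneg : ∀ r ∈ Ioi (0:ℝ), 0 ≤ v r)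
    (hv_le : ∀ᵐ r ∂(volume.restrict (Ioi (0:ℝ))),
      v r ≤ (n : ℝ) * omegaBall n * r ^ (n - 1))
    (α : ℝ → ℝ) (hα_meas : Measurable α) (hα_mem : ∀ r, α r ∈ Icc (0:ℝ) Real.pi)
    (hα : ∀ᵐ r ∂(volume.restrict (Ioi (0:ℝ))),
      μH[(n : ℝ) - 1] (capSet (e1 n (by omega)) r (α r)) = ENNReal.ofReal (v r))
    (hF_perim : perim (sphSymm n α (e1 n (by omega))) univ < ⊤)
    (hF_vol : volume (sphSymm n α (e1 n (by omega))) < ⊤)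
    (hrig : ∀ E : Set (Euc n), MeasurableSet E → SphDistrib v E →
      perim E univ = perim (sphSymm n α (e1 n (by omega))) univ →
      ∃ R : Euc n ≃ₗᵢ[ℝ] Euc n, volume (symmDiff E (R '' (sphSymm n α (e1 n (by omega))))) = 0) :
    Set.OrdConnected {r : ℝ | 0 < r ∧ 0 < apInf α r ∧ apInf α r ≤ apSup α r ∧ apSup α r < Real.pi} ∧
      W11locOn α (interior {r : ℝ | 0 < r ∧ 0 < apInf α r ∧ apInf α r ≤ apSup α r ∧ apSup α r < Real.pi}) := by
  set I : Set ℝ := {r : ℝ | 0 < r ∧ 0 < apInf α r ∧ apInf α r ≤ apSup α r ∧ apSup α r < Real.pi} with hI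
  set e : Euc n := e1 n (by omega) with he_def
  have he : ‖e‖ = 1 := norm_e1 _
  set β : ℝ → ℝ := fun r => Real.cos (α r) with hβ_def
  have hβ : Measurable β := Real.measurable_cos.comp hα_meas
  have hβ1 : ∀ r, β r ∈ Icc (-1:ℝ) 1 := fun r => ⟨Real.neg_one_le_cos _, Real.cos_le_one _⟩
  have hFeq : sphSymm n α e = capE (fun _ => e) β := sphSymm_eq hα_mem he
  rw [hFeq] at hF_perim hrig
  have hF : radPerim (capE (fun _ => e) β) univ < ⊤ := by rw [radPerim_univ]; exact hF_perim
  haveI : IsFiniteMeasure (radPerim (capE (fun _ => e1 n (by omega)) β)) := ⟨hF⟩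
  have hexL : ∀ r : ℝ, ∃ y, 0 < r → y ∈ Icc (-1:ℝ) 1 ∧ LLim β r y := by
    intro r
    by_cases hr : 0 < r
    · obtain ⟨y, hy, h⟩ := exists_LLim hn hβ hβ1 hr
      exact ⟨y, fun _ => ⟨hy, h⟩⟩
    · exact ⟨0, fun h => absurd h hr⟩
  have hexR : ∀ r : ℝ, ∃ y, 0 < r → y ∈ Icc (-1:ℝ) 1 ∧ RLim β r y := by
    intro r
    by_cases hr : 0 < r
    · obtain ⟨y, hy, h⟩ := exists_RLim hn hβ hβ1 hr
      exact ⟨y, fun _ => ⟨hy, h⟩⟩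
    · exact ⟨0, fun h => absurd h hr⟩
  choose yL hyL using hexL
  choose yR hyR using hexR
  have hIeq : I = Iset yL yR := by
    ext r
    constructor
    · rintro ⟨hr, h⟩
      exact ⟨hr, (mem_I_iff hα_mem (hyL r hr).1 (hyR r hr).1 (hyL r hr).2 (hyR r hr).2).1 h⟩
    · rintro ⟨hr, h⟩
      exact ⟨hr, (mem_I_iff hα_mem (hyL r hr).1 (hyR r hr).1 (hyL r hr).2 (hyR r hr).2).2 h⟩
  clear_value I
  subst hIeq
  rcases (Iset yL yR).eq_empty_or_nonempty with hemp | ⟨r0, hr0⟩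
  · rw [hemp]
    refine ⟨ordConnected_empty, ?_⟩
    rw [interior_empty]
    refine ⟨α, fun _ => 0, by simp, fun x hx => absurd hx (notMem_empty x), fun a b h => ?_⟩
    exact absurd (h left_mem_uIcc) (notMem_empty a)
  have hfin : μH[(n:ℝ) - 1] (sphere (0 : Euc n) 1) < ⊤ := by
    have hev : ∀ᶠ x in 𝓝[>] r0 ⊓ ae (volume : Measure ℝ), β x < 1 :=
      (hyR r0 hr0.1).2 (Iio_mem_nhds hr0.2.2.2)
    have h1 := freq_right hev.frequently one_pos
    have h2 : volume {r | ¬ (r ∈ Ioi (0:ℝ) → μH[(n : ℝ) - 1] (capSet e r (α r)) = ENNReal.ofReal (v r))} = 0 :=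
      ae_iff.1 ((ae_restrict_iff' measurableSet_Ioi).1 hα)
    obtain ⟨r, ⟨hr1, hr2⟩, hr3⟩ : ∃ r, r ∈ ({x | β x < 1} ∩ Ioo r0 (r0 + 1)) ∧
        (r ∈ Ioi (0:ℝ) → μH[(n : ℝ) - 1] (capSet e r (α r)) = ENNReal.ofReal (v r)) := by
      by_contra hcon
      push Not at hcon
      refine h1 (measure_mono_null (fun r hr => ?_) h2)
      intro h
      exact (hcon r hr).2 (h (hcon r hr).1)
    have hrpos : 0 < r := hr0.1.trans hr2.1
    have h3 := hr3 hrpos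
    rw [capSet_scale he (hα_mem r) hrpos, hmeas_smul (by omega) hrpos] at h3
    refine sphere_finite he (y := β r) hr1 ?_
    refine lt_top_iff_ne_top.2 fun htop => ?_
    rw [show ucap e (Real.cos (α r)) = ucap e (β r) from rfl, htop] at h3
    have hne : ENNReal.ofReal r ^ ((n:ℝ) - 1) ≠ 0 := by
      intro h0
      rw [ENNReal.rpow_eq_zero_iff] at h0
      rcases h0 with h0 | h0
      · exact (ENNReal.ofReal_pos.2 hrpos).ne' h0.1
      · exact ENNReal.ofReal_ne_top h0.1
    rw [ENNReal.mul_top hne] at h3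
    exact ENNReal.ofReal_ne_top h3.symm
  have hrig' : Rig n e β := by
    intro d hd hd1 hP
    refine hrig _ (capE_measurable hd hβ) (sphDistrib_capE (by omega) he hα_mem hα hd1) ?_
    rw [← radPerim_univ, ← radPerim_univ]; exact hP
  set w : Euc n := EuclideanSpace.single ⟨1, by omega⟩ 1 with hw_def
  have c : Ctx n e w β yL yR :=
    { hn := hn
      he := he
      hw := by simp [hw_def]
      hew := by
        rw [he_def, hw_def, e1, EuclideanSpace.inner_single_left]
        simp
      hβ := hβ
      hβ1 := hβ1
      hfin := hfin
      hF := hF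
      rig := hrig'
      hL := fun r hr => (hyL r hr).2
      hR := fun r hr => (hyR r hr).2
      hL1 := fun r hr => (hyL r hr).1
      hR1 := fun r hr => (hyR r hr).1 }
  refine ⟨c.ordConnected, fun r => Real.arccos (yL r), deriv fun r => Real.arccos (yL r), ?_, ?_, ?_⟩
  · rw [ae_restrict_iff' isOpen_interior.measurableSet, ae_iff]
    refine measure_mono_null (fun r hr => ?_) c.ae_eq
    have hr' : ¬ (r ∈ interior (Iset yL yR) → Real.arccos (yL r) = α r) := hr
    push Not at hr'
    refine ⟨interior_subset hr'.1, fun h => hr'.2 ?_⟩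
    rw [← h]
    exact Real.arccos_cos (hα_mem r).1 (hα_mem r).2
  · intro x hx
    obtain ⟨ε, hε, hb⟩ := Metric.isOpen_iff.1 isOpen_interior x hx
    have hsub : Icc (x - ε / 2) (x + ε / 2) ⊆ Iset yL yR := by
      intro t ht
      refine interior_subset (hb ?_)
      rw [Metric.mem_ball, Real.dist_eq, abs_lt]
      constructor <;> linarith [ht.1, ht.2]
    refine ⟨Ioo (x - ε / 2) (x + ε / 2), mem_nhdsWithin_of_mem_nhds (Ioo_mem_nhds (by linarith) (by linarith)),
      (c.ac hsub (by linarith)).1⟩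
  · intro a b hab
    rcases lt_trichotomy a b with h | h | h
    · rw [uIcc_of_le h.le] at hab
      exact (c.ac (hab.trans interior_subset) h).2
    · subst h; simp
    · rw [uIcc_of_ge h.le] at hab
      have := (c.ac (hab.trans interior_subset) h).2
      rw [intervalIntegral.integral_symm]
      linarith
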